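/- arXiv:2405.12088 — 2 statements merged into one kernel-verified Lean document; each statement's English description precedes it below -/
import Mathlib

section
/- There exists a real constant C with 0.6919 ≤ C ≤ 0.7136 such that F_{3,3}(n)/n converges to C as n → ∞; that is, F_{3,3}(n) = (C + o(1))·n. -/
open Finset Filter

/-- `Fkd k d n` is the maximum cardinality of a set `A ⊆ {1,…,n}` such that there are no
`a_1 < a_2 < ⋯ < a_k` in `A` and positive integer `x` with `a_1 ⋯ a_k = x ^ d`. -/
noncomputable def Fkd (k d n : ℕ) : ℕ :=
  sSup {m : ℕ | ∃ A : Finset ℕ, A ⊆ Finset.Icc 1 n ∧ A.card = m ∧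
    ∀ (a : Fin k → ℕ) (x : ℕ), (∀ i, a i ∈ A) → StrictMono a → 0 < x →
      (∏ i, a i) ≠ x ^ d}

/-- no three distinct elements with product a cube -/
def TF (A : Finset ℕ) : Prop :=
  ∀ a ∈ A, ∀ b ∈ A, ∀ c ∈ A, a ≠ b → a ≠ c → b ≠ c → ∀ x : ℕ, a * b * c ≠ x ^ 3

lemma TF.mono {A B : Finset ℕ} (h : TF B) (hAB : A ⊆ B) : TF A :=
  fun a ha b hb c hc => h a (hAB ha) b (hAB hb) c (hAB hc)

lemma TF_iff {n : ℕ} {A : Finset ℕ} (hA : A ⊆ Icc 1 n) :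
    TF A ↔ ∀ (a : Fin 3 → ℕ) (x : ℕ), (∀ i, a i ∈ A) → StrictMono a → 0 < x →
      (∏ i, a i) ≠ x ^ 3 := by
  constructor
  · intro h a x ha hm _ he
    rw [Fin.prod_univ_three] at he
    exact h _ (ha 0) _ (ha 1) _ (ha 2) (hm (by decide)).ne (hm (by decide)).ne
      (hm (by decide)).ne x he
  · intro h
    have key : ∀ a ∈ A, ∀ b ∈ A, ∀ c ∈ A, a < b → b < c → ∀ x : ℕ, a * b * c ≠ x ^ 3 := by
      intro a ha b hb c hc hab hbc x he
      have hx : 0 < x := by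
        rcases Nat.eq_zero_or_pos x with h0 | h0
        · subst h0
          have h1 := (mem_Icc.1 (hA ha)).1
          have h2 := (mem_Icc.1 (hA hb)).1
          have h3 := (mem_Icc.1 (hA hc)).1
          have : 0 < a * b * c := by positivity
          simp at he; omega
        · exact h0
      refine h ![a, b, c] x ?_ ?_ hx ?_
      · intro i; fin_cases i <;> simpa
      · intro i j hij
        fin_cases i <;> fin_cases j <;> simp at hij ⊢ <;> omega
      · rw [Fin.prod_univ_three]; simpa using he
    intro a ha b hb c hc hab hac hbc x he
    rcases lt_or_gt_of_ne hab with h1 | h1 <;> rcases lt_or_gt_of_ne hac with h2 | h2 <;>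
      rcases lt_or_gt_of_ne hbc with h3 | h3
    · exact key a ha b hb c hc h1 h3 x he
    · exact key a ha c hc b hb h2 h3 x (by rw [← he]; ring)
    · omega
    · exact key c hc a ha b hb h2 h1 x (by rw [← he]; ring)
    · exact key b hb a ha c hc h1 h2 x (by rw [← he]; ring)
    · omega
    · exact key b hb c hc a ha h3 h2 x (by rw [← he]; ring)
    · exact key c hc b hb a ha h3 h1 x (by rw [← he]; ring)

lemma Fkd_bdd (n : ℕ) : BddAbove {m : ℕ | ∃ A : Finset ℕ, A ⊆ Finset.Icc 1 n ∧ A.card = m ∧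
    ∀ (a : Fin 3 → ℕ) (x : ℕ), (∀ i, a i ∈ A) → StrictMono a → 0 < x →
      (∏ i, a i) ≠ x ^ 3} := by
  refine ⟨n, ?_⟩
  rintro m ⟨A, hA, rfl, -⟩
  simpa using card_le_card hA

lemma le_F {n : ℕ} {A : Finset ℕ} (hA : A ⊆ Icc 1 n) (h : TF A) : A.card ≤ Fkd 3 3 n :=
  le_csSup (Fkd_bdd n) ⟨A, hA, rfl, (TF_iff hA).1 h⟩

lemma exists_F (n : ℕ) : ∃ A : Finset ℕ, A ⊆ Icc 1 n ∧ TF A ∧ A.card = Fkd 3 3 n := by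
  have hne : {m : ℕ | ∃ A : Finset ℕ, A ⊆ Finset.Icc 1 n ∧ A.card = m ∧
    ∀ (a : Fin 3 → ℕ) (x : ℕ), (∀ i, a i ∈ A) → StrictMono a → 0 < x →
      (∏ i, a i) ≠ x ^ 3}.Nonempty := by
    refine ⟨0, ∅, by simp, by simp, ?_⟩
    intro a x h
    simpa using h 0
  obtain ⟨A, hA, hc, h⟩ := Nat.sSup_mem hne (Fkd_bdd n)
  exact ⟨A, hA, (TF_iff hA).2 h, hc⟩

lemma cube_of_fact {n : ℕ} (hn : n ≠ 0) (h : ∀ p, p.Prime → 3 ∣ n.factorization p) : ∃ x, n = x ^ 3 := by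
  refine ⟨∏ p ∈ n.primeFactors, p ^ (n.factorization p / 3), ?_⟩
  conv_lhs => rw [← Nat.prod_factorization_pow_eq_self hn]
  rw [Finsupp.prod, Nat.support_factorization, ← Finset.prod_pow]
  refine Finset.prod_congr rfl fun p hp => ?_
  rw [← pow_mul, Nat.div_mul_cancel (h p (Nat.prime_of_mem_primeFactors hp))]

lemma fact_of_cube {n x : ℕ} (h : n = x ^ 3) (p : ℕ) : 3 ∣ n.factorization p := by
  subst h; simp [Nat.factorization_pow]

lemma fact_mul3 {a b c : ℕ} (ha : a ≠ 0) (hb : b ≠ 0) (hc : c ≠ 0) (p : ℕ) :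
    (a * b * c).factorization p = a.factorization p + b.factorization p + c.factorization p := by
  rw [Nat.factorization_mul (mul_ne_zero ha hb) hc, Nat.factorization_mul ha hb]; simp


/-- integers up to `n` divisible by no element of `D` -/
def Rg (D : Finset ℕ) (n : ℕ) : Finset ℕ := (Icc 1 n).filter (fun v => ∀ d ∈ D, ¬ d ∣ v)

lemma div_ratio (k : ℕ) (hk : 0 < k) :
    Tendsto (fun n : ℕ => ((n / k : ℕ) : ℝ) / n) atTop (nhds (1 / k)) := by
  have h0 : Tendsto (fun n : ℕ => (1 / k : ℝ) - 1 / n) atTop (nhds (1 / k)) := by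
    simpa using tendsto_const_nhds.sub (tendsto_one_div_atTop_nhds_zero_nat (𝕜 := ℝ))
  have hk' : (0 : ℝ) < k := by exact_mod_cast hk
  refine tendsto_of_tendsto_of_tendsto_of_le_of_le' h0 tendsto_const_nhds ?_ ?_
  · filter_upwards [eventually_gt_atTop 0] with n hn
    have hn' : (0 : ℝ) < n := by exact_mod_cast hn
    have : (n : ℝ) < k * ((n / k : ℕ) + 1) := by
      exact_mod_cast Nat.lt_mul_div_succ n hk
    rw [div_sub_div _ _ hk'.ne' hn'.ne', div_le_div_iff₀ (by positivity) hn']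
    nlinarith
  · filter_upwards [eventually_gt_atTop 0] with n hn
    have hn' : (0 : ℝ) < n := by exact_mod_cast hn
    rw [div_le_div_iff₀ hn' hk', one_mul]
    exact_mod_cast Nat.div_mul_le_self n k

lemma tendsto_div_nat {g : ℕ → ℝ} {c : ℝ} (h : Tendsto (fun n : ℕ => g n / n) atTop (nhds c))
    (k : ℕ) (hk : 0 < k) : Tendsto (fun n : ℕ => g (n / k) / n) atTop (nhds (c / k)) := by
  have h1 := (h.comp (Nat.tendsto_div_const_atTop hk.ne')).mul (div_ratio k hk)
  rw [mul_one_div] at h1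
  refine h1.congr' ?_
  filter_upwards [eventually_ge_atTop k] with n hn
  have : (0 : ℝ) < (n / k : ℕ) := by exact_mod_cast Nat.div_pos hn hk
  simp only [Function.comp]
  field_simp

lemma Rg_insert (D : Finset ℕ) (q : ℕ) (hq : 0 < q) (hc : ∀ d ∈ D, Nat.Coprime q d) (n : ℕ) :
    (Rg (insert q D) n).card + (Rg D (n / q)).card = (Rg D n).card := by
  have h1 : Rg (insert q D) n = (Rg D n).filter (fun v => ¬ q ∣ v) := by
    ext v; simp [Rg]; tauto
  have h2 : (Rg D (n / q)).card = ((Rg D n).filter (fun v => q ∣ v)).card := by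
    refine Finset.card_bij (fun w _ => q * w) ?_ ?_ ?_
    · intro w hw
      simp only [Rg, mem_filter, mem_Icc] at hw ⊢
      obtain ⟨⟨h1, h2⟩, h3⟩ := hw
      refine ⟨⟨⟨Nat.mul_pos hq h1, ?_⟩, ?_⟩, dvd_mul_right _ _⟩
      · rw [Nat.le_div_iff_mul_le hq] at h2; rwa [mul_comm]
      · intro d hd hdv
        exact h3 d hd (((hc d hd).symm).dvd_of_dvd_mul_left hdv)
    · intro a _ b _ hab
      exact Nat.eq_of_mul_eq_mul_left hq hab
    · intro b hb
      simp only [Rg, mem_filter, mem_Icc] at hb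
      obtain ⟨⟨⟨h1, h2⟩, h3⟩, w, rfl⟩ := hb
      refine ⟨w, ?_, rfl⟩
      simp only [Rg, mem_filter, mem_Icc]
      refine ⟨⟨Nat.pos_of_mul_pos_left h1, ?_⟩, ?_⟩
      · rw [Nat.le_div_iff_mul_le hq]; rwa [mul_comm]
      · intro d hd hdv
        exact h3 d hd (hdv.mul_left q)
  rw [h1, h2, add_comm]
  exact Finset.card_filter_add_card_filter_not _

lemma dens (D : Finset ℕ) : (∀ d ∈ D, 0 < d) → (∀ d ∈ D, ∀ e ∈ D, d ≠ e → Nat.Coprime d e) →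
    Tendsto (fun n : ℕ => ((Rg D n).card : ℝ) / n) atTop (nhds (∏ d ∈ D, (1 - 1 / (d : ℝ)))) := by
  induction D using Finset.induction_on with
  | empty =>
    intro _ _
    simp only [prod_empty]
    refine tendsto_const_nhds.congr' ?_
    filter_upwards [eventually_gt_atTop 0] with n hn
    have hn' : (0 : ℝ) < n := by exact_mod_cast hn
    simp [Rg, hn'.ne']
  | insert q D hq ih =>
    intro h1 h2
    have h3 := ih (fun d hd => h1 d (mem_insert_of_mem hd))
      (fun d hd e he => h2 d (mem_insert_of_mem hd) e (mem_insert_of_mem he))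
    have hq0 := h1 q (mem_insert_self _ _)
    have h4 := h3.sub (tendsto_div_nat (g := fun n => ((Rg D n).card : ℝ)) h3 q hq0)
    rw [prod_insert hq]
    convert h4 using 1
    · ext n
      have := Rg_insert D q hq0 (fun d hd => h2 q (mem_insert_self _ _) d (mem_insert_of_mem hd)
        (by rintro rfl; exact hq hd)) n
      rw [← this]; push_cast; ring
    · congr 1; ring

/-- number of elements of `U` that are at most `t` -/
def cu (U : List ℕ) (t : ℕ) : ℕ := U.countP (fun u => decide (u ≤ t))

lemma sum_cu (D : Finset ℕ) (U : List ℕ) (hU : ∀ u ∈ U, 0 < u) (n : ℕ) :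
    ∑ v ∈ Rg D n, cu U (n / v) = (U.map (fun u => (Rg D (n / u)).card)).sum := by
  induction U with
  | nil => simp [cu]
  | cons u U ih =>
    have hu := hU u (by simp)
    have := ih (fun w hw => hU w (by simp [hw]))
    simp only [cu, List.countP_cons, sum_add_distrib, List.map_cons, List.sum_cons] at this ⊢
    rw [this, add_comm]
    congr 1
    simp only [decide_eq_true_eq]
    rw [← Finset.card_filter]
    congr 1
    ext v
    simp only [Rg, mem_filter, mem_Icc]
    constructor
    · rintro ⟨⟨⟨h1, h2⟩, h3⟩, h4⟩
      rw [Nat.le_div_iff_mul_le h1] at h4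
      exact ⟨⟨h1, (Nat.le_div_iff_mul_le hu).2 (by rwa [mul_comm])⟩, h3⟩
    · rintro ⟨⟨h1, h2⟩, h3⟩
      rw [Nat.le_div_iff_mul_le hu] at h2
      refine ⟨⟨⟨h1, ?_⟩, h3⟩, (Nat.le_div_iff_mul_le h1).2 (by rwa [mul_comm])⟩
      nlinarith

lemma tendsto_sum_cu (D : Finset ℕ) (hD : ∀ d ∈ D, 0 < d)
    (hc : ∀ d ∈ D, ∀ e ∈ D, d ≠ e → Nat.Coprime d e) (U : List ℕ) (hU : ∀ u ∈ U, 0 < u) :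
    Tendsto (fun n : ℕ => ((∑ v ∈ Rg D n, cu U (n / v) : ℕ) : ℝ) / n) atTop
      (nhds ((∏ d ∈ D, (1 - 1 / (d : ℝ))) * (U.map (fun u : ℕ => 1 / (u : ℝ))).sum)) := by
  simp only [sum_cu D U hU]
  induction U with
  | nil => simp
  | cons u U ih =>
    have hu := hU u (by simp)
    have := ih (fun w hw => hU w (by simp [hw]))
    have h2 := (tendsto_div_nat (g := fun n => ((Rg D n).card : ℝ)) (dens D hD hc) u hu).add this
    simp only [List.map_cons, List.sum_cons]
    convert h2 using 1
    · ext n; push_cast; ring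
    · congr 1; ring

/-- a monotone bounded function vanishing at zero is a counting function -/
lemma exists_cu (f : ℕ → ℕ) (hf : Monotone f) (B : ℕ) (hB : ∀ t, f t ≤ B) (h0 : f 0 = 0) :
    ∃ U : List ℕ, (∀ u ∈ U, 0 < u) ∧ ∀ t, f t = cu U t := by
  induction B generalizing f with
  | zero => exact ⟨[], by simp, fun t => by simpa [cu] using hB t⟩
  | succ B ih =>
    by_cases h : ∃ t, f t = B + 1
    · classical
      obtain ⟨U, hU, hUf⟩ := ih (fun t => min (f t) B) (fun a b hab => by
        have := hf hab
        simp only [le_min_iff, min_le_iff]; omega) (fun t => min_le_right _ _) (by simp [h0])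
      refine ⟨Nat.find h :: U, ?_, ?_⟩
      · intro u hu
        rcases List.mem_cons.1 hu with rfl | hu
        · rw [Nat.pos_iff_ne_zero]
          intro hz
          have := Nat.find_spec h
          rw [hz, h0] at this; omega
        · exact hU u hu
      · intro t
        have h1 := hUf t
        simp only [cu, List.countP_cons, decide_eq_true_eq] at h1 ⊢
        rw [← h1]
        split_ifs with hle
        · have := hf hle
          rw [Nat.find_spec h] at this
          have := hB t
          omega
        · have : f t ≠ B + 1 := fun he => hle (Nat.find_min' h he)
          have := hB t
          omega
    · push Not at h
      exact ih f hf (fun t => by have := hB t; have := h t; omega) h0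


/-- all prime factors below `N` -/
def Sm (N u : ℕ) : Prop := ∀ p, p.Prime → p ∣ u → p < N

lemma decomp (N a : ℕ) : a ≠ 0 → ∃ u v : ℕ, Sm N u ∧ (∀ d ∈ Nat.primesBelow N, ¬ d ∣ v) ∧ a = u * v := by
  induction a using induction_on_primes with
  | zero => intro h; exact absurd rfl h
  | one =>
    intro _
    refine ⟨1, 1, ?_, ?_, rfl⟩
    · intro p hp h; exact absurd (Nat.dvd_one.1 h) hp.one_lt.ne'
    · intro d hd h
      exact absurd (Nat.dvd_one.1 h) (Nat.prime_of_mem_primesBelow hd).one_lt.ne'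
  | prime_mul p a hp ih =>
    intro h
    obtain ⟨u, v, hu, hv, rfl⟩ := ih (right_ne_zero_of_mul h)
    by_cases hpN : p < N
    · refine ⟨p * u, v, ?_, hv, by ring⟩
      intro q hq hqd
      rcases hq.dvd_mul.1 hqd with h1 | h1
      · rwa [(Nat.prime_dvd_prime_iff_eq hq hp).1 h1]
      · exact hu q hq h1
    · refine ⟨u, p * v, hu, ?_, by ring⟩
      intro d hd hdv
      have hdp := Nat.prime_of_mem_primesBelow hd
      rcases hdp.dvd_mul.1 hdv with h1 | h1
      · have := Nat.lt_of_mem_primesBelow hd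
        rw [(Nat.prime_dvd_prime_iff_eq hdp hp).1 h1] at this
        exact hpN this
      · exact hv d hd h1

lemma sm_coprime {N u v : ℕ} (hu : Sm N u) (hv : ∀ d ∈ Nat.primesBelow N, ¬ d ∣ v) :
    Nat.Coprime u v := by
  rw [Nat.coprime_iff_isRelPrime] at *
  rw [← Nat.coprime_iff_isRelPrime]
  refine Nat.coprime_of_dvd ?_
  intro p hp h1 h2
  exact hv p (Nat.mem_primesBelow.2 ⟨hu p hp h1, hp⟩) h2

lemma decomp_unique {N u v u' v' : ℕ} (hu : Sm N u) (hv : ∀ d ∈ Nat.primesBelow N, ¬ d ∣ v)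
    (hu' : Sm N u') (hv' : ∀ d ∈ Nat.primesBelow N, ¬ d ∣ v') (h : u * v = u' * v')
    (hu0 : 0 < u) : u = u' ∧ v = v' := by
  have h1 : u ∣ u' := (sm_coprime hu hv').dvd_of_dvd_mul_right (h ▸ dvd_mul_right u v)
  have h2 : u' ∣ u := (sm_coprime hu' hv).dvd_of_dvd_mul_right (h ▸ dvd_mul_right u' v')
  have h3 := Nat.dvd_antisymm h1 h2
  subst h3
  exact ⟨rfl, Nat.eq_of_mul_eq_mul_left hu0 h⟩

open Classical in
/-- smooth numbers up to `t` -/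
noncomputable def smset (N t : ℕ) : Finset ℕ := (Icc 1 t).filter (fun u => Sm N u)

open Classical in
/-- maximal size of a triple-free set of smooth numbers up to `t` -/
noncomputable def fN (N t : ℕ) : ℕ := ((smset N t).powerset.filter (fun A => TF A)).sup card

lemma le_fN {N t : ℕ} {A : Finset ℕ} (hA : A ⊆ smset N t) (h : TF A) : A.card ≤ fN N t := by
  classical
  unfold fN
  exact Finset.le_sup (f := card) (by simp [hA, h])

lemma exists_fN (N t : ℕ) : ∃ A, A ⊆ smset N t ∧ TF A ∧ A.card = fN N t := by
  classical
  have hne : ((smset N t).powerset.filter (fun A => TF A)).Nonempty :=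
    ⟨∅, mem_filter.2 ⟨by simp, by intro a ha; simp at ha⟩⟩
  obtain ⟨A, hA, h⟩ := Finset.exists_mem_eq_sup _ hne card
  simp only [mem_filter, mem_powerset] at hA
  exact ⟨A, hA.1, hA.2, by unfold fN; rw [← h]⟩

lemma smset_mono {N s t : ℕ} (h : s ≤ t) : smset N s ⊆ smset N t := by
  intro u hu
  simp only [smset, mem_filter, mem_Icc] at hu ⊢
  exact ⟨⟨hu.1.1, hu.1.2.trans h⟩, hu.2⟩

lemma fN_mono (N : ℕ) : Monotone (fN N) := by
  intro s t h
  obtain ⟨A, hA, hT, hc⟩ := exists_fN N s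
  rw [← hc]
  exact le_fN (hA.trans (smset_mono h)) hT

lemma fN_zero (N : ℕ) : fN N 0 = 0 := by
  obtain ⟨A, hA, hT, hc⟩ := exists_fN N 0
  have : smset N 0 = ∅ := by simp [smset]
  rw [this, subset_empty] at hA
  rw [← hc, hA]; rfl

lemma fN_bdd (N : ℕ) : ∃ B, ∀ t, fN N t ≤ B := by
  classical
  refine ⟨(univ : Finset (Nat.primesBelow N → ZMod 3)).card * 2, fun t => ?_⟩
  obtain ⟨A, hA, hT, hc⟩ := exists_fN N t
  rw [← hc]
  by_contra hlt
  push Not at hlt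
  obtain ⟨y, -, hy⟩ := Finset.exists_lt_card_fiber_of_mul_lt_card_of_maps_to
    (f := fun a : ℕ => fun p : Nat.primesBelow N => (a.factorization p : ZMod 3))
    (s := A) (t := univ) (fun a _ => mem_univ _) hlt
  obtain ⟨a, ha, b, hb, c, hc, hab, hac, hbc⟩ := Finset.two_lt_card.1 hy
  simp only [mem_filter] at ha hb hc
  have hpos : ∀ a ∈ A, a ≠ 0 := fun a ha => by
    have := hA ha
    simp only [smset, mem_filter, mem_Icc] at this
    omega
  have ha0 := hpos a ha.1
  have hb0 := hpos b hb.1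
  have hc0 := hpos c hc.1
  obtain ⟨x, hx⟩ := cube_of_fact (n := a * b * c) (by positivity) (by
    intro p hp
    rw [fact_mul3 ha0 hb0 hc0]
    by_cases hpN : p < N
    · have hm : p ∈ Nat.primesBelow N := Nat.mem_primesBelow.2 ⟨hpN, hp⟩
      have e1 := congrFun (ha.2.trans hb.2.symm) ⟨p, hm⟩
      have e2 := congrFun (ha.2.trans hc.2.symm) ⟨p, hm⟩
      simp only [ZMod.natCast_eq_natCast_iff, Nat.ModEq] at e1 e2
      omega
    · have hz : ∀ a ∈ A, a.factorization p = 0 := by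
        intro a ha
        have := hA ha
        simp only [smset, mem_filter, mem_Icc] at this
        exact Nat.factorization_eq_zero_of_not_dvd (fun hd => hpN (this.2 p hp hd))
      rw [hz a ha.1, hz b hb.1, hz c hc.1]; simp)
  exact hT a ha.1 b hb.1 c hc.1 hab hac hbc x hx

/-- sum over rough numbers -/
noncomputable def GN (N n : ℕ) : ℕ := ∑ v ∈ Rg (Nat.primesBelow N) n, fN N (n / v)

lemma F_le_GN (N n : ℕ) : Fkd 3 3 n ≤ GN N n := by
  classical
  obtain ⟨A, hA, hT, hc⟩ := exists_F n
  have hd : ∀ a : ℕ, ∃ u v : ℕ, a ≠ 0 → (Sm N u ∧ (∀ d ∈ Nat.primesBelow N, ¬ d ∣ v) ∧ a = u * v) := by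
    intro a
    by_cases h : a = 0
    · exact ⟨0, 0, fun h' => absurd h h'⟩
    · obtain ⟨u, v, h⟩ := decomp N a h
      exact ⟨u, v, fun _ => h⟩
  choose su sv hs using hd
  rw [← hc, GN]
  have hpos : ∀ a ∈ A, a ≠ 0 ∧ a ≤ n := fun a ha => by
    have := mem_Icc.1 (hA ha); omega
  rw [Finset.card_eq_sum_card_fiberwise (f := sv) (t := Rg (Nat.primesBelow N) n)]
  · refine Finset.sum_le_sum fun v hv => ?_
    have hvpos : 0 < v := by
      simp only [Rg, mem_filter, mem_Icc] at hv; omega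
    have hinj : Set.InjOn su (A.filter (fun a => sv a = v)) := by
      intro a ha b hb hab
      simp only [coe_filter, Set.mem_ofPred_eq] at ha hb
      rw [(hs a (hpos a ha.1).1).2.2, (hs b (hpos b hb.1).1).2.2, hab, ha.2, hb.2]
    rw [← Finset.card_image_of_injOn hinj]
    refine le_fN ?_ ?_
    · intro u hu
      obtain ⟨a, ha, rfl⟩ := mem_image.1 hu
      rw [mem_filter] at ha
      obtain ⟨h1, h2, h3⟩ := hs a (hpos a ha.1).1
      simp only [smset, mem_filter, mem_Icc]
      refine ⟨⟨?_, ?_⟩, h1⟩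
      · rw [Nat.one_le_iff_ne_zero]
        intro h0
        rw [h0, zero_mul] at h3
        exact (hpos a ha.1).1 h3
      · rw [Nat.le_div_iff_mul_le hvpos, ← ha.2, ← h3]
        exact (hpos a ha.1).2
    · intro u1 h1 u2 h2 u3 h3 h12 h13 h23 x hx
      obtain ⟨a, ha, rfl⟩ := mem_image.1 h1
      obtain ⟨b, hb, rfl⟩ := mem_image.1 h2
      obtain ⟨c, hc, rfl⟩ := mem_image.1 h3
      rw [mem_filter] at ha hb hc
      refine hT a ha.1 b hb.1 c hc.1 (fun h => h12 (by rw [h])) (fun h => h13 (by rw [h]))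
        (fun h => h23 (by rw [h])) (x * v) ?_
      rw [(hs a (hpos a ha.1).1).2.2, (hs b (hpos b hb.1).1).2.2, (hs c (hpos c hc.1).1).2.2,
        ha.2, hb.2, hc.2, mul_pow, ← hx]
      ring
  · intro a ha
    obtain ⟨h1, h2, h3⟩ := hs a (hpos a ha).1
    have h4 := hpos a ha
    simp only [Rg, coe_filter, mem_Icc, Set.mem_ofPred_eq]
    have hne : su a ≠ 0 ∧ sv a ≠ 0 := by
      rw [← mul_ne_zero_iff, ← h3]; exact h4.1
    refine ⟨⟨by omega, ?_⟩, h2⟩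
    calc sv a ≤ su a * sv a := Nat.le_mul_of_pos_left _ (by omega)
      _ ≤ n := by rw [← h3]; exact h4.2

/-- the glued set -/
def glue (R : Finset ℕ) (S : ℕ → Finset ℕ) : Finset ℕ :=
  R.biUnion (fun v => (S v).image (fun u => u * v))

lemma glue_facts {N n : ℕ} {R : Finset ℕ} {S : ℕ → Finset ℕ} (hR : R ⊆ Rg (Nat.primesBelow N) n)
    (hS : ∀ v ∈ R, S v ⊆ smset N (n / v)) :
    glue R S ⊆ Icc 1 n ∧ (glue R S).card = ∑ v ∈ R, (S v).card := by
  have hRR : ∀ v ∈ R, 0 < v ∧ (∀ d ∈ Nat.primesBelow N, ¬ d ∣ v) := by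
    intro v hv
    have := hR hv
    simp only [Rg, mem_filter, mem_Icc] at this
    exact ⟨by omega, this.2⟩
  have hSS : ∀ v ∈ R, ∀ u ∈ S v, 0 < u ∧ u * v ≤ n ∧ Sm N u := by
    intro v hv u hu
    have := hS v hv hu
    simp only [smset, mem_filter, mem_Icc] at this
    exact ⟨by omega, (Nat.le_div_iff_mul_le (hRR v hv).1).1 this.1.2, this.2⟩
  constructor
  · intro a ha
    simp only [glue, mem_biUnion, mem_image] at ha
    obtain ⟨v, hv, u, hu, rfl⟩ := ha
    rw [mem_Icc]
    exact ⟨Nat.mul_pos (hSS v hv u hu).1 (hRR v hv).1, (hSS v hv u hu).2.1⟩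
  · rw [glue, card_biUnion]
    · refine sum_congr rfl fun v hv => ?_
      refine card_image_of_injective _ ?_
      intro a b hab
      exact Nat.eq_of_mul_eq_mul_right (hRR v hv).1 hab
    · intro v hv w hw hvw
      rw [Function.onFun, Finset.disjoint_left]
      intro a ha hb
      obtain ⟨u, hu, rfl⟩ := mem_image.1 ha
      obtain ⟨u', hu', h⟩ := mem_image.1 hb
      exact hvw (decomp_unique (hSS v hv u hu).2.2 (hRR v hv).2 (hSS w hw u' hu').2.2
        (hRR w hw).2 h.symm (hSS v hv u hu).1).2

lemma GN_le (N n : ℕ) : GN N n ≤ n := by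
  choose S hS hT hc using fun t => exists_fN N t
  have := glue_facts (N := N) (n := n) (R := Rg (Nat.primesBelow N) n) (S := fun v => S (n / v))
    (Subset.refl _) (fun v _ => hS _)
  have h2 := card_le_card this.1
  rw [this.2, Nat.card_Icc] at h2
  simpa [GN, hc] using h2

lemma sqfree_sum_le_F (N n : ℕ) :
    ∑ v ∈ (Rg (Nat.primesBelow N) n).filter Squarefree, fN N (n / v) ≤ Fkd 3 3 n := by
  choose S hS hT hc using fun t => exists_fN N t
  have hg := glue_facts (N := N) (n := n) (R := (Rg (Nat.primesBelow N) n).filter Squarefree)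
    (S := fun v => S (n / v)) (filter_subset _ _) (fun v _ => hS _)
  simp only [hc] at hg
  rw [← hg.2]
  refine le_F hg.1 ?_
  intro a ha b hb c hc' hab hac hbc x hx
  have hfa : ∀ a ∈ glue ((Rg (Nat.primesBelow N) n).filter Squarefree) (fun v => S (n / v)),
      ∃ u v, a = u * v ∧ u ≠ 0 ∧ v ≠ 0 ∧ u ∈ S (n / v) ∧ Squarefree v ∧ 
        (∀ p, p.Prime → p < N → v.factorization p = 0) ∧
        (∀ p, p.Prime → ¬ p < N → u.factorization p = 0) := by
    intro a ha
    simp only [glue, mem_biUnion, mem_image, mem_filter] at ha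
    obtain ⟨v, ⟨hv, hsq⟩, u, hu, rfl⟩ := ha
    have h1 := hS _ hu
    simp only [smset, mem_filter, mem_Icc] at h1
    simp only [Rg, mem_filter, mem_Icc] at hv
    refine ⟨u, v, rfl, by omega, by omega, hu, hsq, ?_, ?_⟩
    · intro p hp hpN
      exact Nat.factorization_eq_zero_of_not_dvd (hv.2 p (Nat.mem_primesBelow.2 ⟨hpN, hp⟩))
    · intro p hp hpN
      exact Nat.factorization_eq_zero_of_not_dvd (fun hd => hpN (h1.2 p hp hd))
  obtain ⟨u1, v1, rfl, hu1, hv1, hm1, hs1, hr1, hq1⟩ := hfa a ha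
  obtain ⟨u2, v2, rfl, hu2, hv2, hm2, hs2, hr2, hq2⟩ := hfa b hb
  obtain ⟨u3, v3, rfl, hu3, hv3, hm3, hs3, hr3, hq3⟩ := hfa c hc'
  have hfx : ∀ p, 3 ∣ (u1.factorization p + v1.factorization p) +
      (u2.factorization p + v2.factorization p) + (u3.factorization p + v3.factorization p) := by
    intro p
    have := fact_of_cube hx p
    rw [fact_mul3 (by positivity) (by positivity) (by positivity), Nat.factorization_mul hu1 hv1,
      Nat.factorization_mul hu2 hv2, Nat.factorization_mul hu3 hv3] at this
    simpa using this
  have hvp : ∀ p, v1.factorization p = v2.factorization p ∧ v1.factorization p = v3.factorization p := by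
    intro p
    by_cases hp : p.Prime
    · by_cases hpN : p < N
      · rw [hr1 p hp hpN, hr2 p hp hpN, hr3 p hp hpN]; simp
      · have := hfx p
        rw [hq1 p hp hpN, hq2 p hp hpN, hq3 p hp hpN] at this
        have e1 := hs1.natFactorization_le_one p
        have e2 := hs2.natFactorization_le_one p
        have e3 := hs3.natFactorization_le_one p
        omega
    · simp [Nat.factorization_eq_zero_of_not_prime _ hp]
  have e12 : v1 = v2 := Nat.eq_of_factorization_eq hv1 hv2 (fun p => (hvp p).1)
  have e13 : v1 = v3 := Nat.eq_of_factorization_eq hv1 hv3 (fun p => (hvp p).2)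
  subst e12
  subst e13
  obtain ⟨y, hy⟩ := cube_of_fact (n := u1 * u2 * u3) (by positivity) (by
    intro p hp
    rw [fact_mul3 hu1 hu2 hu3]
    have := hfx p
    omega)
  exact hT _ u1 hm1 u2 hm2 u3 hm3 (fun h => hab (by rw [h])) (fun h => hac (by rw [h]))
    (fun h => hbc (by rw [h])) y hy

lemma sum_biUnion_le' (s : Finset ℕ) (t : ℕ → Finset ℕ) (f : ℕ → ℕ) :
    ∑ a ∈ s.biUnion t, f a ≤ ∑ i ∈ s, ∑ a ∈ t i, f a := by
  induction s using Finset.induction_on with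
  | empty => simp
  | insert a s ha ih =>
    rw [Finset.biUnion_insert, Finset.sum_insert ha]
    have := Finset.sum_union_inter (s₁ := t a) (s₂ := s.biUnion t) (f := f)
    omega

lemma GN_le_F_add (N n : ℕ) :
    GN N n ≤ Fkd 3 3 n + ∑ q ∈ (Icc N n).filter Nat.Prime, GN N (n / q ^ 2) := by
  classical
  rw [GN, ← Finset.sum_filter_add_sum_filter_not _ (fun v => Squarefree v)]
  refine add_le_add (sqfree_sum_le_F N n) ?_
  have hsub : (Rg (Nat.primesBelow N) n).filter (fun v => ¬ Squarefree v) ⊆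
      ((Icc N n).filter Nat.Prime).biUnion
        (fun q => (Rg (Nat.primesBelow N) (n / q ^ 2)).image (fun w => q ^ 2 * w)) := by
    intro v hv
    simp only [Rg, mem_filter, mem_Icc] at hv
    obtain ⟨⟨⟨h1, h2⟩, h3⟩, h4⟩ := hv
    rw [Nat.squarefree_iff_prime_squarefree] at h4
    push Not at h4
    obtain ⟨q, hq, w, rfl⟩ := h4
    have hw : 0 < w := Nat.pos_of_ne_zero (by rintro rfl; simp at h1)
    simp only [mem_biUnion, mem_filter, mem_Icc, mem_image, Rg]
    refine ⟨q, ⟨⟨?_, ?_⟩, hq⟩, w, ⟨⟨hw, ?_⟩, ?_⟩, by ring⟩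
    · by_contra hlt
      exact h3 q (Nat.mem_primesBelow.2 ⟨by omega, hq⟩) (Dvd.intro (q * w) (by ring))
    · have := hq.pos
      nlinarith [Nat.mul_pos this hw]
    · rw [Nat.le_div_iff_mul_le (by have := hq.pos; positivity)]
      nlinarith
    · intro d hd hdw
      exact h3 d hd (hdw.mul_left _)
  refine (Finset.sum_le_sum_of_subset hsub).trans ?_
  refine (sum_biUnion_le' _ _ _).trans ?_
  refine Finset.sum_le_sum fun q hq => ?_
  rw [mem_filter] at hq
  have hq0 := hq.2.pos
  rw [Finset.sum_image (by
    intro a _ b _ hab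
    exact Nat.eq_of_mul_eq_mul_left (by positivity) hab)]
  rw [GN]
  refine Finset.sum_le_sum fun w _ => ?_
  rw [Nat.div_div_eq_div_mul]


lemma tail_sum (M : ℕ) (hM : 0 < M) (n : ℕ) :
    ∑ q ∈ Icc (M + 1) n, (1 : ℝ) / (q : ℝ) ^ 2 ≤ 1 / M := by
  have hM' : (0 : ℝ) < M := by exact_mod_cast hM
  rcases le_or_gt n M with h | h
  · rw [Icc_eq_empty (by omega)]; simp
  · have key : ∀ n, M ≤ n → ∑ q ∈ Icc (M + 1) n, (1 : ℝ) / (q : ℝ) ^ 2 ≤ 1 / M - 1 / n := by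
      intro n hn
      induction n, hn using Nat.le_induction with
      | base => rw [Icc_eq_empty (by omega)]; simp
      | succ n hn ih =>
        have hn' : (0 : ℝ) < n := by exact_mod_cast (by omega : 0 < n)
        rw [Finset.sum_Icc_succ_top (by omega)]
        have : (1 : ℝ) / ((n + 1 : ℕ) : ℝ) ^ 2 ≤ 1 / n - 1 / ((n + 1 : ℕ) : ℝ) := by
          push_cast
          rw [div_sub_div _ _ hn'.ne' (by positivity), div_le_div_iff₀ (by positivity) (by positivity)]
          nlinarith
        linarith
    have := key n h.le
    have h3 : (0 : ℝ) ≤ 1 / n := by positivity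
    linarith

lemma GN_tendsto (N : ℕ) : ∃ U : List ℕ, (∀ t, fN N t = cu U t) ∧
    (∀ u ∈ U, 0 < u) ∧ 
    Tendsto (fun n : ℕ => (GN N n : ℝ) / n) atTop
      (nhds ((∏ d ∈ Nat.primesBelow N, (1 - 1 / (d : ℝ))) * (U.map (fun u : ℕ => 1 / (u : ℝ))).sum)) := by
  obtain ⟨B, hB⟩ := fN_bdd N
  obtain ⟨U, hU, hf⟩ := exists_cu (fN N) (fN_mono N) B hB (fN_zero N)
  refine ⟨U, hf, hU, ?_⟩
  simp only [GN, hf]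
  refine tendsto_sum_cu _ ?_ ?_ U hU
  · intro d hd; exact (Nat.prime_of_mem_primesBelow hd).pos
  · intro d hd e he hne
    exact (Nat.coprime_primes (Nat.prime_of_mem_primesBelow hd)
      (Nat.prime_of_mem_primesBelow he)).2 hne

lemma F_lower (N M : ℕ) (hM : 0 < M) (n : ℕ) :
    (GN N n : ℝ) ≤ (Fkd 3 3 n : ℝ) + ∑ q ∈ (Icc N M).filter Nat.Prime, (GN N (n / q ^ 2) : ℝ)
      + n / M := by
  have h1 : (GN N n : ℝ) ≤ (Fkd 3 3 n : ℝ) +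
      ∑ q ∈ (Icc N n).filter Nat.Prime, (GN N (n / q ^ 2) : ℝ) := by
    exact_mod_cast GN_le_F_add N n
  have h2 : (Icc N n).filter Nat.Prime ⊆ (Icc N M).filter Nat.Prime ∪ Icc (M + 1) n := by
    intro q hq
    simp only [mem_filter, mem_Icc, mem_union] at hq ⊢
    by_cases h : q ≤ M
    · left; exact ⟨⟨hq.1.1, h⟩, hq.2⟩
    · right; omega
  have h3 : ∑ q ∈ (Icc N n).filter Nat.Prime, (GN N (n / q ^ 2) : ℝ) ≤
      ∑ q ∈ (Icc N M).filter Nat.Prime, (GN N (n / q ^ 2) : ℝ) +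
      ∑ q ∈ Icc (M + 1) n, (GN N (n / q ^ 2) : ℝ) := by
    refine (Finset.sum_le_sum_of_subset_of_nonneg h2 (fun _ _ _ => by positivity)).trans ?_
    rw [← Finset.sum_union_inter]
    have : (0 : ℝ) ≤ ∑ q ∈ (Icc N M).filter Nat.Prime ∩ Icc (M + 1) n, (GN N (n / q ^ 2) : ℝ) :=
      Finset.sum_nonneg (fun _ _ => by positivity)
    linarith
  have h4 : ∑ q ∈ Icc (M + 1) n, (GN N (n / q ^ 2) : ℝ) ≤ n / M := by
    calc ∑ q ∈ Icc (M + 1) n, (GN N (n / q ^ 2) : ℝ)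
        ≤ ∑ q ∈ Icc (M + 1) n, (n : ℝ) * (1 / (q : ℝ) ^ 2) := by
          refine Finset.sum_le_sum fun q _ => ?_
          have a1 : (GN N (n / q ^ 2) : ℝ) ≤ ((n / q ^ 2 : ℕ) : ℝ) := by
            exact_mod_cast GN_le N _
          have a2 := Nat.cast_div_le (α := ℝ) (m := n) (n := q ^ 2)
          push_cast at a2
          rw [mul_one_div]; linarith
      _ = n * ∑ q ∈ Icc (M + 1) n, (1 / (q : ℝ) ^ 2) := by rw [mul_sum]
      _ ≤ n * (1 / M) := mul_le_mul_of_nonneg_left (tail_sum M hM n) (by positivity)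
      _ = n / M := by ring
  linarith

lemma lim_exists : ∃ C : ℝ, Tendsto (fun n : ℕ => (Fkd 3 3 n : ℝ) / n) atTop (nhds C) := by
  apply cauchySeq_tendsto_of_complete
  rw [Metric.cauchySeq_iff]
  intro ε hε
  obtain ⟨M, hM⟩ := exists_nat_one_div_lt (show (0 : ℝ) < ε / 4 by linarith)
  obtain ⟨U, -, -, hG⟩ := GN_tendsto (M + 2)
  have hG' := Metric.cauchySeq_iff.1 hG.cauchySeq (ε / 2) (by linarith)
  obtain ⟨n0, hn0⟩ := hG'
  have hcl : ∀ n, 0 < n → |(Fkd 3 3 n : ℝ) / n - (GN (M + 2) n : ℝ) / n| < ε / 4 := by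
    intro n hn
    have hn' : (0 : ℝ) < n := by exact_mod_cast hn
    have h1 : (Fkd 3 3 n : ℝ) ≤ GN (M + 2) n := by exact_mod_cast F_le_GN (M + 2) n
    have h2 := F_lower (M + 2) (M + 1) (by omega) n
    rw [Icc_eq_empty (by omega)] at h2
    simp only [filter_empty, sum_empty, add_zero] at h2
    rw [← sub_div, abs_div, abs_of_pos hn', div_lt_iff₀ hn', abs_sub_comm,
      abs_of_nonneg (by linarith)]
    have h3 : (n : ℝ) / ((M + 1 : ℕ) : ℝ) = (1 / ((M : ℝ) + 1)) * n := by push_cast; ring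
    have h4 := mul_lt_mul_of_pos_right hM hn'
    linarith
  refine ⟨n0 + 1, fun m hm n hn => ?_⟩
  have h1 := hn0 m (by omega) n (by omega)
  rw [Real.dist_eq] at h1 ⊢
  have h2 := hcl m (by omega)
  have h3 := hcl n (by omega)
  rw [abs_lt] at *
  constructor <;> linarith [h1.1, h1.2, h2.1, h2.2, h3.1, h3.2]

lemma lower_C {C : ℝ} (hC : Tendsto (fun n : ℕ => (Fkd 3 3 n : ℝ) / n) atTop (nhds C))
    (N M : ℕ) (hM : 0 < M) (U : List ℕ) (hU : ∀ u ∈ U, 0 < u) (hUf : ∀ t, cu U t ≤ fN N t)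
    (hS : ∑ q ∈ (Icc N M).filter Nat.Prime, (1 : ℝ) / (q : ℝ) ^ 2 ≤ 1) :
    (∏ d ∈ Nat.primesBelow N, (1 - 1 / (d : ℝ))) * (U.map (fun u : ℕ => 1 / (u : ℝ))).sum *
      (1 - ∑ q ∈ (Icc N M).filter Nat.Prime, (1 : ℝ) / (q : ℝ) ^ 2) - 1 / M ≤ C := by
  obtain ⟨W, hW, hW0, hG⟩ := GN_tendsto N
  set c := (∏ d ∈ Nat.primesBelow N, (1 - 1 / (d : ℝ))) * (W.map (fun u : ℕ => 1 / (u : ℝ))).sum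
    with hc
  have h1 := tendsto_sum_cu (Nat.primesBelow N)
    (fun d hd => (Nat.prime_of_mem_primesBelow hd).pos)
    (fun d hd e he hne => (Nat.coprime_primes (Nat.prime_of_mem_primesBelow hd)
      (Nat.prime_of_mem_primesBelow he)).2 hne) U hU
  have h2 : (∏ d ∈ Nat.primesBelow N, (1 - 1 / (d : ℝ))) *
      (U.map (fun u : ℕ => 1 / (u : ℝ))).sum ≤ c := by
    refine le_of_tendsto_of_tendsto' h1 hG (fun n => ?_)
    refine div_le_div_of_nonneg_right ?_ (by positivity)
    exact_mod_cast Finset.sum_le_sum (fun v _ => hUf _)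
  have h3 : Tendsto (fun n : ℕ => (GN N n : ℝ) / n -
      ∑ q ∈ (Icc N M).filter Nat.Prime, (GN N (n / q ^ 2) : ℝ) / n - 1 / M) atTop
      (nhds (c - ∑ q ∈ (Icc N M).filter Nat.Prime, c / (q ^ 2 : ℕ) - 1 / M)) := by
    refine (hG.sub ?_).sub tendsto_const_nhds
    refine tendsto_finsetSum _ fun q hq => ?_
    have hq0 := (mem_filter.1 hq).2.pos
    exact tendsto_div_nat (g := fun n => (GN N n : ℝ)) hG (q ^ 2) (by positivity)
  have h4 : c - ∑ q ∈ (Icc N M).filter Nat.Prime, c / (q ^ 2 : ℕ) - 1 / M ≤ C := by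
    refine le_of_tendsto_of_tendsto h3 hC ?_
    filter_upwards [eventually_gt_atTop 0] with n hn
    have hn' : (0 : ℝ) < n := by exact_mod_cast hn
    have := F_lower N M hM n
    rw [← Finset.sum_div, ← sub_div, sub_le_iff_le_add, div_le_iff₀ hn', add_mul,
      div_mul_cancel₀ _ hn'.ne']
    have e : (1 : ℝ) / M * n = n / M := by ring
    linarith
  have h5 : ∑ q ∈ (Icc N M).filter Nat.Prime, c / ((q ^ 2 : ℕ) : ℝ) =
      c * ∑ q ∈ (Icc N M).filter Nat.Prime, (1 : ℝ) / (q : ℝ) ^ 2 := by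
    rw [mul_sum]
    refine sum_congr rfl fun q _ => ?_
    push_cast; ring
  rw [h5] at h4
  have h6 := mul_le_mul_of_nonneg_right h2 (sub_nonneg.2 hS)
  linarith


def KS : List (List ℕ) := [
  [0, 1, 3, 9, 4, 27, 10, 81, 28, 12, 30, 82, 13, 84, 36, 31, 90, 85, 37, 108, 39, 91, 109, 93, 40, 111, 94, 117, 112, 118, 120, 121],
  [0, 9, 4, 27, 6, 10, 81, 5, 28, 12, 30, 82, 13, 84, 36, 31, 19, 90, 85, 108, 55, 39, 91, 38, 109, 93, 40, 111, 94, 117, 112, 118, 120, 121],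
  [0, 3, 9, 4, 10, 28, 12, 7, 30, 82, 29, 84, 36, 31, 83, 54, 19, 90, 14, 85, 37, 91, 162, 109, 40, 111, 110, 42, 94, 117, 112, 96, 48, 118, 102, 120, 67, 121],
  [1, 3, 9, 4, 27, 6, 10, 81, 30, 82, 18, 29, 13, 84, 36, 31, 90, 14, 85, 37, 108, 55, 39, 91, 109, 93, 40, 111, 94, 117, 112, 118, 120, 121],
  [1, 3, 9, 27, 10, 81, 5, 12, 7, 30, 82, 18, 29, 13, 84, 36, 85, 37, 108, 32, 55, 39, 91, 162, 109, 93, 40, 92, 111, 94, 117, 112, 118, 120, 121],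
  [0, 1, 3, 9, 4, 27, 81, 30, 82, 29, 13, 84, 36, 31, 15, 19, 90, 14, 85, 37, 108, 39, 91, 109, 93, 40, 111, 94, 117, 112, 64, 118, 120, 121],
  [0, 1, 3, 4, 10, 28, 12, 11, 30, 82, 84, 36, 15, 54, 90, 37, 32, 39, 91, 162, 34, 86, 22, 109, 93, 45, 88, 40, 111, 99, 94, 117, 118, 113, 120, 115, 67, 126, 121],
  [0, 1, 3, 9, 4, 27, 81, 11, 13, 36, 31, 90, 33, 85, 37, 21, 108, 32, 16, 55, 87, 39, 91, 86, 93, 40, 163, 94, 46, 117, 112, 100, 114, 66, 118, 113, 120, 121, 127],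
  [0, 3, 9, 4, 10, 81, 28, 12, 7, 30, 82, 29, 84, 36, 31, 54, 19, 90, 14, 37, 108, 86, 109, 93, 40, 92, 111, 163, 42, 94, 117, 112, 48, 118, 120, 67, 121],
  [1, 3, 9, 27, 10, 81, 5, 28, 12, 7, 30, 82, 18, 13, 84, 31, 54, 90, 85, 37, 108, 39, 91, 38, 109, 93, 40, 111, 94, 117, 112, 118, 120, 121],
  [2, 10, 81, 28, 84, 19, 14, 108, 55, 39, 91, 93, 45, 63, 35, 99, 58, 110, 42, 165, 117, 41, 25, 112, 100, 95, 118, 97, 49, 120, 72, 44, 115, 167, 138, 190, 174, 121, 192, 139, 70, 216, 178, 186, 239],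
  [1, 3, 9, 27, 81, 5, 28, 12, 7, 11, 82, 84, 19, 90, 14, 33, 85, 37, 108, 39, 91, 162, 34, 38, 57, 109, 93, 40, 111, 94, 117, 112, 118, 120, 121]]

def UL : List ℕ := [1, 2, 3, 5, 6, 7, 8, 10, 11, 14, 15, 16, 21, 22, 24, 30, 33, 35, 40, 42, 48, 55, 56, 60, 66, 70, 77, 80, 88, 98, 105, 110, 120, 140, 154, 160, 165, 176, 200, 210, 224, 231, 240, 264, 280, 330, 385, 400, 440, 462, 480, 525, 528, 560, 770, 792, 840, 880, 924, 1056, 1155, 1320, 1470, 1584, 1680, 1848, 1925, 2200, 2310, 2640, 3080, 5544, 5880, 6160, 7392, 9240, 11616, 12936, 13552, 14520, 18480, 20328, 25872, 27225, 35280, 47432, 87120]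

/-- integer with base three exponent code `c` -/
def val5 (c : ℕ) : ℕ :=
  2 ^ (c % 3) * 3 ^ (c / 3 % 3) * 5 ^ (c / 9 % 3) * 7 ^ (c / 27 % 3) * 11 ^ (c / 81 % 3)

def third5 (x y : ℕ) : ℕ :=
  (6 - x % 3 - y % 3) % 3 + 3 * ((6 - x / 3 % 3 - y / 3 % 3) % 3) +
    9 * ((6 - x / 9 % 3 - y / 9 % 3) % 3) + 27 * ((6 - x / 27 % 3 - y / 27 % 3) % 3) +
    81 * ((6 - x / 81 % 3 - y / 81 % 3) % 3)

def mask (K : List ℕ) : ℕ := K.foldr (fun x m => Nat.lor (2 ^ x) m) 0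

lemma mask_spec (K : List ℕ) (z : ℕ) (hz : z ∈ K) : mask K / 2 ^ z % 2 ≠ 0 := by
  have h : ∀ K : List ℕ, z ∈ K → (mask K).testBit z = true := by
    intro K
    induction K with
    | nil => intro h; simp at h
    | cons x K ih =>
      intro h
      have e : mask (x :: K) = 2 ^ x ||| mask K := rfl
      rw [e, Nat.testBit_or]
      rcases List.mem_cons.1 h with rfl | h
      · simp [Nat.testBit_two_pow_self]
      · simp [ih h]
  have := h K hz
  rw [Nat.testBit_eq_decide_div_mod_eq] at this
  simp only [decide_eq_true_eq] at this
  omega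

def capOK (K : List ℕ) : Bool :=
  K.all (fun x => Nat.blt x 243) &&
  (let m := mask K
   K.all (fun x => K.all (fun y => Nat.ble y x || Nat.beq (m / 2 ^ third5 x y % 2) 0)))

/-- the two-layer list of a cap -/
def lay (K : List ℕ) : List ℕ := K.map val5 ++ K.map (fun c => 8 * val5 c)

lemma val5_pos (c : ℕ) : 0 < val5 c := by unfold val5; positivity

lemma val5_sm (c : ℕ) (p : ℕ) (hp : p.Prime) (h : p ∣ val5 c) : p < 12 := by
  unfold val5 at h
  simp only [hp.dvd_mul] at h
  rcases h with (((h | h) | h) | h) | h <;> have := Nat.le_of_dvd (by norm_num) (hp.dvd_of_dvd_pow h) <;>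
    omega

lemma val5_fact (c : ℕ) : (val5 c).factorization 2 = c % 3 ∧ (val5 c).factorization 3 = c / 3 % 3 ∧
    (val5 c).factorization 5 = c / 9 % 3 ∧ (val5 c).factorization 7 = c / 27 % 3 ∧
    (val5 c).factorization 11 = c / 81 % 3 := by
  unfold val5
  rw [Nat.factorization_mul (by positivity) (by positivity),
    Nat.factorization_mul (by positivity) (by positivity),
    Nat.factorization_mul (by positivity) (by positivity),
    Nat.factorization_mul (by positivity) (by positivity)]
  rw [Nat.Prime.factorization_pow (by norm_num), Nat.Prime.factorization_pow (by norm_num),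
    Nat.Prime.factorization_pow (by norm_num), Nat.Prime.factorization_pow (by norm_num),
    Nat.Prime.factorization_pow (by norm_num)]
  simp

lemma key3 (a b c : ℕ) (h : 3 ∣ a % 3 + b % 3 + c % 3) : (6 - a % 3 - b % 3) % 3 = c % 3 := by
  have ha := Nat.mod_lt a (show 3 > 0 by norm_num)
  have hb := Nat.mod_lt b (show 3 > 0 by norm_num)
  have hc := Nat.mod_lt c (show 3 > 0 by norm_num)
  generalize a % 3 = a at *
  generalize b % 3 = b at *
  generalize c % 3 = c at *
  interval_cases a <;> interval_cases b <;> interval_cases c <;> simp_all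

lemma third5_eq {x y z : ℕ} (hz : z < 243) (h0 : 3 ∣ x % 3 + y % 3 + z % 3)
    (h1 : 3 ∣ x / 3 % 3 + y / 3 % 3 + z / 3 % 3) (h2 : 3 ∣ x / 9 % 3 + y / 9 % 3 + z / 9 % 3)
    (h3 : 3 ∣ x / 27 % 3 + y / 27 % 3 + z / 27 % 3)
    (h4 : 3 ∣ x / 81 % 3 + y / 81 % 3 + z / 81 % 3) : z = third5 x y := by
  unfold third5
  rw [key3 _ _ _ h0, key3 _ _ _ h1, key3 _ _ _ h2, key3 _ _ _ h3, key3 _ _ _ h4]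
  have e9 : z / 9 = z / 3 / 3 := by rw [Nat.div_div_eq_div_mul]
  have e27 : z / 27 = z / 3 / 3 / 3 := by rw [Nat.div_div_eq_div_mul, Nat.div_div_eq_div_mul]
  have e81 : z / 81 = z / 3 / 3 / 3 / 3 := by
    rw [Nat.div_div_eq_div_mul, Nat.div_div_eq_div_mul, Nat.div_div_eq_div_mul]
  have e5 : z / 81 < 3 := Nat.div_lt_of_lt_mul (lt_of_lt_of_eq hz (by norm_num))
  rw [Nat.mod_eq_of_lt e5, e9, e27, e81]
  have f0 := Nat.div_add_mod z 3
  have f1 := Nat.div_add_mod (z / 3) 3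
  have f2 := Nat.div_add_mod (z / 3 / 3) 3
  have f3 := Nat.div_add_mod (z / 3 / 3 / 3) 3
  linarith

lemma capOK_aux {K : List ℕ} (h : capOK K = true) {x y z : ℕ} (hx : x ∈ K) (hy : y ∈ K) (hz : z ∈ K)
    (h3 : ∀ p, 3 ∣ (val5 x).factorization p + (val5 y).factorization p + (val5 z).factorization p) :
    y ≤ x := by
  simp only [capOK, Bool.and_eq_true, List.all_eq_true, Bool.or_eq_true, Nat.ble_eq, Nat.blt_eq] at h
  obtain ⟨hlt, h⟩ := h
  rcases h x hx y hy with h | h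
  · exact h
  · exfalso
    have a2 := h3 2
    have a3 := h3 3
    have a5 := h3 5
    have a7 := h3 7
    have a11 := h3 11
    obtain ⟨x2, x3, x5, x7, x11⟩ := val5_fact x
    obtain ⟨y2, y3, y5, y7, y11⟩ := val5_fact y
    obtain ⟨z2, z3, z5, z7, z11⟩ := val5_fact z
    rw [x2, y2, z2] at a2
    rw [x3, y3, z3] at a3
    rw [x5, y5, z5] at a5
    rw [x7, y7, z7] at a7
    rw [x11, y11, z11] at a11
    have e := third5_eq (hlt z hz) a2 a3 a5 a7 a11
    rw [← e] at h
    exact mask_spec K z hz (Nat.eq_of_beq_eq_true h)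

lemma capOK_eq {K : List ℕ} (h : capOK K = true) {x y z : ℕ} (hx : x ∈ K) (hy : y ∈ K) (hz : z ∈ K)
    (h3 : ∀ p, 3 ∣ (val5 x).factorization p + (val5 y).factorization p + (val5 z).factorization p) :
    x = y :=
  le_antisymm (capOK_aux h hy hx hz (fun p => by have := h3 p; omega)) (capOK_aux h hx hy hz h3)

lemma lay_TF {K : List ℕ} (h : capOK K = true) : TF (lay K).toFinset := by
  have hm : ∀ a ∈ (lay K).toFinset, ∃ x ∈ K, ∃ j : ℕ, a = 2 ^ (3 * j) * val5 x ∧ (j = 0 ∨ j = 1) := by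
    intro a ha
    simp only [lay, List.mem_toFinset, List.mem_append, List.mem_map] at ha
    rcases ha with ⟨x, hx, rfl⟩ | ⟨x, hx, rfl⟩
    · exact ⟨x, hx, 0, by simp, Or.inl rfl⟩
    · exact ⟨x, hx, 1, by norm_num, Or.inr rfl⟩
  intro a ha b hb c hc hab hac hbc w hw
  obtain ⟨x, hx, i, rfl, hi⟩ := hm a ha
  obtain ⟨y, hy, j, rfl, hj⟩ := hm b hb
  obtain ⟨z, hz, k, rfl, hk⟩ := hm c hc
  have px := val5_pos x
  have py := val5_pos y
  have pz := val5_pos z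
  have h3 : ∀ p, 3 ∣ (val5 x).factorization p + (val5 y).factorization p +
      (val5 z).factorization p := by
    intro p
    have := fact_of_cube hw p
    rw [fact_mul3 (by positivity) (by positivity) (by positivity),
      Nat.factorization_mul (by positivity) px.ne', Nat.factorization_mul (by positivity) py.ne',
      Nat.factorization_mul (by positivity) pz.ne'] at this
    simp only [Nat.factorization_pow, Finsupp.add_apply, Finsupp.smul_apply, smul_eq_mul] at this
    rw [mul_assoc, mul_assoc, mul_assoc] at this
    omega
  have e1 : x = y := capOK_eq h hx hy hz h3
  have e2 : x = z := capOK_eq h hx hz hy (fun p => by have := h3 p; omega)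
  subst e1
  subst e2
  rcases hi with rfl | rfl <;> rcases hj with rfl | rfl <;> rcases hk with rfl | rfl <;> simp_all

lemma cu_lay_le {K : List ℕ} (h : capOK K = true) (hn : (lay K).Nodup) (t : ℕ) :
    cu (lay K) t ≤ fN 12 t := by
  have e : cu (lay K) t = (((lay K).filter (fun u => decide (u ≤ t))).toFinset).card := by
    rw [List.toFinset_card_of_nodup (hn.filter _), cu, List.countP_eq_length_filter]
  rw [e]
  refine le_fN ?_ ((lay_TF h).mono ?_)
  · intro a ha
    simp only [List.mem_toFinset, List.mem_filter, decide_eq_true_eq] at ha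
    obtain ⟨ha, hat⟩ := ha
    simp only [lay, List.mem_append, List.mem_map] at ha
    simp only [smset, mem_filter, mem_Icc]
    rcases ha with ⟨x, hx, rfl⟩ | ⟨x, hx, rfl⟩
    · exact ⟨⟨val5_pos x, hat⟩, fun p hp hd => val5_sm x p hp hd⟩
    · refine ⟨⟨?_, hat⟩, fun p hp hd => ?_⟩
      · have := val5_pos x; omega
      · rcases hp.dvd_mul.1 hd with hd | hd
        · have := Nat.le_of_dvd (by norm_num) hd; omega
        · exact val5_sm x p hp hd
  · intro a ha
    simp only [List.mem_toFinset, List.mem_filter] at ha ⊢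
    exact ha.1

/-- reduce to jump points -/
lemma cu_jump (U : List ℕ) (t : ℕ) : cu U t = 0 ∨ ∃ u ∈ U, u ≤ t ∧ cu U t = cu U u := by
  by_cases h : ∃ u ∈ U, u ≤ t
  · right
    have hne : (U.toFinset.filter (fun u => u ≤ t)).Nonempty := by
      obtain ⟨u, hu, hut⟩ := h
      exact ⟨u, by simp [hu, hut]⟩
    obtain ⟨u, hu, hmax⟩ := Finset.exists_max_image _ id hne
    simp only [mem_filter, List.mem_toFinset, id] at hu hmax
    refine ⟨u, hu.1, hu.2, ?_⟩
    unfold cu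
    refine List.countP_congr fun w hw => ?_
    simp only [decide_eq_true_eq]
    exact ⟨fun hwt => hmax w ⟨hw, hwt⟩, fun hwu => hwu.trans hu.2⟩
  · left
    push Not at h
    unfold cu
    rw [List.countP_eq_zero]
    intro u hu
    simpa using h u hu

def kcu (U : List ℕ) (t : ℕ) : ℕ := U.foldr (fun u s => bif Nat.ble u t then s + 1 else s) 0

lemma kcu_eq (U : List ℕ) (t : ℕ) : kcu U t = cu U t := by
  induction U with
  | nil => rfl
  | cons u U ih =>
    have e : kcu (u :: U) t = bif Nat.ble u t then kcu U t + 1 else kcu U t := rfl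
    rw [e, ih]
    simp only [cu, List.countP_cons, decide_eq_true_eq]
    by_cases h : u ≤ t
    · rw [Nat.ble_eq_true_of_le h, if_pos h]; rfl
    · have : Nat.ble u t = false := by
        rw [← Bool.not_eq_true, Nat.ble_eq]; exact h
      rw [this, if_neg h]; rfl

lemma KS_ok : KS.all capOK = true := by decide +kernel

lemma KS_nodup : ∀ K ∈ KS, (lay K).Nodup := by decide +kernel

def famChk : Bool :=
  let L := KS.map lay
  UL.all (fun u => L.any (fun l => Nat.ble (kcu UL u) (kcu l u)))

lemma UL_ok : famChk = true := by decide +kernel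

lemma UL_le (t : ℕ) : cu UL t ≤ fN 12 t := by
  rcases cu_jump UL t with h | ⟨u, hu, hut, h⟩
  · omega
  · rw [h]
    have := UL_ok
    simp only [famChk, List.all_eq_true, List.any_eq_true, List.mem_map, Nat.ble_eq, kcu_eq] at this
    obtain ⟨l, ⟨K, hK, rfl⟩, hle⟩ := this u hu
    refine hle.trans ((cu_lay_le (List.all_eq_true.1 KS_ok K hK) (KS_nodup K hK) u).trans
      (fN_mono 12 hut))

lemma inv_ge (U : List ℕ) : (((U.map (fun u => 1000000000 / u)).sum : ℕ) : ℝ) / 1000000000 ≤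
    (U.map (fun u : ℕ => 1 / (u : ℝ))).sum := by
  induction U with
  | nil => simp
  | cons u U ih =>
    simp only [List.map_cons, List.sum_cons]
    push_cast
    rw [add_div]
    refine add_le_add ?_ (by push_cast at ih; exact ih)
    have := Nat.cast_div_le (α := ℝ) (m := 1000000000) (n := u)
    rw [div_le_iff₀ (by norm_num)]
    push_cast at this
    calc ((1000000000 / u : ℕ) : ℝ) ≤ 1000000000 / u := this
      _ = _ := by ring

def pl (q : ℕ) : ℕ :=
  bif [2, 3, 5, 7, 11, 13, 17, 19, 23, 29, 31, 37, 41, 43, 47, 53].any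
    (fun d => Nat.beq (q % d) 0 && !(Nat.beq q d)) then 0 else 1000000000 / (q * q) + 1

lemma pl_sum : ((List.range' 12 2989).map pl).sum ≤ 22430000 := by decide +kernel

lemma prime_sum_le : ∑ q ∈ (Icc 12 3000).filter Nat.Prime, (1 : ℝ) / (q : ℝ) ^ 2 ≤ 0.02243 := by
  have h1 : ∀ q ∈ (Icc 12 3000).filter Nat.Prime, (1 : ℝ) / (q : ℝ) ^ 2 ≤ (pl q : ℝ) / 1000000000 := by
    intro q hq
    have hp := (mem_filter.1 hq).2
    have e : pl q = 1000000000 / (q * q) + 1 := by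
      have hf : ([2, 3, 5, 7, 11, 13, 17, 19, 23, 29, 31, 37, 41, 43, 47, 53].any
          (fun d => Nat.beq (q % d) 0 && !(Nat.beq q d))) = false := by
        rw [List.any_eq_false]
        intro d hd
        simp only [Bool.and_eq_true, Bool.not_eq_true', not_and, Bool.not_eq_false]
        intro hm
        have hdv : d ∣ q := Nat.dvd_of_mod_eq_zero (Nat.eq_of_beq_eq_true hm)
        rcases (Nat.dvd_prime hp).1 hdv with h | h
        · subst h; simp at hd
        · rw [h]; exact Nat.beq_refl _
      unfold pl
      rw [hf]; rfl
    have hq0 : 0 < q * q := Nat.mul_pos hp.pos hp.pos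
    have hlt := Nat.lt_mul_div_succ 1000000000 hq0
    have hlt' : (1000000000 : ℝ) < (q : ℝ) * q * (pl q : ℝ) := by
      rw [e]; exact_mod_cast hlt
    have hq1 : (0 : ℝ) < q := by exact_mod_cast hp.pos
    rw [div_le_div_iff₀ (by positivity) (by norm_num)]
    nlinarith
  refine (sum_le_sum h1).trans ?_
  have h2 : ∑ q ∈ (Icc 12 3000).filter Nat.Prime, (pl q : ℝ) / 1000000000 ≤
      ∑ q ∈ Icc 12 3000, (pl q : ℝ) / 1000000000 :=
    sum_le_sum_of_subset_of_nonneg (filter_subset _ _) (fun _ _ _ => by positivity)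
  refine h2.trans ?_
  rw [← sum_div, div_le_iff₀ (by norm_num)]
  have h3 : ∑ q ∈ Icc 12 3000, pl q = ((List.range' 12 2989).map pl).sum := rfl
  have h4 : ∑ q ∈ Icc 12 3000, pl q ≤ 22430000 := h3 ▸ pl_sum
  have h5 : (∑ q ∈ Icc 12 3000, (pl q : ℝ)) ≤ 22430000 := by exact_mod_cast h4
  linarith

lemma UL_sum : 3408441000 ≤ (UL.map (fun u => 1000000000 / u)).sum := by decide +kernel

lemma UL_pos : ∀ u ∈ UL, 0 < u := by decide +kernel

lemma lower_bound {C : ℝ} (hC : Tendsto (fun n : ℕ => (Fkd 3 3 n : ℝ) / n) atTop (nhds C)) :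
    0.6919 ≤ C := by
  have hS := prime_sum_le
  have h := lower_C hC 12 3000 (by norm_num) UL UL_pos UL_le (hS.trans (by norm_num))
  have hp : Nat.primesBelow 12 = {2, 3, 5, 7, 11} := by decide +kernel
  have hprod : ∏ d ∈ Nat.primesBelow 12, (1 - 1 / (d : ℝ)) = 16 / 77 := by
    rw [hp]; norm_num
  rw [hprod] at h
  have h1 : (3.408441 : ℝ) ≤ (UL.map (fun u : ℕ => 1 / (u : ℝ))).sum := by
    refine le_trans ?_ (inv_ge UL)
    rw [le_div_iff₀ (by norm_num)]
    have : (3408441000 : ℝ) ≤ (((UL.map (fun u => 1000000000 / u)).sum : ℕ) : ℝ) := by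
      exact_mod_cast UL_sum
    linarith
  set S := ∑ q ∈ (Icc 12 3000).filter Nat.Prime, (1 : ℝ) / (q : ℝ) ^ 2
  set W := (UL.map (fun u : ℕ => 1 / (u : ℝ))).sum
  push_cast at h
  have h2 : (0.97757 : ℝ) ≤ 1 - S := by linarith
  nlinarith


/-- cap condition -/
def IsCap {V : Type} [AddCommGroup V] (K : Finset V) : Prop :=
  ∀ x ∈ K, ∀ y ∈ K, ∀ z ∈ K, x + y + z = 0 → x = y

def CapBd (d B : ℕ) : Prop := ∀ K : Finset (Fin d → ZMod 3), IsCap K → K.card ≤ B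

instance : Fact (Nat.Prime 3) := ⟨Nat.prime_three⟩

lemma three_smul_zero {V : Type} [AddCommGroup V] [Module (ZMod 3) V] (p : V) : p + p + p = 0 := by
  have : ((1 : ZMod 3) + 1 + 1) • p = 0 := by
    have h : (1 : ZMod 3) + 1 + 1 = 0 := by decide
    rw [h, zero_smul]
  simpa [add_smul] using this

lemma cap_transfer {V : Type} [AddCommGroup V] [Module (ZMod 3) V] [FiniteDimensional (ZMod 3) V]
    (W : Submodule (ZMod 3) V) (p : V) (B : ℕ) (hB : CapBd (Module.finrank (ZMod 3) W) B)
    (K : Finset V) (hK : IsCap K) (hp : ∀ x ∈ K, x - p ∈ W) : K.card ≤ B := by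
  classical
  let e : W ≃ₗ[ZMod 3] (Fin (Module.finrank (ZMod 3) W) → ZMod 3) :=
    (Module.finBasis (ZMod 3) W).equivFun
  let g : V → (Fin (Module.finrank (ZMod 3) W) → ZMod 3) :=
    fun x => if h : x - p ∈ W then e ⟨x - p, h⟩ else 0
  have hg : ∀ x (h : x ∈ K), g x = e ⟨x - p, hp x h⟩ := fun x h => by
    simp only [g]; rw [dif_pos (hp x h)]
  have hinj : Set.InjOn g K := by
    intro x hx y hy hxy
    rw [hg x hx, hg y hy] at hxy
    have := congrArg Subtype.val (e.injective hxy)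
    simpa using this
  rw [← card_image_of_injOn hinj]
  refine hB _ ?_
  intro a ha b hb c hc habc
  obtain ⟨x, hx, rfl⟩ := mem_image.1 ha
  obtain ⟨y, hy, rfl⟩ := mem_image.1 hb
  obtain ⟨z, hz, rfl⟩ := mem_image.1 hc
  have h0 : x + y + z = 0 := by
    rw [hg x hx, hg y hy, hg z hz, ← map_add, ← map_add] at habc
    have h1 := (LinearEquiv.map_eq_zero_iff e).1 habc
    have h2 := congrArg Subtype.val h1
    simp only [Submodule.coe_add, Submodule.coe_zero] at h2
    have h3 := three_smul_zero p
    calc x + y + z = (x - p + (y - p) + (z - p)) + (p + p + p) := by abel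
      _ = 0 := by rw [h2, h3, add_zero]
  rw [hK x hx y hy z hz h0]

/-- the linear form attached to `z` -/
def Lf {m : ℕ} (z : Fin m → ZMod 3) : (Fin m → ZMod 3) →ₗ[ZMod 3] ZMod 3 :=
  ∑ i, z i • LinearMap.proj i

lemma Lf_apply {m : ℕ} (z x : Fin m → ZMod 3) : Lf z x = ∑ i, z i * x i := by
  simp [Lf, LinearMap.sum_apply]

lemma Lf_comm {m : ℕ} (z x : Fin m → ZMod 3) : Lf z x = Lf x z := by
  rw [Lf_apply, Lf_apply]; exact sum_congr rfl fun i _ => mul_comm _ _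

lemma Lf_ne {m : ℕ} (z : Fin m → ZMod 3) (hz : z ≠ 0) : Lf z ≠ 0 := by
  intro h
  apply hz
  ext i
  have := LinearMap.congr_fun h (Pi.single i 1)
  rw [Lf_apply] at this
  simpa [Pi.single_apply] using this

lemma Lf_ker {d : ℕ} (z : Fin (d + 1) → ZMod 3) (hz : z ≠ 0) :
    Module.finrank (ZMod 3) (LinearMap.ker (Lf z)) = d := by
  have := Module.Dual.finrank_ker_add_one_of_ne_zero (f := Lf z) (Lf_ne z hz)
  simp at this
  omega

lemma Lf_card {d : ℕ} (z : Fin (d + 1) → ZMod 3) (hz : z ≠ 0) :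
    (univ.filter (fun a => Lf a z = 0)).card = 3 ^ d := by
  classical
  have h1 := Module.card_eq_pow_finrank (K := ZMod 3) (V := LinearMap.ker (Lf z))
  rw [Lf_ker z hz] at h1
  rw [ZMod.card] at h1
  rw [← h1, Fintype.card_subtype]
  congr 1
  ext a
  simp [Lf_comm a z]

lemma cap_step (d B n q : ℕ) (hB : CapBd d B)
    (hq : ∀ a b c : ℕ, a ≤ B → b ≤ B → c ≤ B → a + b + c = n → a * a + b * b + c * c ≤ q)
    (hn : n * n + (3 ^ (d + 1) - 1) * q < 3 ^ (d + 1) * n + 3 ^ d * (n * n - n)) :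
    CapBd (d + 1) (n - 1) := by
  classical
  intro K0 hK0
  by_contra hlt
  obtain ⟨K, hKs, hKc⟩ := Finset.exists_subset_card_eq (show n ≤ K0.card by omega)
  have hK : IsCap K := fun x hx y hy z hz => hK0 x (hKs hx) y (hKs hy) z (hKs hz)
  -- double counting
  have hdc : ∑ a : Fin (d + 1) → ZMod 3, ((K ×ˢ K).filter (fun xy => Lf a (xy.1 - xy.2) = 0)).card =
      3 ^ (d + 1) * n + 3 ^ d * (n * n - n) := by
    simp only [card_filter]
    rw [sum_comm]
    simp only [← card_filter]
    rw [← Finset.sum_filter_add_sum_filter_not (K ×ˢ K) (fun xy => xy.1 = xy.2)]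
    have e1 : ((K ×ˢ K).filter (fun xy => xy.1 = xy.2)).card = n := by
      rw [← hKc, ← Finset.diag_card K]
      congr 1
      ext ⟨x, y⟩
      simp only [mem_filter, mem_product, mem_diag]
      constructor
      · rintro ⟨⟨h1, -⟩, h2⟩; exact ⟨h1, h2⟩
      · rintro ⟨h1, h2⟩; exact ⟨⟨h1, h2 ▸ h1⟩, h2⟩
    have e2 : ((K ×ˢ K).filter (fun xy => ¬ xy.1 = xy.2)).card = n * n - n := by
      have := Finset.card_filter_add_card_filter_not (s := K ×ˢ K) (fun xy => xy.1 = xy.2)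
      rw [e1, card_product, hKc] at this
      omega
    congr 1
    · rw [Finset.sum_congr rfl (g := fun _ => 3 ^ (d + 1)), sum_const, e1, smul_eq_mul, mul_comm]
      intro xy h
      rw [(mem_filter.1 h).2]
      simp
    · rw [Finset.sum_congr rfl (g := fun _ => 3 ^ d), sum_const, e2, smul_eq_mul, mul_comm]
      intro xy h
      exact Lf_card _ (sub_ne_zero.2 (mem_filter.1 h).2)
  have hle : ∀ a : Fin (d + 1) → ZMod 3, a ≠ 0 →
      ((K ×ˢ K).filter (fun xy => Lf a (xy.1 - xy.2) = 0)).card ≤ q := by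
    intro a ha
    have hs : ∀ c : ZMod 3, (K.filter (fun x => Lf a x = c)).card ≤ B := by
      intro c
      rcases (K.filter (fun x => Lf a x = c)).eq_empty_or_nonempty with h | ⟨p, hp⟩
      · rw [h]; simp
      · refine cap_transfer (LinearMap.ker (Lf a)) p B (by rw [Lf_ker a ha]; exact hB) _ ?_ ?_
        · intro x hx y hy z hz
          exact hK x (mem_filter.1 hx).1 y (mem_filter.1 hy).1 z (mem_filter.1 hz).1
        · intro x hx
          rw [LinearMap.mem_ker, map_sub, (mem_filter.1 hx).2, (mem_filter.1 hp).2, sub_self]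
    have huniv : (univ : Finset (ZMod 3)) = {0, 1, 2} := by decide
    have hsum : K.card = ∑ c : ZMod 3, (K.filter (fun x => Lf a x = c)).card :=
      Finset.card_eq_sum_card_fiberwise (fun x _ => mem_univ _)
    have hsum2 : ((K ×ˢ K).filter (fun xy => Lf a (xy.1 - xy.2) = 0)).card =
        ∑ c : ZMod 3, (K.filter (fun x => Lf a x = c)).card *
          (K.filter (fun x => Lf a x = c)).card := by
      rw [Finset.card_eq_sum_card_fiberwise (f := fun xy => Lf a xy.1) (t := univ)
        (fun x _ => mem_univ _)]
      refine sum_congr rfl fun c _ => ?_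
      rw [← card_product]
      congr 1
      ext ⟨x, y⟩
      simp only [mem_filter, mem_product, map_sub, sub_eq_zero]
      constructor
      · rintro ⟨⟨⟨h1, h2⟩, h3⟩, h4⟩
        exact ⟨⟨h1, h4⟩, h2, h3 ▸ h4⟩
      · rintro ⟨⟨h1, h2⟩, h3, h4⟩
        exact ⟨⟨⟨h1, h3⟩, h2.trans h4.symm⟩, h2⟩
    rw [hKc, huniv, sum_insert (by decide), sum_insert (by decide), sum_singleton] at hsum
    rw [hsum2, huniv, sum_insert (by decide), sum_insert (by decide), sum_singleton, ← add_assoc]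
    exact hq _ _ _ (hs 0) (hs 1) (hs 2) (by omega)
  have hz : ((K ×ˢ K).filter (fun xy => Lf (0 : Fin (d + 1) → ZMod 3) (xy.1 - xy.2) = 0)).card ≤
      n * n := by
    rw [← hKc, ← card_product]; exact card_le_card (filter_subset _ _)
  have htot : ∑ a : Fin (d + 1) → ZMod 3, ((K ×ˢ K).filter (fun xy => Lf a (xy.1 - xy.2) = 0)).card ≤
      n * n + (3 ^ (d + 1) - 1) * q := by
    rw [← Finset.add_sum_erase univ _ (mem_univ 0)]
    refine add_le_add hz ?_
    refine (Finset.sum_le_card_nsmul _ _ q ?_).trans ?_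
    · intro a ha; exact hle a (mem_erase.1 ha).1
    · rw [card_erase_of_mem (mem_univ _), smul_eq_mul]
      simp
  omega

lemma cap0 : CapBd 0 1 := by
  intro K _
  exact Finset.card_le_one_of_subsingleton K

lemma cap1 : CapBd 1 2 := by
  intro K hK
  by_contra h
  have : K.card ≤ 3 := by
    refine (card_le_univ K).trans ?_
    simp
  have hu : K = univ := by
    rw [← Finset.card_eq_iff_eq_univ]; simp; omega
  have := hK (fun _ => 0) (by rw [hu]; simp) (fun _ => 1) (by rw [hu]; simp) (fun _ => 2)
    (by rw [hu]; simp) (by decide)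
  exact absurd this (by decide)

lemma cap2 : CapBd 2 4 := by
  refine cap_step 1 2 5 9 cap1 ?_ (by norm_num)
  intro a b c ha hb hc h
  interval_cases a <;> interval_cases b <;> first | omega | (have : c ≤ 2 := hc; interval_cases c <;> omega)

lemma cap3 : CapBd 3 9 := by
  refine cap_step 2 4 10 36 cap2 ?_ (by norm_num)
  intro a b c ha hb hc h
  have : c = 10 - a - b := by omega
  subst this
  interval_cases a <;> interval_cases b <;> omega

lemma cap4 : CapBd 4 22 := by
  refine cap_step 3 9 23 187 cap3 ?_ (by norm_num)
  intro a b c ha hb hc h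
  have : c = 23 - a - b := by omega
  subst this
  interval_cases a <;> interval_cases b <;> omega

def cbn : ℕ → ℕ
  | 0 => 1
  | 1 => 2
  | 2 => 4
  | 3 => 9
  | _ => 22

lemma cap_cb (d : ℕ) (hd : d ≤ 4) : CapBd d (cbn d) := by
  interval_cases d
  · exact cap0
  · exact cap1
  · exact cap2
  · exact cap3
  · exact cap4

lemma cbn_mono : Monotone cbn := by
  refine monotone_nat_of_le_succ fun n => ?_
  match n with
  | 0 => decide
  | 1 => decide
  | 2 => decide
  | 3 => decide
  | n + 4 => exact le_refl _

/-- caps inside an affine span -/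
lemma cap_span (us : List (Fin 4 → ZMod 3)) (p : Fin 4 → ZMod 3) (K : Finset (Fin 4 → ZMod 3))
    (hK : IsCap K) (hp : ∀ x ∈ K, x - p ∈ Submodule.span (ZMod 3) {u | u ∈ us}) :
    K.card ≤ cbn us.length := by
  classical
  set W := Submodule.span (ZMod 3) {u | u ∈ us} with hW
  have h4 : Module.finrank (ZMod 3) W ≤ 4 := by
    have := Submodule.finrank_le W
    simpa using this
  have hl : Module.finrank (ZMod 3) W ≤ us.length := by
    have e : {u | u ∈ us} = ((us.toFinset : Finset _) : Set (Fin 4 → ZMod 3)) := by ext; simp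
    rw [hW, e]
    exact (finrank_span_finset_le_card _).trans (List.toFinset_card_le us)
  exact (cap_transfer W p _ (cap_cb _ h4) K hK hp).trans (cbn_mono hl)


def UU : List ℕ := [1, 2, 3, 5, 6, 7, 8, 10, 14, 15, 16, 21, 24, 30, 35, 40, 42, 48, 56, 60, 70, 80, 98, 105, 120, 140, 168, 200, 210, 240, 280, 336, 392, 441, 560, 600, 720, 840, 1200, 1225, 1680, 1800, 2352, 3920]

/-- dual certificates: threshold, value, denominator, weighted affine subspaces -/
def CS : List (ℕ × ℕ × ℕ × List (ℕ × ℕ × List ℕ)) := [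
  (1, 1, 1, []),
  (2, 2, 1, []),
  (4, 3, 1, [(1, 0, [1])]),
  (5, 4, 1, [(1, 0, [1])]),
  (6, 5, 1, [(1, 0, [1])]),
  (7, 6, 1, [(1, 0, [1])]),
  (9, 7, 1, [(1, 0, [1]), (1, 0, [3])]),
  (13, 8, 1, [(1, 0, [1, 3])]),
  (14, 9, 1, [(1, 0, [1, 3])]),
  (15, 10, 1, [(1, 0, [1, 3])]),
  (20, 11, 2, [(2, 0, [1, 3]), (1, 0, [1, 9]), (1, 0, [1, 27]), (1, 9, [1, 45])]),
  (23, 12, 2, [(2, 0, [1, 3]), (1, 0, [1, 9]), (1, 0, [1, 27]), (1, 9, [1, 45])]),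
  (29, 13, 1, [(1, 27, [1]), (1, 0, [1, 3]), (1, 0, [1, 9])]),
  (34, 14, 1, [(1, 27, [1]), (1, 0, [1, 3]), (1, 0, [1, 9])]),
  (39, 15, 1, [(1, 27, [1]), (1, 0, [1, 3]), (1, 0, [1, 9])]),
  (41, 16, 1, [(1, 27, [1]), (1, 0, [1, 3]), (1, 0, [1, 9])]),
  (47, 17, 1, [(1, 27, [1]), (1, 9, [3]), (1, 0, [1, 3]), (1, 0, [1, 9])]),
  (55, 18, 6, [(5, 9, [3]), (4, 0, [1, 3]), (4, 0, [1, 9]), (2, 0, [1, 27]), (3, 3, [1, 27]), (2, 3, [1, 33]), (1, 9, [1, 45]), (1, 0, [3, 9]), (1, 1, [3, 9]), (1, 2, [4, 10]), (1, 0, [4, 27]), (1, 1, [5, 28]), (1, 2, [5, 29]), (1, 8, [17, 35])]),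
  (59, 19, 3, [(2, 9, [3]), (2, 0, [1, 3]), (1, 9, [1, 3]), (1, 27, [1, 3]), (2, 0, [1, 9]), (1, 0, [1, 27]), (1, 3, [1, 27]), (1, 3, [1, 33]), (1, 0, [3, 27]), (1, 2, [4, 10]), (1, 8, [17, 35])]),
  (69, 20, 1, [(1, 27, [3]), (1, 0, [1, 27]), (1, 0, [1, 3, 9])]),
  (79, 21, 2, [(1, 0, [1, 3]), (1, 27, [1, 3]), (1, 0, [1, 27]), (1, 0, [3, 27]), (2, 0, [1, 3, 9])]),
  (97, 22, 14, [(2, 9, [3]), (11, 0, [1, 3]), (3, 9, [1, 3]), (10, 27, [1, 3]), (1, 3, [1, 15]), (2, 0, [1, 27]), (2, 3, [1, 27]), (2, 9, [1, 27]), (2, 3, [1, 42]), (1, 2, [3, 10]), (2, 0, [3, 27]), (3, 1, [4, 11]), (3, 2, [5, 10]), (2, 1, [5, 28]), (1, 2, [5, 28]), (5, 0, [9, 27]), (2, 1, [9, 29]), (2, 2, [11, 29]), (8, 0, [1, 3, 9])]),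
  (104, 23, 1, [(1, 9, [1, 27]), (1, 0, [1, 3, 9]), (1, 0, [1, 3, 27])]),
  (119, 24, 10, [(4, 3, [1]), (3, 6, [12]), (2, 2, [28]), (7, 0, [1, 3]), (5, 9, [1, 3]), (8, 27, [1, 3]), (2, 3, [1, 42]), (2, 0, [9, 27]), (4, 1, [9, 27]), (3, 0, [10, 27]), (1, 2, [10, 28]), (2, 1, [11, 27]), (3, 2, [11, 29]), (2, 6, [12, 30]), (5, 0, [1, 3, 9]), (2, 0, [1, 3, 27])]),
  (139, 25, 4, [(3, 3, [1]), (2, 6, [12]), (1, 6, [15]), (3, 0, [1, 3]), (2, 9, [1, 3]), (4, 27, [1, 3]), (1, 0, [1, 27]), (1, 1, [9, 27]), (2, 0, [10, 27]), (1, 2, [10, 28]), (1, 1, [11, 27]), (1, 2, [11, 29]), (2, 0, [1, 3, 9])]),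
  (167, 26, 2, [(1, 27, [1, 9]), (1, 9, [1, 27]), (1, 9, [1, 45]), (2, 0, [1, 3, 9]), (2, 0, [1, 3, 27])]),
  (199, 27, 2, [(1, 27, [1, 9]), (1, 9, [1, 27]), (1, 9, [1, 45]), (2, 0, [1, 3, 9]), (2, 0, [1, 3, 27])]),
  (209, 28, 1, [(1, 9, [1]), (1, 6, [15]), (1, 27, [1, 9]), (1, 0, [1, 3, 9]), (1, 0, [1, 3, 27])]),
  (239, 29, 1, [(1, 9, [1]), (1, 27, [1, 9]), (1, 0, [1, 3, 9]), (1, 0, [1, 3, 27])]),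
  (279, 30, 5, [(1, 9, [1]), (1, 6, [15]), (1, 7, [31]), (1, 18, [36]), (1, 27, [1, 3]), (1, 27, [1, 9]), (1, 27, [1, 12]), (3, 9, [1, 27]), (4, 12, [1, 27]), (1, 3, [1, 33]), (1, 0, [9, 27]), (1, 1, [10, 27]), (1, 2, [11, 27]), (5, 0, [1, 3, 9]), (4, 0, [1, 3, 27])]),
  (335, 31, 7, [(3, 36, [3]), (1, 29, [4]), (1, 28, [5]), (3, 6, [15]), (3, 27, [1, 9]), (1, 6, [1, 15]), (1, 3, [1, 27]), (3, 9, [1, 27]), (3, 9, [1, 45]), (1, 27, [3, 9]), (3, 9, [3, 27]), (1, 0, [9, 27]), (1, 1, [10, 27]), (1, 2, [11, 27]), (7, 0, [1, 3, 9]), (6, 0, [1, 3, 27])]),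
  (391, 32, 2, [(1, 36, [3]), (1, 11, [5]), (1, 27, [1, 3]), (1, 27, [1, 9]), (1, 6, [1, 15]), (1, 3, [1, 27]), (1, 9, [3, 27]), (2, 0, [1, 3, 9]), (1, 0, [1, 3, 27]), (1, 0, [1, 9, 27])]),
  (440, 33, 107, [(59, 39, [1]), (7, 28, [3]), (28, 37, [4]), (34, 11, [5]), (2, 27, [9]), (15, 29, [10]), (7, 30, [12]), (33, 7, [15]), (20, 6, [33]), (23, 8, [35]), (1, 11, [38]), (15, 18, [45]), (20, 9, [1, 3]), (48, 27, [1, 3]), (36, 27, [1, 9]), (13, 27, [1, 12]), (6, 6, [1, 15]), (51, 3, [1, 27]), (12, 6, [1, 33]), (44, 9, [3, 27]), (4, 0, [4, 27]), (3, 28, [5, 10]), (7, 29, [5, 10]), (4, 0, [5, 11]), (1, 11, [5, 27]), (20, 10, [5, 28]), (12, 1, [9, 29]), (4, 0, [11, 27]), (12, 2, [11, 29]), (4, 3, [12, 27]), (17, 6, [15, 33]), (10, 8, [17, 35]), (107, 0, [1, 3, 9]), (52, 0, [1, 3, 27]), (43, 0, [1, 9, 27])]),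
  (559, 34, 120, [(2, 39, [1]), (16, 10, [4]), (16, 7, [15]), (13, 4, [27]), (6, 8, [35]), (9, 19, [36]), (41, 18, [45]), (15, 19, [46]), (33, 9, [1, 3]), (48, 27, [1, 3]), (13, 3, [1, 9]), (32, 6, [1, 15]), (22, 3, [1, 27]), (3, 1, [3, 9]), (38, 27, [3, 9]), (3, 9, [3, 27]), (3, 1, [4, 9]), (2, 28, [5, 10]), (31, 29, [5, 10]), (17, 2, [9, 29]), (3, 2, [10, 27]), (5, 1, [10, 28]), (13, 8, [10, 35]), (13, 5, [13, 35]), (104, 0, [1, 3, 9]), (22, 27, [1, 3, 9]), (85, 0, [1, 3, 27]), (39, 9, [1, 3, 27]), (42, 0, [1, 9, 27]), (16, 0, [3, 9, 27])]),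
  (599, 35, 7, [(1, 12, [1]), (2, 29, [5]), (3, 28, [9]), (1, 7, [15]), (1, 11, [29]), (1, 19, [37]), (3, 18, [45]), (3, 9, [1, 3]), (2, 27, [1, 3]), (3, 36, [1, 3]), (1, 3, [1, 9]), (2, 6, [1, 15]), (2, 3, [1, 27]), (1, 9, [1, 27]), (3, 27, [3, 9]), (1, 27, [3, 10]), (1, 9, [3, 36]), (1, 10, [4, 27]), (1, 29, [5, 10]), (1, 6, [9, 33]), (1, 8, [10, 35]), (1, 5, [13, 35]), (6, 0, [1, 3, 9]), (5, 0, [1, 3, 27]), (3, 0, [1, 9, 27])]),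
  (719, 36, 37, [(2, 30, [1]), (4, 37, [3]), (4, 28, [4]), (7, 4, [10]), (1, 8, [16]), (7, 10, [27]), (6, 15, [42]), (9, 18, [45]), (7, 21, [46]), (10, 9, [1, 3]), (11, 27, [1, 3]), (5, 36, [1, 3]), (5, 3, [1, 9]), (11, 6, [1, 15]), (5, 3, [1, 27]), (8, 9, [1, 27]), (6, 12, [1, 45]), (1, 2, [3, 10]), (2, 27, [3, 10]), (3, 9, [3, 27]), (3, 18, [3, 45]), (1, 0, [4, 10]), (3, 2, [4, 29]), (1, 2, [5, 10]), (8, 0, [5, 11]), (2, 1, [5, 28]), (2, 11, [5, 28]), (1, 11, [5, 29]), (3, 19, [5, 47]), (3, 1, [9, 28]), (1, 1, [10, 28]), (5, 8, [10, 35]), (1, 2, [17, 34]), (31, 0, [1, 3, 9]), (19, 27, [1, 3, 9]), (23, 0, [1, 3, 27]), (13, 0, [1, 9, 27]), (6, 0, [3, 9, 27]), (1, 1, [4, 9, 27]), (2, 2, [5, 10, 27])]),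
  (839, 37, 18, [(3, 30, [1]), (3, 2, [17]), (1, 21, [39]), (4, 19, [45]), (1, 20, [46]), (3, 20, [47]), (4, 9, [1, 3]), (8, 27, [1, 3]), (3, 3, [1, 9]), (3, 27, [1, 9]), (3, 6, [1, 33]), (6, 18, [1, 45]), (1, 27, [3, 9]), (1, 28, [4, 11]), (1, 29, [5, 10]), (3, 3, [12, 30]), (1, 5, [14, 31]), (15, 0, [1, 3, 9]), (3, 27, [1, 3, 9]), (10, 0, [1, 3, 27]), (6, 9, [1, 3, 27]), (3, 0, [1, 9, 27]), (8, 0, [1, 3, 9, 27])]),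
  (1199, 38, 52, [(22, 21, [45]), (19, 9, [1, 3]), (19, 27, [1, 3]), (2, 27, [1, 9]), (2, 33, [1, 12]), (8, 6, [1, 15]), (2, 9, [1, 27]), (2, 15, [1, 30]), (8, 6, [1, 33]), (22, 18, [1, 45]), (7, 3, [9, 27]), (7, 4, [10, 28]), (7, 5, [11, 29]), (3, 0, [15, 33]), (3, 1, [16, 34]), (3, 2, [17, 35]), (36, 0, [1, 3, 9]), (18, 27, [1, 3, 9]), (36, 0, [1, 3, 27]), (18, 9, [1, 3, 27]), (13, 0, [1, 9, 27]), (9, 3, [1, 12, 30]), (16, 0, [1, 3, 9, 27])]),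
  (1224, 39, 46, [(7, 4, [9]), (3, 3, [11]), (3, 1, [15]), (1, 5, [29]), (1, 15, [30]), (5, 15, [33]), (1, 16, [35]), (3, 22, [37]), (2, 14, [38]), (5, 22, [39]), (4, 22, [41]), (27, 21, [45]), (16, 9, [1, 3]), (18, 27, [1, 3]), (6, 27, [1, 9]), (5, 33, [1, 12]), (1, 9, [1, 27]), (7, 6, [1, 33]), (28, 18, [1, 45]), (1, 0, [3, 27]), (3, 2, [3, 29]), (3, 0, [5, 29]), (1, 20, [5, 37]), (6, 3, [9, 27]), (1, 6, [9, 33]), (2, 5, [10, 27]), (2, 4, [10, 28]), (1, 5, [14, 31]), (36, 0, [1, 3, 9]), (13, 27, [1, 3, 9]), (25, 0, [1, 3, 27]), (12, 9, [1, 3, 27]), (6, 0, [1, 9, 27]), (1, 2, [5, 10, 28]), (21, 0, [1, 3, 9, 27])]),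
  (1679, 40, 113, [(6, 36, [1]), (2, 28, [3]), (4, 29, [11]), (30, 33, [15]), (1, 0, [17]), (2, 5, [29]), (4, 22, [36]), (53, 21, [45]), (50, 9, [1, 3]), (30, 27, [1, 3]), (9, 3, [1, 9]), (27, 27, [1, 9]), (4, 30, [1, 15]), (9, 3, [1, 27]), (4, 15, [1, 30]), (21, 6, [1, 33]), (55, 18, [1, 45]), (1, 1, [3, 9]), (5, 27, [3, 9]), (3, 2, [3, 29]), (4, 0, [4, 9]), (4, 2, [4, 27]), (4, 0, [5, 10]), (2, 27, [5, 10]), (4, 3, [9, 27]), (3, 1, [10, 27]), (2, 0, [10, 28]), (2, 4, [10, 28]), (1, 3, [11, 35]), (2, 5, [12, 32]), (1, 3, [14, 31]), (5, 6, [14, 35]), (4, 1, [15, 31]), (4, 0, [15, 33]), (10, 1, [15, 35]), (11, 2, [16, 35]), (5, 6, [17, 28]), (65, 0, [1, 3, 9]), (16, 27, [1, 3, 9]), (45, 0, [1, 3, 27]), (6, 9, [1, 3, 27]), (12, 0, [1, 9, 27]), (2, 3, [1, 9, 27]), (3, 0, [4, 9, 27]), (86, 0, [1, 3, 9, 27]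)]),
  (1799, 41, 14, [(1, 36, [1]), (5, 33, [15]), (1, 8, [44]), (6, 21, [45]), (6, 9, [1, 3]), (3, 27, [1, 3]), (1, 3, [1, 9]), (2, 27, [1, 9]), (2, 15, [1, 30]), (3, 6, [1, 33]), (6, 18, [1, 45]), (1, 2, [3, 29]), (1, 2, [4, 27]), (1, 2, [5, 28]), (1, 1, [15, 35]), (1, 2, [16, 35]), (1, 0, [17, 35]), (9, 0, [1, 3, 9]), (4, 27, [1, 3, 9]), (5, 0, [1, 3, 27]), (3, 0, [1, 9, 27]), (2, 3, [1, 9, 27]), (10, 0, [1, 3, 9, 27])]),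
  (2351, 42, 51, [(2, 36, [1]), (3, 28, [10]), (1, 29, [11]), (4, 33, [15]), (10, 35, [17]), (2, 10, [28]), (2, 5, [29]), (13, 17, [35]), (8, 22, [40]), (12, 21, [45]), (4, 24, [48]), (5, 24, [51]), (12, 24, [52]), (7, 9, [1, 3]), (20, 27, [1, 3]), (8, 3, [1, 9]), (2, 27, [1, 9]), (1, 9, [1, 27]), (9, 6, [1, 33]), (22, 18, [1, 45]), (6, 1, [3, 9]), (6, 2, [3, 29]), (2, 1, [4, 10]), (5, 2, [4, 27]), (3, 0, [5, 10]), (8, 1, [5, 11]), (8, 2, [5, 28]), (3, 0, [9, 27]), (1, 4, [9, 27]), (2, 6, [9, 33]), (4, 1, [10, 27]), (6, 0, [11, 29]), (13, 0, [15, 33]), (29, 0, [1, 3, 9]), (14, 27, [1, 3, 9]), (13, 0, [1, 3, 27]), (13, 9, [1, 3, 27]), (4, 0, [1, 9, 27]), (1, 3, [1, 9, 27]), (2, 0, [3, 9, 27]), (1, 2, [3, 11, 27]), (36, 0, [1, 3, 9, 27])]),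
  (3919, 43, 7, [(2, 9, [1, 3]), (1, 9, [1, 36]), (1, 15, [1, 39]), (1, 12, [1, 42]), (4, 0, [1, 3, 9]), (4, 27, [1, 3, 9]), (3, 0, [1, 3, 27]), (3, 18, [1, 3, 45]), (7, 0, [1, 3, 9, 27])])]

def val4 (c : ℕ) : ℕ := 2 ^ (c % 3) * 3 ^ (c / 3 % 3) * 5 ^ (c / 9 % 3) * 7 ^ (c / 27 % 3)

/-- number of allowed elements in the fibre of `c` -/
def wt (t c : ℕ) : ℕ := (bif Nat.ble (val4 c) t then 1 else 0) + (bif Nat.ble (8 * val4 c) t then 1 else 0)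

def add4 (x y : ℕ) : ℕ :=
  (x % 3 + y % 3) % 3 + 3 * ((x / 3 % 3 + y / 3 % 3) % 3) + 9 * ((x / 9 % 3 + y / 9 % 3) % 3) +
    27 * ((x / 27 % 3 + y / 27 % 3) % 3)

def pts (p : ℕ) : List ℕ → List ℕ
  | [] => [p]
  | u :: us => pts p us ++ (pts (add4 p u) us ++ pts (add4 (add4 p u) u) us)

def covr (ms : List (ℕ × ℕ)) (x : ℕ) : ℕ := ms.foldr (fun lm s => lm.1 * (lm.2 / 2 ^ x % 2) + s) 0

def lsum (ls : List (ℕ × ℕ × List ℕ)) : ℕ := ls.foldr (fun l s => l.1 * cbn l.2.2.length + s) 0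

def certOK (T h D : ℕ) (ls : List (ℕ × ℕ × List ℕ)) : Bool :=
  let ms := ls.map (fun l => (l.1, mask (pts l.2.1 l.2.2)))
  Nat.blt (lsum ls + (List.range 81).foldr (fun x s => (D * wt T x - covr ms x) + s) 0) (D * (h + 1))

def chkAll (U : List ℕ) : ℕ → List (ℕ × ℕ × ℕ × List (ℕ × ℕ × List ℕ)) → Bool
  | lo, [] => Nat.ble 44 (kcu U lo)
  | lo, (T, h, D, ls) :: cs => certOK T h D ls && Nat.ble h (kcu U lo) && chkAll U (T + 1) cs

lemma CS_ok : chkAll UU 1 CS = true := by decide +kernel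


def toV (x : ℕ) : Fin 4 → ZMod 3 := ![(x : ZMod 3), ((x / 3 : ℕ) : ZMod 3), ((x / 9 : ℕ) : ZMod 3),
  ((x / 27 : ℕ) : ZMod 3)]

lemma dig4 : ∀ a < 3, ∀ b < 3, ∀ c < 3, ∀ d < 3, (a + 3 * b + 9 * c + 27 * d) % 3 = a ∧
    (a + 3 * b + 9 * c + 27 * d) / 3 % 3 = b ∧ (a + 3 * b + 9 * c + 27 * d) / 9 % 3 = c ∧
    (a + 3 * b + 9 * c + 27 * d) / 27 % 3 = d := by decide +kernel

lemma toV_add4 (x y : ℕ) : toV (add4 x y) = toV x + toV y := by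
  have m3 : ∀ k : ℕ, k % 3 < 3 := fun k => Nat.mod_lt k (by norm_num)
  obtain ⟨h0, h1, h2, h3⟩ := dig4 _ (m3 (x % 3 + y % 3)) _ (m3 (x / 3 % 3 + y / 3 % 3)) _
    (m3 (x / 9 % 3 + y / 9 % 3)) _ (m3 (x / 27 % 3 + y / 27 % 3))
  have key : ∀ a b c : ℕ, c % 3 = (a % 3 + b % 3) % 3 → (c : ZMod 3) = (a : ZMod 3) + (b : ZMod 3) := by
    intro a b c h
    rw [← Nat.add_mod] at h
    rw [← Nat.cast_add, ZMod.natCast_eq_natCast_iff]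
    exact h
  have k0 := key x y (add4 x y) h0
  have k1 := key (x / 3) (y / 3) (add4 x y / 3) h1
  have k2 := key (x / 9) (y / 9) (add4 x y / 9) h2
  have k3 := key (x / 27) (y / 27) (add4 x y / 27) h3
  ext i
  fin_cases i
  · exact k0
  · exact k1
  · exact k2
  · exact k3

lemma toV_inj : ∀ x < 81, ∀ y < 81, toV x = toV y → x = y := by
  intro x hx y hy h
  have h0 := congrFun h 0
  have h1 := congrFun h 1
  have h2 := congrFun h 2
  have h3 := congrFun h 3
  simp only [toV, Matrix.cons_val] at h0 h1 h2 h3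
  rw [ZMod.natCast_eq_natCast_iff] at h0 h1 h2 h3
  have dec : ∀ x < 81, x = x % 3 + 3 * (x / 3 % 3) + 9 * (x / 9 % 3) + 27 * (x / 27 % 3) := by
    decide +kernel
  rw [dec x hx, dec y hy]
  unfold Nat.ModEq at h0 h1 h2 h3
  rw [h0, h1, h2, h3]

lemma pts_mem (us : List ℕ) : ∀ p x, x ∈ pts p us →
    toV x - toV p ∈ Submodule.span (ZMod 3) {u | u ∈ us.map toV} := by
  induction us with
  | nil => intro p x h; simp [pts] at h; subst h; simp
  | cons u us ih =>
    intro p x h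
    have hmono : Submodule.span (ZMod 3) {w | w ∈ us.map toV} ≤
        Submodule.span (ZMod 3) {w | w ∈ (u :: us).map toV} := by
      refine Submodule.span_mono ?_
      intro w hw
      simp only [Set.mem_ofPred_eq, List.map_cons, List.mem_cons] at hw ⊢
      exact Or.inr hw
    have hu : toV u ∈ Submodule.span (ZMod 3) {w | w ∈ (u :: us).map toV} :=
      Submodule.subset_span (by simp)
    simp only [pts, List.mem_append] at h
    rcases h with h | h | h
    · exact hmono (ih p x h)
    · have := Submodule.add_mem _ (hmono (ih _ x h)) hu
      rw [toV_add4] at this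
      convert this using 1
      abel
    · have := Submodule.add_mem _ (Submodule.add_mem _ (hmono (ih _ x h)) hu) hu
      rw [toV_add4, toV_add4] at this
      convert this using 1
      abel

lemma mask_mem (K : List ℕ) (z : ℕ) (h : mask K / 2 ^ z % 2 ≠ 0) : z ∈ K := by
  have h1 : (mask K).testBit z = true := by
    rw [Nat.testBit_eq_decide_div_mod_eq]
    simp only [decide_eq_true_eq]
    omega
  clear h
  induction K with
  | nil => simp [mask] at h1
  | cons x K ih =>
    have e : mask (x :: K) = 2 ^ x ||| mask K := rfl
    rw [e, Nat.testBit_or, Bool.or_eq_true, Nat.testBit_two_pow] at h1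
    rcases h1 with h1 | h1
    · simp only [decide_eq_true_eq] at h1
      simp [h1]
    · exact List.mem_cons_of_mem _ (ih h1)

/-- codes of a cap -/
def CCap (K : Finset ℕ) : Prop := (∀ x ∈ K, x < 81) ∧
  ∀ x ∈ K, ∀ y ∈ K, ∀ z ∈ K, toV x + toV y + toV z = 0 → x = y

lemma ccap_pts {K : Finset ℕ} (hK : CCap K) (p : ℕ) (us : List ℕ) :
    (K.filter (fun x => x ∈ pts p us)).card ≤ cbn us.length := by
  classical
  have hinj : Set.InjOn toV (K.filter (fun x => x ∈ pts p us)) := by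
    intro x hx y hy h
    exact toV_inj x (hK.1 x (mem_filter.1 hx).1) y (hK.1 y (mem_filter.1 hy).1) h
  rw [← card_image_of_injOn hinj]
  have := cap_span (us.map toV) (toV p) ((K.filter (fun x => x ∈ pts p us)).image toV) ?_ ?_
  · simpa using this
  · intro a ha b hb c hc h
    obtain ⟨x, hx, rfl⟩ := mem_image.1 ha
    obtain ⟨y, hy, rfl⟩ := mem_image.1 hb
    obtain ⟨z, hz, rfl⟩ := mem_image.1 hc
    rw [hK.2 x (mem_filter.1 hx).1 y (mem_filter.1 hy).1 z (mem_filter.1 hz).1 h]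
  · intro a ha
    obtain ⟨x, hx, rfl⟩ := mem_image.1 ha
    exact pts_mem us p x (mem_filter.1 hx).2

lemma ccap_22 {K : Finset ℕ} (hK : CCap K) : K.card ≤ 22 := by
  classical
  have hinj : Set.InjOn toV K := by
    intro x hx y hy h
    exact toV_inj x (hK.1 x hx) y (hK.1 y hy) h
  rw [← card_image_of_injOn hinj]
  refine cap4 _ ?_
  intro a ha b hb c hc h
  obtain ⟨x, hx, rfl⟩ := mem_image.1 ha
  obtain ⟨y, hy, rfl⟩ := mem_image.1 hb
  obtain ⟨z, hz, rfl⟩ := mem_image.1 hc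
  rw [hK.2 x hx y hy z hz h]

lemma covr_sum {K : Finset ℕ} (hK : CCap K) (ls : List (ℕ × ℕ × List ℕ)) :
    ∑ x ∈ K, covr (ls.map (fun l => (l.1, mask (pts l.2.1 l.2.2)))) x ≤ lsum ls := by
  induction ls with
  | nil => simp [covr]
  | cons l ls ih =>
    have e1 : ∀ x, covr ((l :: ls).map (fun l => (l.1, mask (pts l.2.1 l.2.2)))) x =
      l.1 * (mask (pts l.2.1 l.2.2) / 2 ^ x % 2) +
        covr (ls.map (fun l => (l.1, mask (pts l.2.1 l.2.2)))) x := fun x => rfl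
    have e2 : lsum (l :: ls) = l.1 * cbn l.2.2.length + lsum ls := rfl
    simp only [e1]
    rw [e2, sum_add_distrib, ← mul_sum]
    refine add_le_add (Nat.mul_le_mul_left _ ?_) ih
    refine le_trans ?_ (ccap_pts hK l.2.1 l.2.2)
    rw [card_filter]
    refine sum_le_sum fun x _ => ?_
    by_cases h : x ∈ pts l.2.1 l.2.2
    · rw [if_pos h]; omega
    · rw [if_neg h]
      by_contra h2
      exact h (mask_mem _ _ (by omega))

lemma foldr_range (f : ℕ → ℕ) (n : ℕ) :
    (List.range n).foldr (fun x s => f x + s) 0 = ∑ x ∈ range n, f x := by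
  have : ∀ l : List ℕ, l.foldr (fun x s => f x + s) 0 = (l.map f).sum := by
    intro l
    induction l with
    | nil => rfl
    | cons a l ih => simp [ih]
  rw [this]
  induction n with
  | zero => simp
  | succ n ih => rw [List.range_succ, List.map_append, List.sum_append, ih, sum_range_succ]; simp

lemma cert_sound {K : Finset ℕ} (hK : CCap K) {T h D : ℕ} {ls : List (ℕ × ℕ × List ℕ)}
    (hc : certOK T h D ls = true) : ∑ x ∈ K, wt T x ≤ h := by
  simp only [certOK, Nat.blt_eq] at hc
  rw [foldr_range] at hc
  set ms := ls.map (fun l => (l.1, mask (pts l.2.1 l.2.2))) with hms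
  have h1 := covr_sum hK ls
  rw [← hms] at h1
  have h2 : ∑ x ∈ K, (D * wt T x - covr ms x) ≤ ∑ x ∈ range 81, (D * wt T x - covr ms x) :=
    sum_le_sum_of_subset (fun x hx => mem_range.2 (hK.1 x hx))
  have h3 : D * ∑ x ∈ K, wt T x ≤ ∑ x ∈ K, covr ms x + ∑ x ∈ K, (D * wt T x - covr ms x) := by
    rw [mul_sum, ← sum_add_distrib]
    exact sum_le_sum fun x _ => by omega
  have h4 : D * ∑ x ∈ K, wt T x < D * (h + 1) := by omega
  have := lt_of_mul_lt_mul_left h4 (Nat.zero_le D)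
  omega

lemma wt_mono (x : ℕ) {s t : ℕ} (h : s ≤ t) : wt s x ≤ wt t x := by
  have key : ∀ a : ℕ, (bif Nat.ble a s then 1 else 0) ≤ (bif Nat.ble a t then 1 else 0) := by
    intro a
    by_cases h1 : a ≤ s
    · rw [Nat.ble_eq_true_of_le h1, Nat.ble_eq_true_of_le (h1.trans h)]
    · have : Nat.ble a s = false := by
        rw [← Bool.not_eq_true, Nat.ble_eq]; exact h1
      rw [this]; simp
  exact add_le_add (key _) (key _)

lemma wt_le_two (t x : ℕ) : wt t x ≤ 2 := by
  unfold wt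
  cases Nat.ble (val4 x) t <;> cases Nat.ble (8 * val4 x) t <;> simp

lemma cu_mono (U : List ℕ) {s t : ℕ} (h : s ≤ t) : cu U s ≤ cu U t := by
  unfold cu
  refine List.countP_mono_left fun u _ hu => ?_
  simp only [decide_eq_true_eq] at hu ⊢
  omega

lemma chk_sound {K : Finset ℕ} (hK : CCap K) (U : List ℕ)
    (cs : List (ℕ × ℕ × ℕ × List (ℕ × ℕ × List ℕ))) : ∀ lo, chkAll U lo cs = true →
    ∀ t, lo ≤ t → ∑ x ∈ K, wt t x ≤ cu U t := by
  induction cs with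
  | nil =>
    intro lo h t ht
    simp only [chkAll, Nat.ble_eq, kcu_eq] at h
    have h1 : ∑ x ∈ K, wt t x ≤ K.card * 2 := by
      simpa using Finset.sum_le_card_nsmul K (fun x => wt t x) 2 (fun x _ => wt_le_two t x)
    have h2 := ccap_22 hK
    have h3 := cu_mono U ht
    omega
  | cons c cs ih =>
    obtain ⟨T, h, D, ls⟩ := c
    intro lo hc t ht
    simp only [chkAll, Bool.and_eq_true, Nat.ble_eq, kcu_eq] at hc
    obtain ⟨⟨h1, h2⟩, h3⟩ := hc
    by_cases htT : t ≤ T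
    · calc ∑ x ∈ K, wt t x ≤ ∑ x ∈ K, wt T x := sum_le_sum fun x _ => wt_mono x htT
        _ ≤ h := cert_sound hK h1
        _ ≤ cu U lo := h2
        _ ≤ cu U t := cu_mono U ht
    · exact ih (T + 1) h3 t (by omega)

lemma ccap_le {K : Finset ℕ} (hK : CCap K) (t : ℕ) (ht : 1 ≤ t) : ∑ x ∈ K, wt t x ≤ cu UU t :=
  chk_sound hK UU CS 1 CS_ok t ht


lemma cubefree_dec : ∀ a : ℕ, a ≠ 0 → ∃ w z : ℕ, a = w * z ^ 3 ∧ ∀ p, p.Prime → ¬ p ^ 3 ∣ w := by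
  intro a
  induction a using Nat.strong_induction_on with
  | _ a ih =>
    intro ha
    by_cases h : ∃ p, p.Prime ∧ p ^ 3 ∣ a
    · obtain ⟨p, hp, b, rfl⟩ := h
      have hb : b ≠ 0 := by rintro rfl; simp at ha
      have h8 : 1 < p ^ 3 := Nat.one_lt_pow (by norm_num) hp.one_lt
      obtain ⟨w, z, h1, h2⟩ := ih b (by nlinarith [Nat.pos_of_ne_zero hb]) hb
      exact ⟨w, p * z, by rw [h1]; ring, h2⟩
    · push Not at h
      exact ⟨a, 1, by simp, h⟩

lemma ext_prime (p : ℕ) (hp : p.Prime) (w : ℕ) (hw : w ≠ 0) (h : ¬ p ^ 3 ∣ w) :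
    ∃ e w', w = p ^ e * w' ∧ e < 3 ∧ ¬ p ∣ w' := by
  obtain ⟨e, w', h1, h2⟩ := Nat.exists_eq_pow_mul_and_not_dvd hw p hp.ne_one
  refine ⟨e, w', h2, ?_, h1⟩
  by_contra h3
  exact h (h2 ▸ Dvd.dvd.mul_right (pow_dvd_pow p (by omega)) w')

/-- moduli of the upper bound -/
def DU : Finset ℕ := {2, 3, 5, 7, 1331, 2197, 4913, 6859}

lemma full_dec (a : ℕ) (ha : a ≠ 0) : ∃ c v z : ℕ, a = val4 c * v * z ^ 3 ∧ c < 81 ∧ v ≠ 0 ∧ z ≠ 0 ∧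
    ∀ d ∈ DU, ¬ d ∣ v := by
  obtain ⟨w, z, h0, hcf⟩ := cubefree_dec a ha
  have hw : w ≠ 0 := by rintro rfl; simp at h0; exact ha h0
  have hz : z ≠ 0 := by rintro rfl; simp at h0; exact ha h0
  obtain ⟨e1, w1, h1, g1, d1⟩ := ext_prime 2 (by norm_num) w hw (hcf 2 (by norm_num))
  have k1 : w1 ∣ w := Dvd.intro_left _ h1.symm
  obtain ⟨e2, w2, h2, g2, d2⟩ := ext_prime 3 (by norm_num) w1 (by rintro rfl; simp at d1)
    (fun h => hcf 3 (by norm_num) (h.trans k1))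
  have k2 : w2 ∣ w1 := Dvd.intro_left _ h2.symm
  obtain ⟨e3, w3, h3, g3, d3⟩ := ext_prime 5 (by norm_num) w2 (by rintro rfl; simp at d2)
    (fun h => hcf 5 (by norm_num) (h.trans (k2.trans k1)))
  have k3 : w3 ∣ w2 := Dvd.intro_left _ h3.symm
  obtain ⟨e4, w4, h4, g4, d4⟩ := ext_prime 7 (by norm_num) w3 (by rintro rfl; simp at d3)
    (fun h => hcf 7 (by norm_num) (h.trans (k3.trans (k2.trans k1))))
  have k4 : w4 ∣ w3 := Dvd.intro_left _ h4.symm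
  obtain ⟨q1, q2, q3, q4⟩ := dig4 e1 g1 e2 g2 e3 g3 e4 g4
  refine ⟨e1 + 3 * e2 + 9 * e3 + 27 * e4, w4, z, ?_, by omega, by rintro rfl; simp at d4, hz, ?_⟩
  · rw [val4, q1, q2, q3, q4, h0, h1, h2, h3, h4]; ring
  · have k : w4 ∣ w := k4.trans (k3.trans (k2.trans k1))
    intro d hd hdv
    simp only [DU, mem_insert, mem_singleton] at hd
    rcases hd with rfl | rfl | rfl | rfl | rfl | rfl | rfl | rfl
    · exact d1 (hdv.trans (k4.trans (k3.trans k2)))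
    · exact d2 (hdv.trans (k4.trans k3))
    · exact d3 (hdv.trans k4)
    · exact d4 hdv
    · exact hcf 11 (by norm_num) (hdv.trans k)
    · exact hcf 13 (by norm_num) (hdv.trans k)
    · exact hcf 17 (by norm_num) (hdv.trans k)
    · exact hcf 19 (by norm_num) (hdv.trans k)

lemma pow3 (p a b c : ℕ) (h : (a : ZMod 3) + (b : ZMod 3) + (c : ZMod 3) = 0) :
    ∃ y, p ^ (a % 3) * p ^ (b % 3) * p ^ (c % 3) = y ^ 3 := by
  have h' : ((a + b + c : ℕ) : ZMod 3) = 0 := by push_cast; exact h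
  rw [ZMod.natCast_eq_zero_iff] at h'
  obtain ⟨k, hk⟩ : 3 ∣ a % 3 + b % 3 + c % 3 := by omega
  refine ⟨p ^ k, ?_⟩
  rw [← pow_add, ← pow_add, hk, ← pow_mul, mul_comm]

lemma val4_cube (x y z : ℕ) (h : toV x + toV y + toV z = 0) :
    ∃ r, val4 x * val4 y * val4 z = r ^ 3 := by
  have h0 := congrFun h 0
  have h1 := congrFun h 1
  have h2 := congrFun h 2
  have h3 := congrFun h 3
  simp only [toV, Pi.add_apply, Pi.zero_apply, Matrix.cons_val] at h0 h1 h2 h3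
  obtain ⟨r0, e0⟩ := pow3 2 _ _ _ h0
  obtain ⟨r1, e1⟩ := pow3 3 _ _ _ h1
  obtain ⟨r2, e2⟩ := pow3 5 _ _ _ h2
  obtain ⟨r3, e3⟩ := pow3 7 _ _ _ h3
  refine ⟨r0 * r1 * r2 * r3, ?_⟩
  rw [mul_pow, mul_pow, mul_pow, ← e0, ← e1, ← e2, ← e3]
  simp only [val4]
  ring

lemma toV_three (x y : ℕ) (h : toV x + toV y + toV x = 0) : toV x = toV y := by
  have h3 : ∀ a b : ZMod 3, a + b + a = 0 → a = b := by decide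
  funext i
  exact h3 _ _ (congrFun h i)

lemma val4_pos (c : ℕ) : 0 < val4 c := by unfold val4; positivity

lemma wt_ge_one {t c : ℕ} (h : val4 c ≤ t) : 1 ≤ wt t c := by
  unfold wt; rw [Nat.ble_eq_true_of_le h]; simp

lemma wt_ge_two {t c : ℕ} (h : 8 * val4 c ≤ t) : 2 ≤ wt t c := by
  unfold wt
  rw [Nat.ble_eq_true_of_le h, Nat.ble_eq_true_of_le (show val4 c ≤ t by omega)]; simp

lemma F_le (n : ℕ) : Fkd 3 3 n ≤ ∑ v ∈ Rg DU n, cu UU (n / v) := by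
  classical
  obtain ⟨A, hA, hTF, hcard⟩ := exists_F n
  rw [← hcard]
  have hd : ∀ a : ℕ, ∃ c v z : ℕ, a ≠ 0 → (a = val4 c * v * z ^ 3 ∧ c < 81 ∧ v ≠ 0 ∧ z ≠ 0 ∧
    ∀ d ∈ DU, ¬ d ∣ v) := by
    intro a
    by_cases ha : a = 0
    · exact ⟨0, 0, 0, fun h => absurd ha h⟩
    · obtain ⟨c, v, z, h⟩ := full_dec a ha
      exact ⟨c, v, z, fun _ => h⟩
  choose cc vv zz hdec using hd
  have hdec' : ∀ a ∈ A, a = val4 (cc a) * vv a * zz a ^ 3 ∧ cc a < 81 ∧ vv a ≠ 0 ∧ zz a ≠ 0 ∧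
    ∀ d ∈ DU, ¬ d ∣ vv a := fun a ha => hdec a (by have := (mem_Icc.1 (hA ha)).1; omega)
  have hle : ∀ a ∈ A, val4 (cc a) * vv a * zz a ^ 3 ≤ n := fun a ha => by
    rw [← (hdec' a ha).1]; exact (mem_Icc.1 (hA ha)).2
  have hmap : ∀ a ∈ A, vv a ∈ Rg DU n := by
    intro a ha
    obtain ⟨-, -, h2, h3, h4⟩ := hdec' a ha
    refine mem_filter.2 ⟨mem_Icc.2 ⟨Nat.pos_of_ne_zero h2, ?_⟩, h4⟩
    have := hle a ha
    have e1 := val4_pos (cc a)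
    have e2 : 0 < zz a ^ 3 := pow_pos (Nat.pos_of_ne_zero h3) 3
    calc vv a ≤ val4 (cc a) * vv a := Nat.le_mul_of_pos_left _ e1
      _ ≤ val4 (cc a) * vv a * zz a ^ 3 := Nat.le_mul_of_pos_right _ e2
      _ ≤ n := this
  rw [card_eq_sum_card_fiberwise hmap]
  refine sum_le_sum fun v hv => ?_
  have hv1 := mem_Icc.1 (mem_filter.1 hv).1
  set B := A.filter (fun a => vv a = v) with hB
  have hBA : ∀ a ∈ B, a ∈ A ∧ vv a = v := fun a ha => mem_filter.1 ha
  have hcap : CCap (B.image cc) := by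
    constructor
    · intro x hx
      obtain ⟨a, ha, rfl⟩ := mem_image.1 hx
      exact (hdec' a (hBA a ha).1).2.1
    · intro x hx y hy z hz h
      obtain ⟨a, ha, rfl⟩ := mem_image.1 hx
      obtain ⟨b, hb, rfl⟩ := mem_image.1 hy
      obtain ⟨c, hc, rfl⟩ := mem_image.1 hz
      by_contra hne
      obtain ⟨a1, a2, -⟩ := hdec' a (hBA a ha).1
      obtain ⟨b1, b2, -⟩ := hdec' b (hBA b hb).1
      obtain ⟨c1, c2, -⟩ := hdec' c (hBA c hc).1
      have hac : cc a ≠ cc c := fun e => by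
        rw [← e] at h
        exact hne (toV_inj _ a2 _ b2 (toV_three _ _ h))
      have hbc : cc b ≠ cc c := fun e => by
        rw [← e, add_comm (toV (cc a))] at h
        exact hne (toV_inj _ a2 _ b2 (toV_three _ _ h).symm)
      obtain ⟨r, hr⟩ := val4_cube _ _ _ h
      refine hTF a (hBA a ha).1 b (hBA b hb).1 c (hBA c hc).1 (fun e => hne (by rw [e]))
        (fun e => hac (by rw [e])) (fun e => hbc (by rw [e])) (r * v * zz a * zz b * zz c) ?_
      rw [(hBA a ha).2] at a1
      rw [(hBA b hb).2] at b1
      rw [(hBA c hc).2] at c1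
      calc a * b * c = (val4 (cc a) * v * zz a ^ 3) * (val4 (cc b) * v * zz b ^ 3) *
            (val4 (cc c) * v * zz c ^ 3) := by rw [← a1, ← b1, ← c1]
        _ = (val4 (cc a) * val4 (cc b) * val4 (cc c)) * (v * zz a * zz b * zz c) ^ 3 := by ring
        _ = _ := by rw [hr]; ring
  refine le_trans ?_ (ccap_le hcap (n / v) (Nat.div_pos hv1.2 hv1.1))
  rw [card_eq_sum_card_image cc B]
  refine sum_le_sum fun x hx => ?_
  set E := B.filter (fun a => cc a = x) with hE
  have hEx : ∀ a ∈ E, a ∈ A ∧ a = val4 x * v * zz a ^ 3 ∧ zz a ≠ 0 ∧ val4 x * v * zz a ^ 3 ≤ n := by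
    intro a ha
    obtain ⟨h1, h2⟩ := mem_filter.1 ha
    obtain ⟨h3, h4⟩ := hBA a h1
    have h5 := hdec' a h3
    have h6 := hle a h3
    rw [h2, h4] at h5 h6
    exact ⟨h3, h5.1, h5.2.2.2.1, h6⟩
  have hE2 : E.card ≤ 2 := by
    by_contra hcon
    obtain ⟨a, ha, b, hb, c, hc, hab, hac, hbc⟩ := two_lt_card.1 (not_le.1 hcon)
    obtain ⟨a0, a1, -⟩ := hEx a ha
    obtain ⟨b0, b1, -⟩ := hEx b hb
    obtain ⟨c0, c1, -⟩ := hEx c hc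
    refine hTF a a0 b b0 c c0 hab hac hbc (val4 x * v * zz a * zz b * zz c) ?_
    calc a * b * c = (val4 x * v * zz a ^ 3) * (val4 x * v * zz b ^ 3) *
            (val4 x * v * zz c ^ 3) := by rw [← a1, ← b1, ← c1]
      _ = _ := by ring
  have big : ∀ a ∈ E, ∀ m, m ≤ zz a → m ^ 3 * val4 x ≤ n / v := by
    intro a ha m hm
    rw [Nat.le_div_iff_mul_le hv1.1]
    calc m ^ 3 * val4 x * v = val4 x * v * m ^ 3 := by ring
      _ ≤ val4 x * v * zz a ^ 3 := Nat.mul_le_mul_left _ (Nat.pow_le_pow_left hm 3)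
      _ ≤ n := (hEx a ha).2.2.2
  by_cases h1 : 1 < E.card
  · obtain ⟨a, ha, b, hb, hab⟩ := one_lt_card.1 h1
    have hz : zz a ≠ zz b := fun e => hab (by rw [(hEx a ha).2.1, (hEx b hb).2.1, e])
    have ha0 := (hEx a ha).2.2.1
    have hb0 := (hEx b hb).2.2.1
    refine hE2.trans (wt_ge_two ?_)
    rcases (by omega : 2 ≤ zz a ∨ 2 ≤ zz b) with h | h
    · exact big a ha 2 h
    · exact big b hb 2 h
  · by_cases h0 : E = ∅
    · rw [h0]; simp
    · obtain ⟨a, ha⟩ := nonempty_iff_ne_empty.2 h0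
      have := wt_ge_one (t := n / v) (c := x) (by simpa using big a ha 1 (Nat.pos_of_ne_zero (hEx a ha).2.2.1))
      omega

lemma upper_bound {C : ℝ} (hC : Tendsto (fun n : ℕ => (Fkd 3 3 n : ℝ) / n) atTop (nhds C)) :
    C ≤ 0.7136 := by
  have h := tendsto_sum_cu DU (by decide) (by decide +kernel) UU (by decide)
  have h2 := le_of_tendsto_of_tendsto' hC h (fun n => by
    have : (Fkd 3 3 n : ℝ) ≤ ((∑ v ∈ Rg DU n, cu UU (n / v) : ℕ) : ℝ) := by exact_mod_cast F_le n
    gcongr)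
  refine h2.trans ?_
  have e1 : ∏ d ∈ DU, (1 - 1 / (d : ℝ)) = (8 / 35) * ((1330 / 1331) * (2196 / 2197) *
      (4912 / 4913) * (6858 / 6859)) := by
    unfold DU
    rw [prod_insert (by decide), prod_insert (by decide), prod_insert (by decide),
      prod_insert (by decide), prod_insert (by decide), prod_insert (by decide),
      prod_insert (by decide), prod_singleton]
    norm_num
  have e2 : (UU.map (fun u : ℕ => 1 / (u : ℝ))).sum ≤ 3.12656 := by
    simp only [UU, List.map_cons, List.map_nil, List.sum_cons, List.sum_nil]
    norm_num
  rw [e1]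
  calc _ ≤ (8 / 35) * ((1330 / 1331) * (2196 / 2197) *
      (4912 / 4913) * (6858 / 6859)) * (3.12656 : ℝ) := by gcongr
    _ ≤ 0.7136 := by norm_num

theorem stmt_4 : ∃ C : ℝ, 0.6919 ≤ C ∧ C ≤ 0.7136 ∧
    Filter.Tendsto (fun n : ℕ => (Fkd 3 3 n : ℝ) / (n : ℝ)) Filter.atTop (nhds C) := by
  obtain ⟨C, hC⟩ := lim_exists
  exact ⟨C, lower_bound hC, upper_bound hC, hC⟩
end

section
/- There exist positive real constants c1 and c2 such that for every sufficiently large positive integer n, π(n) + c1·n^{3/4}/(log n)^{3/2} < f_{6,3}(n) < π(n) + c2·n^{3/4}/(log n)^{3/2}. -/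
open Finset Filter

/-- The multiset of the values of `a` can be partitioned into groups,
each consisting of `d` copies of a single number. -/
def TrivialSol (d : ℕ) {k : ℕ} (a : Fin k → ℕ) : Prop :=
  ∀ y : ℕ, d ∣ (List.ofFn a : Multiset ℕ).count y

/-- `fkd k d n` is the maximum cardinality of a set `A ⊆ {1,…,n}` such that whenever
`a_1, …, a_k ∈ A` (not necessarily distinct) and `a_1 ⋯ a_k = x ^ d` for a positive integer
`x`, the multiset of the `a_i` is trivial. -/
noncomputable def fkd (k d n : ℕ) : ℕ :=
  sSup {m : ℕ | ∃ A : Finset ℕ, A ⊆ Finset.Icc 1 n ∧ A.card = m ∧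
    ∀ (a : Fin k → ℕ) (x : ℕ), (∀ i, a i ∈ A) → 0 < x →
      (∏ i, a i) = x ^ d → TrivialSol d a}


lemma c4_core (E : Finset (ℕ × ℕ)) (U V : Finset ℕ) (hE : ∀ e ∈ E, e.1 ∈ U ∧ e.2 ∈ V)
    (h : ∀ u1 u2 v1 v2, (u1,v1) ∈ E → (u1,v2) ∈ E → (u2,v1) ∈ E → (u2,v2) ∈ E →
      u1 = u2 ∨ v1 = v2) :
    E.card = ∑ u ∈ U, (V.filter (fun v => (u,v) ∈ E)).card ∧
    ∑ u ∈ U, (V.filter (fun v => (u,v) ∈ E)).card ^ 2 ≤ V.card ^ 2 + E.card := by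
  classical
  have h1 : E.card = ∑ u ∈ U, (V.filter (fun v => (u,v) ∈ E)).card := by
    rw [← Finset.card_sigma]
    refine Finset.card_bij (fun e _ => ⟨e.1, e.2⟩) ?_ ?_ ?_
    · intro e he
      simp [hE e he, he]
    · rintro ⟨a, b⟩ _ ⟨c, d⟩ _ h
      simpa using h
    · rintro ⟨a, b⟩ hb
      simp only [Finset.mem_sigma, Finset.mem_filter] at hb
      exact ⟨(a, b), hb.2.2, rfl⟩
  refine ⟨h1, ?_⟩
  have h2 : ∑ u ∈ U, (V.filter (fun v => (u,v) ∈ E)).offDiag.card ≤ V.card ^ 2 := by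
    rw [← Finset.card_sigma, sq, ← Finset.card_product]
    refine Finset.card_le_card_of_injOn (fun s => s.2) ?_ ?_
    · rintro ⟨u, v, v'⟩ hs
      simp at hs ⊢
      tauto
    · rintro ⟨u, v, v'⟩ hs ⟨u', w, w'⟩ hs' heq
      simp at hs hs' heq
      obtain ⟨rfl, rfl⟩ := heq
      have := h u u' v v' (by tauto) (by tauto) (by tauto) (by tauto)
      have : u = u' := by tauto
      subst this; rfl
  have h3 : ∀ u ∈ U, (V.filter (fun v => (u,v) ∈ E)).card ^ 2 =
      (V.filter (fun v => (u,v) ∈ E)).offDiag.card + (V.filter (fun v => (u,v) ∈ E)).card := by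
    intro u _
    rw [Finset.offDiag_card, sq]
    have : (V.filter (fun v => (u,v) ∈ E)).card ≤ (V.filter (fun v => (u,v) ∈ E)).card * (V.filter (fun v => (u,v) ∈ E)).card := Nat.le_mul_self _
    omega
  rw [Finset.sum_congr rfl h3, Finset.sum_add_distrib, ← h1]
  omega

lemma c4_bound1 (E : Finset (ℕ × ℕ)) (U V : Finset ℕ) (hE : ∀ e ∈ E, e.1 ∈ U ∧ e.2 ∈ V)
    (h : ∀ u1 u2 v1 v2, (u1,v1) ∈ E → (u1,v2) ∈ E → (u2,v1) ∈ E → (u2,v2) ∈ E →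
      u1 = u2 ∨ v1 = v2) : E.card ≤ U.card + V.card ^ 2 := by
  obtain ⟨h1, h2⟩ := c4_core E U V hE h
  have : ∑ u ∈ U, 2 * (V.filter (fun v => (u,v) ∈ E)).card ≤
      ∑ u ∈ U, ((V.filter (fun v => (u,v) ∈ E)).card ^ 2 + 1) := by
    apply Finset.sum_le_sum
    intro u _
    generalize (V.filter (fun v => (u,v) ∈ E)).card = d
    rcases d with _ | d
    · simp
    · nlinarith [sq_nonneg (d:ℤ)]
  rw [← Finset.mul_sum, ← h1, Finset.sum_add_distrib] at this
  simp at this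
  omega

lemma c4_bound2 (E : Finset (ℕ × ℕ)) (U V : Finset ℕ) (hE : ∀ e ∈ E, e.1 ∈ U ∧ e.2 ∈ V)
    (h : ∀ u1 u2 v1 v2, (u1,v1) ∈ E → (u1,v2) ∈ E → (u2,v1) ∈ E → (u2,v2) ∈ E →
      u1 = u2 ∨ v1 = v2) : (E.card : ℝ) ≤ V.card * √(U.card) + U.card := by
  obtain ⟨h1, h2⟩ := c4_core E U V hE h
  have h3 : E.card ^ 2 ≤ U.card * (V.card ^ 2 + E.card) := by
    calc E.card ^ 2 = (∑ u ∈ U, (V.filter (fun v => (u,v) ∈ E)).card) ^ 2 := by rw [← h1]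
      _ ≤ U.card * ∑ u ∈ U, (V.filter (fun v => (u,v) ∈ E)).card ^ 2 := sq_sum_le_card_mul_sum_sq
      _ ≤ _ := Nat.mul_le_mul_left _ h2
  have h4 : (E.card : ℝ) ^ 2 ≤ U.card * (V.card ^ 2 + E.card) := by exact_mod_cast h3
  by_contra hc
  push Not at hc
  set s : ℝ := V.card * √(U.card) with hs
  have hs2 : s ^ 2 = V.card ^ 2 * U.card := by
    rw [hs, mul_pow, Real.sq_sqrt (by positivity)]
  have hs0 : 0 ≤ s := by positivity
  have hu0 : (0:ℝ) ≤ U.card := by positivity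
  nlinarith

def MSidon (A : Finset ℕ) : Prop :=
  ∀ a ∈ A, ∀ b ∈ A, ∀ c ∈ A, ∀ d ∈ A, a * b = c * d → a = c ∨ a = d

lemma sidon_graph (A : Finset ℕ) (hA0 : ∀ a ∈ A, 0 < a) (hA : MSidon A) (B : Finset ℕ) (hB : B ⊆ A)
    (U V : Finset ℕ) (hUV : ∀ a ∈ B, ∃ u ∈ U, ∃ v ∈ V, u * v = a) :
    B.card ≤ U.card + V.card ^ 2 ∧ (B.card : ℝ) ≤ V.card * √(U.card) + U.card := by
  classical
  choose! f hf g hg hfg using hUV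
  set E := B.image (fun a => (f a, g a)) with hEdef
  have hcard : E.card = B.card := by
    apply Finset.card_image_of_injOn
    intro a ha b hb hab
    simp only [Prod.mk.injEq] at hab
    rw [← hfg a ha, ← hfg b hb, hab.1, hab.2]
  have hmem : ∀ u v, (u, v) ∈ E → u * v ∈ A := by
    intro u v huv
    simp only [hEdef, Finset.mem_image, Prod.mk.injEq] at huv
    obtain ⟨a, ha, rfl, rfl⟩ := huv
    rw [hfg a ha]; exact hB ha
  have hE : ∀ e ∈ E, e.1 ∈ U ∧ e.2 ∈ V := by
    intro e he
    simp only [hEdef, Finset.mem_image] at he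
    obtain ⟨a, ha, rfl⟩ := he
    exact ⟨hf a ha, hg a ha⟩
  have h : ∀ u1 u2 v1 v2, (u1,v1) ∈ E → (u1,v2) ∈ E → (u2,v1) ∈ E → (u2,v2) ∈ E →
      u1 = u2 ∨ v1 = v2 := by
    intro u1 u2 v1 v2 h11 h12 h21 h22
    have p := hA0 _ (hmem _ _ h11)
    have hu : 0 < u1 := Nat.pos_of_mul_pos_right p
    have hv : 0 < v1 := Nat.pos_of_mul_pos_left p
    rcases hA _ (hmem _ _ h11) _ (hmem _ _ h22) _ (hmem _ _ h12) _ (hmem _ _ h21) (by ring) with h | h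
    · right; exact Nat.eq_of_mul_eq_mul_left hu h
    · left; exact Nat.eq_of_mul_eq_mul_right hv h
  rw [← hcard]
  exact ⟨c4_bound1 E U V hE h, c4_bound2 E U V hE h⟩

def Rough (w : ℝ) (r : ℕ) : Prop := ∀ p : ℕ, p.Prime → p ∣ r → w ≤ p
def Smth (w : ℝ) (r : ℕ) : Prop := ∀ p : ℕ, p.Prime → p ∣ r → (p:ℝ) < w

lemma smth_div (w : ℝ) (hw : 1 < w) (t : ℕ) (ht0 : 0 < t) (ht : Smth w t) (Y : ℝ) (hY : 1 ≤ Y) (hYt : Y ≤ t) :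
    ∃ t' : ℕ, t' ∣ t ∧ Y ≤ t' ∧ (t':ℝ) < Y * w := by
  classical
  have hex : ∃ d : ℕ, d ∣ t ∧ Y ≤ d := ⟨t, dvd_rfl, hYt⟩
  refine ⟨Nat.find hex, (Nat.find_spec hex).1, (Nat.find_spec hex).2, ?_⟩
  set d := Nat.find hex with hd
  have hs := Nat.find_spec hex
  rw [← hd] at hs
  by_cases h1 : d = 1
  · rw [h1]; push_cast; nlinarith
  · obtain ⟨p, hp, e, he⟩ := Nat.exists_prime_and_dvd h1
    have hd0 : 0 < d := Nat.pos_of_dvd_of_pos hs.1 ht0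
    have he0 : 0 < e := by
      rcases Nat.eq_zero_or_pos e with h | h
      · subst h; omega
      · exact h
    have hlt : e < d := by
      rw [he]; nlinarith [hp.two_le]
    have hm := Nat.find_min hex (hd ▸ hlt)
    have hedvd : e ∣ t := (Dvd.intro_left p he.symm).trans hs.1
    have heY : (e:ℝ) < Y := by
      by_contra hc
      exact hm ⟨hedvd, not_lt.mp hc⟩
    have hpw := ht p hp ((Dvd.intro e he.symm).trans hs.1)
    rw [he]; push_cast
    have : (0:ℝ) < p := by exact_mod_cast hp.pos
    have : (0:ℝ) < e := by exact_mod_cast he0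
    nlinarith

lemma smth_rough (w : ℝ) (e : ℕ) (he : 0 < e) : ∃ t r : ℕ, e = t * r ∧ Smth w t ∧ Rough w r := by
  induction e using induction_on_primes with
  | zero => omega
  | one => exact ⟨1, 1, rfl, fun p hp h => absurd (Nat.dvd_one.mp h) hp.ne_one, fun p hp h => absurd (Nat.dvd_one.mp h) hp.ne_one⟩
  | prime_mul p a hp ih =>
    obtain ⟨t, r, rfl, ht, hr⟩ := ih (Nat.pos_of_mul_pos_left he)
    by_cases h : (p:ℝ) < w
    · refine ⟨p * t, r, by ring, ?_, hr⟩
      intro q hq hqd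
      rcases (Nat.Prime.dvd_mul hq).1 hqd with h' | h'
      · rw [(Nat.prime_dvd_prime_iff_eq hq hp).1 h']; exact h
      · exact ht q hq h'
    · refine ⟨t, p * r, by ring, ht, ?_⟩
      intro q hq hqd
      rcases (Nat.Prime.dvd_mul hq).1 hqd with h' | h'
      · rw [(Nat.prime_dvd_prime_iff_eq hq hp).1 h']; exact not_lt.mp h
      · exact hr q hq h'

lemma bad_structure (w : ℝ) (hw : 1 < w) (a : ℕ) (ha : 0 < a) (han : (a:ℝ) ≤ w ^ 24)
    (hP : ∀ p : ℕ, p.Prime → p ∣ a → (p:ℝ) ≤ w ^ 17)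
    (hM : ∀ u v : ℕ, u * v = a → (v:ℝ) ≤ w ^ 11 → w ^ 17 < u) :
    ∃ t r1 r2 : ℕ, a = t * r1 * r2 ∧ r2 ≤ r1 ∧ Rough w r1 ∧ Rough w r2 ∧ w ^ 11 < r2 := by
  classical
  have hwp : 0 < w := by linarith
  -- symmetric form
  have hM' : ∀ u : ℕ, u ∣ a → w ^ 13 ≤ u → w ^ 17 < u := by
    rintro u ⟨v, hv⟩ hu
    apply hM u v hv.symm
    have h1 : (a:ℝ) = u * v := by exact_mod_cast hv
    have : w ^ 13 * v ≤ w ^ 13 * w ^ 11 := by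
      calc w ^ 13 * (v:ℝ) ≤ u * v := by gcongr
        _ = a := h1.symm
        _ ≤ w ^ 24 := han
        _ = _ := by ring
    exact le_of_mul_le_mul_left this (by positivity)
  have hpw : ∀ i j : ℕ, i ≤ j → w ^ i ≤ w ^ j := fun i j h => pow_le_pow_right₀ hw.le h
  set S := a.divisors.filter (fun d => Rough w d ∧ (d:ℝ) ≤ w ^ 13) with hS
  have hne : S.Nonempty := ⟨1, by
    simp only [hS, Finset.mem_filter, Nat.mem_divisors]
    refine ⟨⟨one_dvd _, ha.ne'⟩, fun p hp h => absurd (Nat.dvd_one.mp h) hp.ne_one, ?_⟩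
    push_cast; exact one_le_pow₀ hw.le⟩
  obtain ⟨d, hdS, hdmax⟩ := S.exists_max_image (fun d => d) hne
  have hdS' := hdS
  simp only [hS, Finset.mem_filter, Nat.mem_divisors] at hdS
  obtain ⟨⟨⟨e, he⟩, -⟩, hdr, hd13⟩ := hdS
  have he0 : 0 < e := by
    rcases Nat.eq_zero_or_pos e with h | h
    · subst h; omega
    · exact h
  have hd0 : 0 < d := by
    rcases Nat.eq_zero_or_pos d with h | h
    · subst h; omega
    · exact h
  have hd0' : (0:ℝ) < d := by exact_mod_cast hd0
  have haR : (a:ℝ) = d * e := by exact_mod_cast he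
  have hd11 : w ^ 11 < d := by
    by_contra hc
    push Not at hc
    have he17 : w ^ 17 < e := hM e d (by rw [he]; ring) hc
    have hd7 : (d:ℝ) < w ^ 7 := by
      have : (d:ℝ) * w ^ 17 < w ^ 7 * w ^ 17 := by
        calc (d:ℝ) * w ^ 17 < d * e := by gcongr
          _ = a := haR.symm
          _ ≤ w ^ 24 := han
          _ = _ := by ring
      exact lt_of_mul_lt_mul_right this (by positivity)
    have hes : Smth w e := by
      intro p hp hpe
      by_contra hpw'
      push Not at hpw'
      have hpa : p ∣ a := hpe.trans (Dvd.intro_left d he.symm)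
      have hdp : d * p ∣ a := by rw [he]; exact Nat.mul_dvd_mul_left d hpe
      have hrp : Rough w p := by
        intro q hq hqp
        rw [(Nat.prime_dvd_prime_iff_eq hq hp).1 hqp]; exact hpw'
      have hrdp : Rough w (d * p) := by
        intro q hq hqd
        rcases (Nat.Prime.dvd_mul hq).1 hqd with h | h
        · exact hdr q hq h
        · exact hrp q hq h
      have hdp13 : w ^ 13 < ((d * p : ℕ) : ℝ) := by
        by_contra hc2
        have hmem : d * p ∈ S := by
          simp only [hS, Finset.mem_filter, Nat.mem_divisors]
          exact ⟨⟨hdp, ha.ne'⟩, hrdp, not_lt.mp hc2⟩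
        have := hdmax _ hmem
        nlinarith [hp.two_le]
      have hdp17 := hM' _ hdp hdp13.le
      have hp10 : w ^ 10 < p := by
        have : w ^ 7 * w ^ 10 < w ^ 7 * p := by
          calc w ^ 7 * w ^ 10 = w ^ 17 := by ring
            _ < ((d * p : ℕ):ℝ) := hdp17
            _ = d * p := by push_cast; ring
            _ ≤ w ^ 7 * p := by gcongr
        exact lt_of_mul_lt_mul_left this (by positivity)
      have hp13 : (p:ℝ) ≤ w ^ 13 := by
        by_contra hc2
        have := hM' p hpa (not_le.mp hc2).le
        linarith [hP p hp hpa]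
      have hmem : p ∈ S := by
        simp only [hS, Finset.mem_filter, Nat.mem_divisors]
        exact ⟨⟨hpa, ha.ne'⟩, hrp, hp13⟩
      have h1 : p ≤ d := hdmax _ hmem
      have h2 : (p:ℝ) ≤ d := by exact_mod_cast h1
      linarith [hpw 7 10 (by norm_num)]
    obtain ⟨t', ht'e, ht'1, ht'2⟩ := smth_div w hw e he0 hes (w ^ 13) (one_le_pow₀ hw.le)
      (by linarith [hpw 13 17 (by norm_num)])
    have h1 := hM' t' (ht'e.trans (Dvd.intro_left d he.symm)) ht'1
    have h2 : w ^ 13 * w = w ^ 14 := by ring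
    linarith [hpw 14 17 (by norm_num)]
  obtain ⟨t, r, hetr, hts, hrr⟩ := smth_rough w e he0
  have ht0 : 0 < t := by
    rcases Nat.eq_zero_or_pos t with h | h
    · subst h; omega
    · exact h
  have ht2 : (t:ℝ) < w ^ 2 := by
    by_contra hc
    push Not at hc
    obtain ⟨t', ht't, ht'1, ht'2⟩ := smth_div w hw t ht0 hts (w ^ 2) (one_le_pow₀ hw.le) hc
    have hdv : d * t' ∣ a := by
      rw [he, hetr]; exact Nat.mul_dvd_mul_left d (ht't.trans (Dvd.intro r rfl))
    have h13 : w ^ 13 ≤ ((d * t' : ℕ):ℝ) := by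
      push_cast
      calc w ^ 13 = w ^ 11 * w ^ 2 := by ring
        _ ≤ _ := by gcongr
    have h17 := hM' _ hdv h13
    push_cast at h17
    have : (d:ℝ) * t' ≤ w ^ 13 * (w ^ 2 * w) := by gcongr
    have h2 : w ^ 13 * (w ^ 2 * w) = w ^ 16 := by ring
    linarith [hpw 16 17 (by norm_num)]
  rcases le_total d r with h | h
  · exact ⟨t, r, d, by rw [he, hetr]; ring, h, hrr, hdr, hd11⟩
  · refine ⟨t, d, r, by rw [he, hetr]; ring, h, hdr, hrr, ?_⟩
    by_contra hc
    push Not at hc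
    have h1 := hM (t * d) r (by rw [he, hetr]; ring) hc
    push_cast at h1
    have : (t:ℝ) * d ≤ w ^ 2 * w ^ 13 := by gcongr
    have h2 : w ^ 2 * w ^ 13 = w ^ 15 := by ring
    linarith [hpw 15 17 (by norm_num)]
lemma mertens_up (N : ℕ) : ∑ p ∈ (Ioc 0 N).filter Nat.Prime, Real.log p / p ≤ 2 * Real.log N := by
  classical
  rcases Nat.eq_zero_or_pos N with h0 | h0
  · subst h0; simp
  have hN : (0:ℝ) < N := by exact_mod_cast h0
  have h1 : ∀ m ∈ Ioc 0 N, ∑ p ∈ (Ioc 0 N).filter Nat.Prime, (if p ∣ m then Real.log p else 0) ≤ Real.log N := by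
    intro m hm
    simp only [mem_Ioc] at hm
    calc _ = ∑ p ∈ ((Ioc 0 N).filter Nat.Prime).filter (fun p => p ∣ m), Real.log p := by
            rw [Finset.sum_filter (p := fun p => p ∣ m)]
      _ = ∑ p ∈ ((Ioc 0 N).filter Nat.Prime).filter (fun p => p ∣ m), ArithmeticFunction.vonMangoldt p := by
            apply Finset.sum_congr rfl
            intro p hp
            simp only [mem_filter] at hp
            rw [ArithmeticFunction.vonMangoldt_apply_prime hp.1.2]
      _ ≤ ∑ p ∈ m.divisors, ArithmeticFunction.vonMangoldt p := by
            apply Finset.sum_le_sum_of_subset_of_nonneg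
            · intro p hp
              simp only [mem_filter] at hp
              simp [hp.2]; omega
            · intros; exact ArithmeticFunction.vonMangoldt_nonneg
      _ = Real.log m := ArithmeticFunction.vonMangoldt_sum
      _ ≤ Real.log N := Real.log_le_log (by exact_mod_cast hm.1) (by exact_mod_cast hm.2)
  have h2 := Finset.sum_le_sum h1
  rw [Finset.sum_comm] at h2
  simp only [sum_const, Nat.card_Ioc, nsmul_eq_mul, tsub_zero] at h2
  have h3 : (N:ℝ) * ∑ p ∈ (Ioc 0 N).filter Nat.Prime, Real.log p / p ≤
      2 * ∑ p ∈ (Ioc 0 N).filter Nat.Prime, ∑ m ∈ Ioc 0 N, (if p ∣ m then Real.log p else 0) := by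
    rw [Finset.mul_sum, Finset.mul_sum]
    apply Finset.sum_le_sum
    intro p hp
    simp only [mem_filter, mem_Ioc] at hp
    rw [← Finset.sum_filter, Finset.sum_const, Nat.Ioc_filter_dvd_card_eq_div, nsmul_eq_mul]
    have hp0 : (0:ℝ) < p := by exact_mod_cast hp.1.1
    have hl : 0 ≤ Real.log p := Real.log_natCast_nonneg p
    have hq : 1 ≤ N / p := Nat.div_pos hp.1.2 hp.1.1
    have hmod : N < p * (N / p) + p := by
      have := Nat.div_add_mod N p
      have := Nat.mod_lt N hp.1.1
      omega
    have h4 : (N:ℝ) ≤ 2 * (p * (N / p : ℕ)) := by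
      have : N ≤ 2 * (p * (N / p)) := by nlinarith
      exact_mod_cast this
    rw [← mul_div_assoc, div_le_iff₀ hp0]
    calc (N:ℝ) * Real.log p ≤ (2 * (p * (N / p : ℕ))) * Real.log p := by gcongr
      _ = _ := by ring
  have h4 : (N:ℝ) * ∑ p ∈ (Ioc 0 N).filter Nat.Prime, Real.log p / p ≤ N * (2 * Real.log N) := by
    linarith
  exact le_of_mul_le_mul_left h4 hN

open Classical in
lemma sum_inv_rough (w : ℝ) (hw : 1 < w) (N : ℕ) (hN : Real.log N ≤ 14 * Real.log w) :
    ∑ m ∈ (Ioc 0 N).filter (Rough w), (1:ℝ) / m ≤ Real.exp 56 := by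
  set s := (Ioc 0 N).filter (fun p : ℕ => p.Prime ∧ w ≤ p) with hs
  let f : ℕ →* ℝ := { toFun := fun n => (n:ℝ)⁻¹, map_one' := by simp, map_mul' := by intro a b; push_cast; rw [mul_inv] }
  have hfp : ∀ {p : ℕ}, p.Prime → ‖f p‖ < 1 := by
    intro p hp
    have : (1:ℝ) < p := by exact_mod_cast hp.one_lt
    show ‖(p:ℝ)⁻¹‖ < 1
    rw [norm_inv, Real.norm_natCast]
    exact inv_lt_one_of_one_lt₀ this
  obtain ⟨hs1, hs2⟩ := EulerProduct.summable_and_hasSum_factoredNumbers_prod_filter_prime_geometric hfp s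
  have h1 : ∑ m ∈ (Ioc 0 N).filter (Rough w), (1:ℝ) / m ≤ ∏ p ∈ s with p.Prime, (1 - f p)⁻¹ := by
    have hmem : ∀ m ∈ (Ioc 0 N).filter (Rough w), m ∈ Nat.factoredNumbers s := by
      intro m hm
      simp only [mem_filter, mem_Ioc] at hm
      rw [Nat.mem_factoredNumbers_iff_forall_le]
      refine ⟨by omega, fun p hpm hp hd => ?_⟩
      simp only [hs, mem_filter, mem_Ioc]
      exact ⟨⟨hp.pos, by omega⟩, hp, hm.2 p hp hd⟩
    calc _ = ∑ m ∈ ((Ioc 0 N).filter (Rough w)).attach, f (m:ℕ) := by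
            rw [← Finset.sum_attach]
            apply Finset.sum_congr rfl
            intro m _
            simp [f]
      _ = ∑ m ∈ (((Ioc 0 N).filter (Rough w)).attach.image (fun m => (⟨m.1, hmem m.1 m.2⟩ : Nat.factoredNumbers s))), f (m:ℕ) := by
            rw [Finset.sum_image]
            rintro ⟨a, ha⟩ _ ⟨b, hb⟩ _ h
            simpa using h
      _ ≤ _ := by
            apply sum_le_hasSum _ _ hs2
            intro i _
            show 0 ≤ ((i:ℕ):ℝ)⁻¹
            positivity
  refine h1.trans ?_
  have h2 : ∏ p ∈ s with p.Prime, (1 - f p)⁻¹ ≤ ∏ p ∈ s with p.Prime, Real.exp (2 * (1 / p)) := by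
    apply Finset.prod_le_prod
    · intro p hp
      have := hfp (mem_filter.1 hp).2
      have h3 := Real.norm_eq_abs (f p) ▸ this
      have := (abs_lt.1 h3).2
      apply inv_nonneg.2; linarith
    · intro p hp
      have hpp := (mem_filter.1 hp).2
      have hp2 : (2:ℝ) ≤ p := by exact_mod_cast hpp.two_le
      show (1 - (p:ℝ)⁻¹)⁻¹ ≤ _
      have hx : (p:ℝ)⁻¹ ≤ 1/2 := by rw [one_div]; exact inv_anti₀ (by norm_num) hp2
      have hx0 : 0 < (p:ℝ)⁻¹ := by positivity
      rw [one_div]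
      set x := (p:ℝ)⁻¹
      have h4 : 2 * x + 1 ≤ Real.exp (2 * x) := Real.add_one_le_exp _
      refine le_trans ?_ h4
      rw [inv_le_comm₀ (by linarith) (by linarith), inv_le_iff_one_le_mul₀ (by linarith)]
      nlinarith
  refine h2.trans ?_
  rw [← Real.exp_sum, ← Finset.mul_sum]
  apply Real.exp_le_exp.2
  have hlw : 0 < Real.log w := Real.log_pos hw
  have h3 : ∑ p ∈ s with p.Prime, (1:ℝ) / p ≤ ∑ p ∈ (Ioc 0 N).filter Nat.Prime, (Real.log p / p) / Real.log w := by
    calc _ ≤ ∑ p ∈ s with p.Prime, (Real.log p / p) / Real.log w := by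
            apply Finset.sum_le_sum
            intro p hp
            simp only [hs, mem_filter, mem_Ioc] at hp
            have hp0 : (0:ℝ) < p := by exact_mod_cast hp.1.1.1
            have hl : Real.log w ≤ Real.log p := Real.log_le_log (by linarith) hp.1.2.2
            rw [le_div_iff₀ hlw, one_div, div_eq_mul_inv, mul_comm]
            gcongr
      _ ≤ _ := by
            apply Finset.sum_le_sum_of_subset_of_nonneg
            · intro p hp
              simp only [hs, mem_filter] at hp ⊢
              tauto
            · intro p _ _
              have := Real.log_natCast_nonneg p
              positivity
  rw [← Finset.sum_div] at h3
  have h5 := mertens_up N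
  have h6 : (∑ p ∈ (Ioc 0 N).filter Nat.Prime, Real.log p / p) / Real.log w ≤ 28 := by
    rw [div_le_iff₀ hlw]; linarith
  linarith

open Classical in
lemma rough_log (w : ℝ) (hw : 1 < w) (N : ℕ) (hN : Real.log N ≤ 14 * Real.log w) :
    ∑ r ∈ (Ioc 0 N).filter (Rough w), Real.log r ≤ 6 * Real.exp 56 * N := by
  set R := (Ioc 0 N).filter (Rough w) with hR
  have h1 : ∀ r ∈ R, Real.log r = ∑ m ∈ R, if m ∣ r then ArithmeticFunction.vonMangoldt (r / m) else 0 := by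
    intro r hr
    simp only [hR, mem_filter, mem_Ioc] at hr
    rw [← ArithmeticFunction.vonMangoldt_sum, ← Nat.sum_div_divisors, ← Finset.sum_filter]
    apply Finset.sum_congr _ (fun _ _ => rfl)
    ext m
    simp only [Nat.mem_divisors, hR, mem_filter, mem_Ioc]
    constructor
    · rintro ⟨hd, -⟩
      have := Nat.le_of_dvd hr.1.1 hd
      refine ⟨⟨⟨Nat.pos_of_dvd_of_pos hd hr.1.1, by omega⟩, fun p hp hpm => hr.2 p hp (hpm.trans hd)⟩, hd⟩
    · rintro ⟨-, hd⟩
      exact ⟨hd, by omega⟩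
  rw [Finset.sum_congr rfl h1, Finset.sum_comm]
  have h2 : ∀ m ∈ R, (∑ r ∈ R, if m ∣ r then ArithmeticFunction.vonMangoldt (r / m) else 0) ≤ (6 * N) * (1 / (m:ℝ)) := by
    intro m hm
    simp only [hR, mem_filter, mem_Ioc] at hm
    have hm0 : (0:ℝ) < m := by exact_mod_cast hm.1.1
    rw [← Finset.sum_filter]
    have hle : ∑ r ∈ R.filter (fun r => m ∣ r), ArithmeticFunction.vonMangoldt (r / m) ≤ Chebyshev.psi ((N:ℝ) / m) := by
      rw [Chebyshev.psi, Nat.floor_div_eq_div]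
      rw [← Finset.sum_image (s := R.filter (fun r => m ∣ r)) (g := fun r => r / m) (f := fun d => ArithmeticFunction.vonMangoldt d)]
      · apply Finset.sum_le_sum_of_subset_of_nonneg
        · intro d hd
          simp only [mem_image, mem_filter, hR, mem_Ioc] at hd ⊢
          obtain ⟨r, ⟨⟨⟨hr0, hrN⟩, -⟩, hmr⟩, rfl⟩ := hd
          exact ⟨Nat.div_pos (Nat.le_of_dvd hr0 hmr) hm.1.1, Nat.div_le_div_right hrN⟩
        · intros; exact ArithmeticFunction.vonMangoldt_nonneg
      · intro a ha b hb hab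
        simp only [coe_filter, Set.mem_ofPred_eq] at ha hb
        simp only at hab
        rw [← Nat.div_mul_cancel ha.2, ← Nat.div_mul_cancel hb.2, hab]
    have h3 := Chebyshev.psi_le_const_mul_self (x := (N:ℝ) / m) (by positivity)
    have h4 : Real.log 4 ≤ 2 := by
      rw [show (4:ℝ) = 2 ^ 2 by norm_num, Real.log_pow]
      have := Real.log_two_lt_d9
      push_cast; linarith
    have h5 : (Real.log 4 + 4) * ((N:ℝ) / m) ≤ 6 * ((N:ℝ) / m) := by gcongr; linarith
    calc _ ≤ 6 * ((N:ℝ) / m) := by linarith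
      _ = _ := by ring
  refine (Finset.sum_le_sum h2).trans ?_
  rw [← Finset.mul_sum]
  have := sum_inv_rough w hw N hN
  calc _ ≤ (6 * N : ℝ) * Real.exp 56 := by gcongr
    _ = _ := by ring

open Classical in
lemma rough_count (w : ℝ) (hw : 2 ≤ w) (y : ℝ) (hy1 : w ^ 10 ≤ y) (hy2 : y ≤ w ^ 14) :
    (((Ioc 0 ⌊y⌋₊).filter (Rough w)).card : ℝ) ≤ (6 * Real.exp 56 + 1) * y / Real.log w := by
  have hlw : 0 < Real.log w := Real.log_pos (by linarith)
  have hw0 : 0 < w := by linarith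
  have hy0 : 0 < y := lt_of_lt_of_le (by positivity) hy1
  set R := (Ioc 0 ⌊y⌋₊).filter (Rough w) with hR
  have hfy : (⌊y⌋₊ : ℝ) ≤ y := Nat.floor_le hy0.le
  have h1 := rough_log w (by linarith) ⌊y⌋₊ (by
    have hf0 : (0:ℝ) < ⌊y⌋₊ := by
      have : (1:ℝ) ≤ y := le_trans (one_le_pow₀ (by linarith)) hy1
      exact_mod_cast Nat.floor_pos.2 this
    calc Real.log ⌊y⌋₊ ≤ Real.log (w ^ 14) := Real.log_le_log hf0 (hfy.trans hy2)
      _ = _ := by rw [Real.log_pow]; norm_num)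
  rw [← hR] at h1
  -- every r ≥ 2 in R has log r ≥ log w
  have h2 : ∀ r ∈ R, r ≠ 1 → Real.log w ≤ Real.log r := by
    intro r hr hr1
    simp only [hR, mem_filter, mem_Ioc] at hr
    obtain ⟨p, hp, hpr⟩ := Nat.exists_prime_and_dvd hr1
    have h3 := hr.2 p hp hpr
    have h4 : (p:ℝ) ≤ r := by exact_mod_cast Nat.le_of_dvd hr.1.1 hpr
    exact Real.log_le_log hw0 (h3.trans h4)
  have h3 : (R.card : ℝ) * Real.log w ≤ ∑ r ∈ R, (Real.log r + if r = 1 then Real.log w else 0) := by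
    rw [← nsmul_eq_mul]
    apply Finset.card_nsmul_le_sum
    intro r hr
    by_cases h : r = 1
    · simp [h]
    · simpa [h] using h2 r hr h
  rw [Finset.sum_add_distrib] at h3
  have h4 : ∑ r ∈ R, (if r = 1 then Real.log w else 0) ≤ y := by
    rw [Finset.sum_ite_eq']
    have h5 : Real.log w ≤ y := by
      have := Real.log_le_sub_one_of_pos hw0
      have h6 : w ^ 1 ≤ w ^ 10 := pow_le_pow_right₀ (by linarith) (by norm_num)
      rw [pow_one] at h6
      linarith
    split_ifs <;> linarith
  rw [le_div_iff₀ hlw]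
  have h5 : 6 * Real.exp 56 * (⌊y⌋₊ : ℝ) ≤ 6 * Real.exp 56 * y := by gcongr
  linarith

lemma card_Ioc_floor (y : ℝ) (hy : 0 ≤ y) : ((Ioc 0 ⌊y⌋₊).card : ℝ) ≤ y := by
  simpa using Nat.floor_le hy

open Classical in
lemma class_P (w : ℝ) (hw : 2 ≤ w) (n : ℕ) (hn : (n:ℝ) = w ^ 24) (A : Finset ℕ)
    (hAn : A ⊆ Icc 1 n) (hA : MSidon A) (B : Finset ℕ) (hB : B ⊆ A)
    (h : ∀ a ∈ B, ∃ p : ℕ, p.Prime ∧ p ∣ a ∧ w ^ 17 < p) :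
    (B.card : ℝ) ≤ Nat.primeCounting n + w ^ 14 := by
  have hA0 : ∀ a ∈ A, 0 < a := fun a ha => by have := hAn ha; simp at this; omega
  have h1 := (sidon_graph A hA0 hA B hB ((Ioc 0 n).filter Nat.Prime) (Ioc 0 ⌊w ^ 7⌋₊) (by
    intro a ha
    obtain ⟨p, hp, ⟨v, hv⟩, hpw⟩ := h a ha
    have han := hAn (hB ha)
    simp only [mem_Icc] at han
    have hv0 : 0 < v := by
      rcases Nat.eq_zero_or_pos v with h | h
      · subst h; omega
      · exact h
    have hle : p ≤ a := by rw [hv]; exact Nat.le_mul_of_pos_right p hv0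
    refine ⟨p, ?_, v, ?_, hv.symm⟩
    · simp only [mem_filter, mem_Ioc]; exact ⟨⟨hp.pos, by omega⟩, hp⟩
    · simp only [mem_Ioc]
      refine ⟨hv0, Nat.le_floor ?_⟩
      have h2 : w ^ 17 * v ≤ w ^ 17 * w ^ 7 := by
        calc w ^ 17 * v ≤ p * v := by gcongr
          _ = (a:ℝ) := by exact_mod_cast hv.symm
          _ ≤ n := by exact_mod_cast han.2
          _ = w ^ 17 * w ^ 7 := by rw [hn]; ring
      exact le_of_mul_le_mul_left h2 (by positivity))).1
  have h2 : ((Ioc 0 n).filter Nat.Prime).card = Nat.primeCounting n := by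
    rw [Nat.primeCounting, Nat.primeCounting', Nat.count_eq_card_filter_range]
    congr 1
    ext p
    simp only [mem_filter, mem_Ioc, mem_range]
    constructor
    · rintro ⟨h, hp⟩; exact ⟨by omega, hp⟩
    · rintro ⟨h, hp⟩; exact ⟨⟨hp.pos, by omega⟩, hp⟩
  rw [h2] at h1
  have h3 : (B.card : ℝ) ≤ Nat.primeCounting n + ((Ioc 0 ⌊w ^ 7⌋₊).card : ℝ) ^ 2 := by exact_mod_cast h1
  have h4 := card_Ioc_floor (w ^ 7) (by positivity)
  have h5 : ((Ioc 0 ⌊w ^ 7⌋₊).card : ℝ) ^ 2 ≤ (w ^ 7) ^ 2 := by gcongr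
  have h6 : (w ^ 7) ^ 2 = w ^ 14 := by ring
  linarith

open Classical in
lemma class_Mj (h w : ℝ) (hh : 2 ≤ h) (hhw : w = h ^ 2) (n : ℕ) (hn : (n:ℝ) = w ^ 24) (A : Finset ℕ)
    (hAn : A ⊆ Icc 1 n) (hA : MSidon A) (B : Finset ℕ) (hB : B ⊆ A) (j : ℕ) (hj : (2:ℝ) ^ j ≤ w ^ 11)
    (hBB : ∀ a ∈ B, ∃ u v : ℕ, u * v = a ∧ (u:ℝ) ≤ w ^ 17 ∧ 2 ^ j ≤ v ∧ v < 2 ^ (j + 1)) :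
    (B.card : ℝ) ≤ 3 * h ^ 35 := by
  have hA0 : ∀ a ∈ A, 0 < a := fun a ha => by have := hAn ha; simp at this; omega
  have hw0 : 0 < w := by rw [hhw]; positivity
  have h1 := (sidon_graph A hA0 hA B hB (Ioc 0 ⌊min (w ^ 17) (w ^ 24 / 2 ^ j)⌋₊) (Ioc 0 (2 ^ (j + 1))) (by
    intro a ha
    obtain ⟨u, v, huv, hu, hv1, hv2⟩ := hBB a ha
    have han := hAn (hB ha)
    simp only [mem_Icc] at han
    have ha0 : 0 < u * v := by omega
    refine ⟨u, ?_, v, ?_, huv⟩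
    · simp only [mem_Ioc]
      refine ⟨Nat.pos_of_mul_pos_right ha0, Nat.le_floor (le_min hu ?_)⟩
      rw [le_div_iff₀ (by positivity), ← hn]
      calc (u:ℝ) * 2 ^ j ≤ u * v := by gcongr; exact_mod_cast hv1
        _ = (a:ℝ) := by exact_mod_cast huv
        _ ≤ n := by exact_mod_cast han.2
    · simp only [mem_Ioc]
      exact ⟨Nat.pos_of_mul_pos_left ha0, hv2.le⟩)).2
  have h4 := card_Ioc_floor (min (w ^ 17) (w ^ 24 / 2 ^ j)) (by positivity)
  set N : ℝ := ((Ioc 0 ⌊min (w ^ 17) (w ^ 24 / 2 ^ j)⌋₊).card : ℝ)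
  have h5 : N ≤ w ^ 17 := h4.trans (min_le_left _ _)
  have h6 : N ≤ w ^ 24 / 2 ^ j := h4.trans (min_le_right _ _)
  have h7 : ((Ioc 0 (2 ^ (j + 1))).card : ℝ) = 2 * 2 ^ j := by simp; ring
  rw [h7] at h1
  have h8 : 2 * 2 ^ j * √N ≤ 2 * h ^ 35 := by
    have : √N * 2 ^ j ≤ h ^ 35 := by
      apply le_of_sq_le_sq _ (by positivity)
      rw [mul_pow, Real.sq_sqrt (by positivity)]
      calc N * (2 ^ j) ^ 2 ≤ w ^ 24 / 2 ^ j * (2 ^ j) ^ 2 := by gcongr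
        _ = w ^ 24 * 2 ^ j := by field_simp
        _ ≤ w ^ 24 * w ^ 11 := by gcongr
        _ = (h ^ 35) ^ 2 := by rw [hhw]; ring
    linarith
  have h9 : w ^ 17 ≤ h ^ 35 := by
    rw [hhw, ← pow_mul]; exact pow_le_pow_right₀ (by linarith) (by norm_num)
  linarith

open Classical in
lemma class_M (h w : ℝ) (hh : 2 ≤ h) (hhw : w = h ^ 2) (hL : 1 ≤ Real.log w)
    (n : ℕ) (hn : (n:ℝ) = w ^ 24) (A : Finset ℕ)
    (hAn : A ⊆ Icc 1 n) (hA : MSidon A) (B : Finset ℕ) (hB : B ⊆ A)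
    (hBB : ∀ a ∈ B, ∃ u v : ℕ, u * v = a ∧ (u:ℝ) ≤ w ^ 17 ∧ (v:ℝ) ≤ w ^ 11) :
    (B.card : ℝ) ≤ 51 * Real.log w * h ^ 35 := by
  have hw0 : 0 < w := by rw [hhw]; positivity
  have hw1 : 1 ≤ w := by rw [hhw]; exact one_le_pow₀ (by linarith)
  set m := ⌊w ^ 11⌋₊ with hm
  have hm0 : m ≠ 0 := by
    have : 0 < m := Nat.floor_pos.2 (one_le_pow₀ hw1)
    omega
  have hmw : (m:ℝ) ≤ w ^ 11 := Nat.floor_le (by positivity)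
  have hpow : ∀ j ≤ Nat.log 2 m, (2:ℝ) ^ j ≤ w ^ 11 := by
    intro j hj
    have := Nat.pow_le_of_le_log hm0 hj
    have h2 : ((2 ^ j : ℕ):ℝ) ≤ m := by exact_mod_cast this
    push_cast at h2
    linarith
  set F : ℕ → Finset ℕ := fun j => B.filter (fun a => ∃ u v : ℕ, u * v = a ∧ (u:ℝ) ≤ w ^ 17 ∧ 2 ^ j ≤ v ∧ v < 2 ^ (j + 1)) with hF
  have hsub : B ⊆ (range (Nat.log 2 m + 1)).biUnion F := by
    intro a ha
    obtain ⟨u, v, huv, hu, hv⟩ := hBB a ha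
    have han := hAn (hB ha)
    simp only [mem_Icc] at han
    have ha0 : 0 < u * v := by omega
    have hv0 : 0 < v := Nat.pos_of_mul_pos_left ha0
    have hvm : v ≤ m := Nat.le_floor hv
    simp only [mem_biUnion, mem_range, hF, mem_filter]
    refine ⟨Nat.log 2 v, ?_, ha, u, v, huv, hu, Nat.pow_log_le_self 2 hv0.ne', Nat.lt_pow_succ_log_self (by norm_num) v⟩
    have := Nat.log_mono_right (b := 2) hvm
    omega
  have h1 : (B.card : ℝ) ≤ ∑ j ∈ range (Nat.log 2 m + 1), ((F j).card : ℝ) := by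
    exact_mod_cast (card_le_card hsub).trans card_biUnion_le
  have h2 : ∑ j ∈ range (Nat.log 2 m + 1), ((F j).card : ℝ) ≤ ∑ j ∈ range (Nat.log 2 m + 1), 3 * h ^ 35 := by
    apply Finset.sum_le_sum
    intro j hj
    simp only [mem_range] at hj
    refine class_Mj h w hh hhw n hn A hAn hA (F j) ((filter_subset _ _).trans hB) j (hpow j (by omega)) ?_
    intro a ha
    exact (mem_filter.1 ha).2
  rw [sum_const, card_range, nsmul_eq_mul] at h2
  have h3 : ((Nat.log 2 m + 1 : ℕ) : ℝ) ≤ 17 * Real.log w := by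
    have := Real.log_le_log (by positivity) (hpow _ le_rfl)
    rw [Real.log_pow, Real.log_pow] at this
    have hl2 := Real.log_two_gt_d9
    push_cast at this ⊢
    have h0 : (0:ℝ) ≤ Nat.log 2 m := by positivity
    nlinarith
  calc (B.card : ℝ) ≤ ((Nat.log 2 m + 1 : ℕ) : ℝ) * (3 * h ^ 35) := h1.trans h2
    _ ≤ 17 * Real.log w * (3 * h ^ 35) := by gcongr
    _ = _ := by ring

lemma harm_bound (i : ℕ) : ∑ t ∈ Ioc 0 (4 ^ (i + 1)), (1:ℝ) / (t:ℕ) ≤ 2 * i + 3 := by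
  have h := harmonic_le_one_add_log (4 ^ (i + 1))
  rw [harmonic_eq_sum_Icc] at h
  push_cast at h
  have h4 : Real.log 4 ≤ 2 := by
    rw [show (4:ℝ) = 2 ^ 2 by norm_num, Real.log_pow]
    have := Real.log_two_lt_d9
    push_cast; linarith
  rw [Real.log_pow] at h
  have : Ioc 0 (4 ^ (i + 1)) = Icc 1 (4 ^ (i + 1)) := by ext; simp; omega
  rw [this]
  simp only [one_div]
  push_cast at h
  have h5 : ((i:ℝ) + 1) * Real.log 4 ≤ (i + 1) * 2 := by gcongr
  linarith

lemma pow_ineq (i : ℕ) : (4 * i + 6 : ℝ) ≤ 2 ^ i * (5 * (4/5) ^ i) ^ 2 := by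
  have h1 : (1 + (i:ℝ) * (7/25)) ≤ (1 + 7/25) ^ i := one_add_mul_le_pow (by norm_num) i
  have h2 : (2:ℝ) ^ i * (5 * (4/5) ^ i) ^ 2 = 25 * (1 + 7/25) ^ i := by
    rw [mul_pow, ← pow_mul, mul_comm i 2, pow_mul, mul_left_comm, ← mul_pow]; norm_num
  rw [h2]
  have : (0:ℝ) ≤ i := by positivity
  nlinarith

open Classical in
lemma class_Bi (w C : ℝ) (hw : 2 ≤ w) (hL : 1 ≤ Real.log w) (hC : C = 6 * Real.exp 56 + 1)
    (n : ℕ) (hn : (n:ℝ) = w ^ 24) (A : Finset ℕ)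
    (hAn : A ⊆ Icc 1 n) (hA : MSidon A) (B : Finset ℕ) (hB : B ⊆ A) (i : ℕ) (hi : (2:ℝ) ^ i ≤ w)
    (hBB : ∀ a ∈ B, ∃ t r1 r2 : ℕ, a = t * r1 * r2 ∧ r2 ≤ r1 ∧ Rough w r1 ∧ Rough w r2 ∧
      (2:ℝ) ^ i ≤ w ^ 12 / r2 ∧ w ^ 12 / r2 < 2 ^ (i + 1)) :
    (B.card : ℝ) ≤ (C * (w ^ 12 / Real.log w)) * √(C * (w ^ 12 / Real.log w)) * (5 * (4/5) ^ i)
      + 6 * C * w ^ 14 := by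
  have hA0 : ∀ a ∈ A, 0 < a := fun a ha => by have := hAn ha; simp at this; omega
  have hw0 : 0 < w := by linarith
  have hC0 : 0 < C := by rw [hC]; positivity
  set L := Real.log w with hLdef
  set D := C * (w ^ 12 / L) with hD
  have hL0 : 0 < L := by linarith
  have hD0 : 0 < D := by positivity
  set V := (Ioc 0 ⌊w ^ 12 / 2 ^ i⌋₊).filter (Rough w) with hV
  set U := (Ioc 0 (4 ^ (i + 1))).biUnion (fun t : ℕ =>
    ((Ioc 0 ⌊w ^ 12 * 2 ^ (i + 1) / t⌋₊).filter (Rough w)).image (fun r => t * r)) with hU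
  have h1 := (sidon_graph A hA0 hA B hB U V (by
    intro a ha
    obtain ⟨t, r1, r2, hat, hr, hr1, hr2, hb1, hb2⟩ := hBB a ha
    have han := hAn (hB ha)
    simp only [mem_Icc] at han
    have ha0 : 0 < t * r1 * r2 := by omega
    have hr20 : 0 < r2 := Nat.pos_of_mul_pos_left ha0
    have htr1 : 0 < t * r1 := Nat.pos_of_mul_pos_right ha0
    have ht0 : 0 < t := Nat.pos_of_mul_pos_right htr1
    have hr10 : 0 < r1 := Nat.pos_of_mul_pos_left htr1
    have hr2R : (0:ℝ) < r2 := by exact_mod_cast hr20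
    have htR : (0:ℝ) < t := by exact_mod_cast ht0
    have haR : (t:ℝ) * r1 * r2 ≤ w ^ 24 := by
      rw [← hn]
      calc (t:ℝ) * r1 * r2 = a := by exact_mod_cast hat.symm
        _ ≤ n := by exact_mod_cast han.2
    rw [le_div_iff₀ hr2R] at hb1
    rw [div_lt_iff₀ hr2R] at hb2
    have hrR : (r2:ℝ) ≤ r1 := by exact_mod_cast hr
    refine ⟨t * r1, ?_, r2, ?_, hat.symm⟩
    · simp only [hU, mem_biUnion, mem_image, mem_filter, mem_Ioc]
      refine ⟨t, ⟨ht0, ?_⟩, r1, ⟨⟨hr10, Nat.le_floor ?_⟩, hr1⟩, rfl⟩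
      · have h2 : (t:ℝ) * w ^ 24 ≤ 4 ^ (i + 1) * w ^ 24 := by
          calc (t:ℝ) * w ^ 24 = (t:ℝ) * (w ^ 12) ^ 2 := by ring
            _ ≤ (t:ℝ) * (2 ^ (i + 1) * (r2:ℝ)) ^ 2 := by gcongr
            _ = (4:ℝ) ^ (i + 1) * ((t:ℝ) * r2 * r2) := by
                rw [show (4:ℝ) = 2 ^ 2 by norm_num, ← pow_mul]; ring
            _ ≤ (4:ℝ) ^ (i + 1) * ((t:ℝ) * r1 * r2) := by gcongr
            _ ≤ _ := by gcongr
        have h3 := le_of_mul_le_mul_right h2 (by positivity)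
        exact_mod_cast h3
      · rw [le_div_iff₀ htR]
        have h2 : (r1:ℝ) * t * w ^ 12 ≤ w ^ 12 * 2 ^ (i + 1) * w ^ 12 := by
          calc (r1:ℝ) * t * w ^ 12 ≤ r1 * t * (2 ^ (i + 1) * r2) := by gcongr
            _ = 2 ^ (i + 1) * (t * r1 * r2) := by ring
            _ ≤ 2 ^ (i + 1) * w ^ 24 := by gcongr
            _ = _ := by ring
        exact le_of_mul_le_mul_right h2 (by positivity)
    · simp only [hV, mem_filter, mem_Ioc]
      refine ⟨⟨hr20, Nat.le_floor ?_⟩, hr2⟩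
      rw [le_div_iff₀ (by positivity)]; linarith)).2
  have hVc : (V.card : ℝ) ≤ D / 2 ^ i := by
    have := rough_count w hw (w ^ 12 / 2 ^ i) (by
      rw [le_div_iff₀ (by positivity)]
      calc w ^ 10 * 2 ^ i ≤ w ^ 10 * w := by gcongr
        _ = w ^ 11 := by ring
        _ ≤ w ^ 12 := pow_le_pow_right₀ (by linarith) (by norm_num)) (by
      rw [div_le_iff₀ (by positivity)]
      calc w ^ 12 ≤ w ^ 14 := pow_le_pow_right₀ (by linarith) (by norm_num)
        _ ≤ w ^ 14 * 2 ^ i := le_mul_of_one_le_right (by positivity) (one_le_pow₀ (by norm_num)))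
    rw [← hC] at this
    calc (V.card : ℝ) ≤ C * (w ^ 12 / 2 ^ i) / L := this
      _ = D / 2 ^ i := by rw [hD]; field_simp
  have hUc : (U.card : ℝ) ≤ D * 2 ^ i * (4 * i + 6) := by
    have h2 : (U.card : ℝ) ≤ ∑ t ∈ Ioc 0 (4 ^ (i + 1)), (((Ioc 0 ⌊w ^ 12 * 2 ^ (i + 1) / (t:ℕ)⌋₊).filter (Rough w)).card : ℝ) := by
      have : U.card ≤ ∑ t ∈ Ioc 0 (4 ^ (i + 1)), ((Ioc 0 ⌊w ^ 12 * 2 ^ (i + 1) / (t:ℕ)⌋₊).filter (Rough w)).card :=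
        card_biUnion_le.trans (Finset.sum_le_sum fun t _ => card_image_le)
      exact_mod_cast this
    have h3 : ∑ t ∈ Ioc 0 (4 ^ (i + 1)), (((Ioc 0 ⌊w ^ 12 * 2 ^ (i + 1) / (t:ℕ)⌋₊).filter (Rough w)).card : ℝ) ≤
        ∑ t ∈ Ioc 0 (4 ^ (i + 1)), (D * 2 ^ (i + 1)) * ((1:ℝ) / (t:ℕ)) := by
      apply Finset.sum_le_sum
      intro t ht
      simp only [mem_Ioc] at ht
      have htR : (0:ℝ) < t := by exact_mod_cast ht.1
      have ht1 : (1:ℝ) ≤ t := by exact_mod_cast ht.1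
      have ht4 : (t:ℝ) ≤ 4 ^ (i + 1) := by exact_mod_cast ht.2
      have h2i : (2:ℝ) ^ (i + 1) ≤ w ^ 2 := by
        rw [pow_succ, sq]; gcongr
      have := rough_count w hw (w ^ 12 * 2 ^ (i + 1) / t) (by
        rw [le_div_iff₀ htR]
        calc w ^ 10 * t ≤ w ^ 10 * 4 ^ (i + 1) := by gcongr
          _ = w ^ 10 * 2 ^ (i + 1) * 2 ^ (i + 1) := by
              rw [show (4:ℝ) = 2 * 2 by norm_num, mul_pow]; ring
          _ ≤ w ^ 10 * w ^ 2 * 2 ^ (i + 1) := by gcongr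
          _ = _ := by ring) (by
        rw [div_le_iff₀ htR]
        calc w ^ 12 * 2 ^ (i + 1) ≤ w ^ 12 * w ^ 2 := by gcongr
          _ = w ^ 14 := by ring
          _ ≤ w ^ 14 * t := le_mul_of_one_le_right (by positivity) ht1)
      rw [← hC] at this
      calc _ ≤ C * (w ^ 12 * 2 ^ (i + 1) / t) / L := this
        _ = _ := by rw [hD]; field_simp
    rw [← Finset.mul_sum] at h3
    calc (U.card : ℝ) ≤ (D * 2 ^ (i + 1)) * (2 * i + 3) := by
          refine h2.trans (h3.trans ?_)
          gcongr
          exact harm_bound i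
      _ = _ := by ring
  have hterm1 : (V.card : ℝ) * √(U.card) ≤ D * √D * (5 * (4/5) ^ i) := by
    have h2 : √(U.card : ℝ) ≤ √D * (2 ^ i * (5 * (4/5) ^ i)) := by
      apply Real.sqrt_le_iff.2 ⟨by positivity, ?_⟩
      rw [mul_pow, Real.sq_sqrt hD0.le]
      calc (U.card : ℝ) ≤ D * 2 ^ i * (4 * i + 6) := hUc
        _ ≤ D * 2 ^ i * (2 ^ i * (5 * (4/5) ^ i) ^ 2) := by gcongr; exact pow_ineq i
        _ = _ := by ring
    calc (V.card : ℝ) * √(U.card) ≤ (D / 2 ^ i) * (√D * (2 ^ i * (5 * (4/5) ^ i))) := by gcongr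
      _ = _ := by field_simp
  have hterm2 : (U.card : ℝ) ≤ 6 * C * w ^ 14 := by
    have h2 : (4 * i + 6 : ℝ) ≤ 6 * 2 ^ i := by
      have : i + 1 ≤ 2 ^ i := Nat.lt_two_pow_self
      have h3 : (i:ℝ) + 1 ≤ 2 ^ i := by exact_mod_cast this
      have : (0:ℝ) ≤ i := by positivity
      linarith
    have h3 : D ≤ C * w ^ 12 := by
      rw [hD]; gcongr; exact div_le_self (by positivity) hL
    calc (U.card : ℝ) ≤ D * 2 ^ i * (4 * i + 6) := hUc
      _ ≤ (C * w ^ 12) * w * (6 * w) := by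
          gcongr; exact h2.trans (by gcongr)
      _ = _ := by ring
  linarith

open Classical in
lemma class_B (w C : ℝ) (hw : 2 ≤ w) (hL : 1 ≤ Real.log w) (hC : C = 6 * Real.exp 56 + 1)
    (n : ℕ) (hn : (n:ℝ) = w ^ 24) (A : Finset ℕ)
    (hAn : A ⊆ Icc 1 n) (hA : MSidon A) (B : Finset ℕ) (hB : B ⊆ A)
    (hP : ∀ a ∈ B, ∀ p : ℕ, p.Prime → p ∣ a → (p:ℝ) ≤ w ^ 17)
    (hM : ∀ a ∈ B, ∀ u v : ℕ, u * v = a → (v:ℝ) ≤ w ^ 11 → w ^ 17 < u) :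
    (B.card : ℝ) ≤ 25 * ((C * (w ^ 12 / Real.log w)) * √(C * (w ^ 12 / Real.log w)))
      + 12 * C * w ^ 15 := by
  have hw0 : 0 < w := by linarith
  have hC0 : 0 < C := by rw [hC]; positivity
  set F : ℕ → Finset ℕ := fun i => B.filter (fun a => ∃ t r1 r2 : ℕ, a = t * r1 * r2 ∧ r2 ≤ r1 ∧ Rough w r1 ∧ Rough w r2 ∧
      (2:ℝ) ^ i ≤ w ^ 12 / r2 ∧ w ^ 12 / r2 < 2 ^ (i + 1)) with hF
  set I := (range ⌈w⌉₊).filter (fun i => (2:ℝ) ^ i ≤ w) with hI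
  have hsub : B ⊆ I.biUnion F := by
    intro a ha
    have han := hAn (hB ha)
    simp only [mem_Icc] at han
    have hanR : (a:ℝ) ≤ w ^ 24 := by rw [← hn]; exact_mod_cast han.2
    obtain ⟨t, r1, r2, hat, hr, hr1, hr2, h11⟩ := bad_structure w (by linarith) a (by omega) hanR (hP a ha) (hM a ha)
    have hr2R : (0:ℝ) < r2 := lt_trans (by positivity) h11
    have ha0 : 0 < t * r1 * r2 := by omega
    have htr1 : 0 < t * r1 := Nat.pos_of_mul_pos_right ha0
    have ht0 : 0 < t := Nat.pos_of_mul_pos_right htr1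
    have hr12 : (r2:ℝ) ≤ w ^ 12 := by
      apply le_of_sq_le_sq _ (by positivity)
      calc (r2:ℝ) ^ 2 ≤ a := by
            have : r2 ^ 2 ≤ a := by rw [hat]; nlinarith [Nat.le_mul_of_pos_left r1 ht0]
            exact_mod_cast this
        _ ≤ w ^ 24 := hanR
        _ = _ := by ring
    obtain ⟨i, hi1, hi2⟩ := exists_nat_pow_near (x := w ^ 12 / r2) (y := (2:ℝ)) (by rw [le_div_iff₀ hr2R]; linarith) (by norm_num)
    have hiw : (2:ℝ) ^ i ≤ w := by
      refine hi1.trans ?_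
      rw [div_le_iff₀ hr2R]
      calc w ^ 12 = w * w ^ 11 := by ring
        _ ≤ w * r2 := by gcongr
    simp only [mem_biUnion, hI, hF, mem_filter, mem_range]
    refine ⟨i, ⟨?_, hiw⟩, ha, t, r1, r2, hat, hr, hr1, hr2, hi1, hi2⟩
    rw [Nat.lt_ceil]
    have : i < 2 ^ i := Nat.lt_two_pow_self
    have h3 : (i:ℝ) < 2 ^ i := by exact_mod_cast this
    linarith
  set D := (C * (w ^ 12 / Real.log w)) with hD
  have hD0 : 0 ≤ D := by positivity
  have h1 : (B.card : ℝ) ≤ ∑ i ∈ I, ((F i).card : ℝ) := by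
    exact_mod_cast (card_le_card hsub).trans card_biUnion_le
  have h2 : ∑ i ∈ I, ((F i).card : ℝ) ≤ ∑ i ∈ I, (D * √D * (5 * (4/5) ^ i) + 6 * C * w ^ 14) := by
    apply Finset.sum_le_sum
    intro i hi
    exact class_Bi w C hw hL hC n hn A hAn hA (F i) ((filter_subset _ _).trans hB) i (mem_filter.1 hi).2
      (fun a ha => (mem_filter.1 ha).2)
  have h3 : ∑ i ∈ I, (D * √D * (5 * (4/5) ^ i) + 6 * C * w ^ 14) ≤
      ∑ i ∈ range ⌈w⌉₊, (D * √D * (5 * (4/5) ^ i) + 6 * C * w ^ 14) := by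
    apply Finset.sum_le_sum_of_subset_of_nonneg (filter_subset _ _)
    intros; positivity
  have h3' : ∑ i ∈ range ⌈w⌉₊, (D * √D * (5 * (4/5) ^ i) + 6 * C * w ^ 14) =
      D * √D * (5 * ∑ i ∈ range ⌈w⌉₊, ((4:ℝ)/5) ^ i) + ⌈w⌉₊ * (6 * C * w ^ 14) := by
    rw [Finset.sum_add_distrib, ← Finset.mul_sum, ← Finset.mul_sum, sum_const, card_range, nsmul_eq_mul]
  rw [h3'] at h3
  have h4 : ∑ i ∈ range ⌈w⌉₊, ((4:ℝ)/5) ^ i ≤ 5 := by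
    rw [geom_sum_eq (by norm_num)]
    have : (0:ℝ) ≤ (4/5) ^ ⌈w⌉₊ := by positivity
    have h5 : (((4:ℝ)/5) ^ ⌈w⌉₊ - 1) / (4/5 - 1) = 5 * (1 - (4/5) ^ ⌈w⌉₊) := by ring
    rw [h5]; linarith
  have h5 : (⌈w⌉₊ : ℝ) ≤ 2 * w := by
    have := Nat.ceil_lt_add_one hw0.le
    linarith
  calc (B.card : ℝ) ≤ D * √D * (5 * ∑ i ∈ range ⌈w⌉₊, ((4:ℝ)/5) ^ i) + ⌈w⌉₊ * (6 * C * w ^ 14) := h1.trans (h2.trans h3)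
    _ ≤ D * √D * (5 * 5) + (2 * w) * (6 * C * w ^ 14) := by gcongr
    _ = _ := by ring

open Classical in
lemma upper_explicit (h w C : ℝ) (hh : 2 ≤ h) (hhw : w = h ^ 2) (hL : 1 ≤ Real.log w) (hC : C = 6 * Real.exp 56 + 1)
    (n : ℕ) (hn : (n:ℝ) = w ^ 24) (A : Finset ℕ)
    (hAn : A ⊆ Icc 1 n) (hA : MSidon A) :
    (A.card : ℝ) ≤ Nat.primeCounting n + w ^ 14 + 51 * Real.log w * h ^ 35 +
      (25 * ((C * (w ^ 12 / Real.log w)) * √(C * (w ^ 12 / Real.log w))) + 12 * C * w ^ 15) := by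
  have hw : 2 ≤ w := by rw [hhw]; nlinarith
  set B1 := A.filter (fun a => ∃ p : ℕ, p.Prime ∧ p ∣ a ∧ w ^ 17 < p) with hB1
  set B2 := A.filter (fun a => ∃ u v : ℕ, u * v = a ∧ (u:ℝ) ≤ w ^ 17 ∧ (v:ℝ) ≤ w ^ 11) with hB2
  set B3 := A.filter (fun a => (∀ p : ℕ, p.Prime → p ∣ a → (p:ℝ) ≤ w ^ 17) ∧
    (∀ u v : ℕ, u * v = a → (v:ℝ) ≤ w ^ 11 → w ^ 17 < u)) with hB3
  have hsub : A ⊆ (B1 ∪ B2) ∪ B3 := by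
    intro a ha
    simp only [mem_union, hB1, hB2, hB3, mem_filter]
    by_cases h1 : ∃ p : ℕ, p.Prime ∧ p ∣ a ∧ w ^ 17 < p
    · left; left; exact ⟨ha, h1⟩
    by_cases h2 : ∃ u v : ℕ, u * v = a ∧ (u:ℝ) ≤ w ^ 17 ∧ (v:ℝ) ≤ w ^ 11
    · left; right; exact ⟨ha, h2⟩
    right
    push Not at h1 h2
    refine ⟨ha, h1, fun u v huv hv => ?_⟩
    by_contra hc
    linarith [h2 u v huv (not_lt.1 hc)]
  have h0 : A.card ≤ B1.card + B2.card + B3.card :=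
    (card_le_card hsub).trans ((card_union_le _ _).trans (Nat.add_le_add_right (card_union_le _ _) _))
  have h0' : (A.card : ℝ) ≤ B1.card + B2.card + B3.card := by exact_mod_cast h0
  have e1 := class_P w hw n hn A hAn hA B1 (filter_subset _ _) (fun a ha => (mem_filter.1 ha).2)
  have e2 := class_M h w hh hhw hL n hn A hAn hA B2 (filter_subset _ _) (fun a ha => (mem_filter.1 ha).2)
  have e3 := class_B w C hw hL hC n hn A hAn hA B3 (filter_subset _ _) (fun a ha => (mem_filter.1 ha).2.1)
    (fun a ha => (mem_filter.1 ha).2.2)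
  linarith

lemma upper_final : ∃ c2 : ℝ, 0 < c2 ∧ ∀ᶠ n : ℕ in atTop, ∀ A : Finset ℕ, A ⊆ Icc 1 n → MSidon A →
    (A.card : ℝ) ≤ Nat.primeCounting n + c2 * ((n:ℝ) ^ ((3:ℝ)/4) / (Real.log n) ^ ((3:ℝ)/2)) := by
  set C : ℝ := 6 * Real.exp 56 + 1 with hC
  have hC0 : 0 < C := by positivity
  refine ⟨(25 * C ^ ((3:ℝ)/2) + 1) * 24 ^ ((3:ℝ)/2), by positivity, ?_⟩
  have ht : Tendsto (fun n : ℕ => (n:ℝ) ^ ((1:ℝ)/48)) atTop atTop :=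
    (tendsto_rpow_atTop (by norm_num)).comp tendsto_natCast_atTop_atTop
  have hlog : ∀ᶠ h : ℝ in atTop, (52 + 12 * C) * 8 * Real.log h ^ 3 ≤ h := by
    have := (Real.isLittleO_pow_log_id_atTop (n := 3)).bound (c := ((52 + 12 * C) * 8)⁻¹) (by positivity)
    filter_upwards [this, eventually_ge_atTop 1] with h hh h1
    simp only [id, Real.norm_eq_abs] at hh
    rw [abs_of_nonneg (by linarith : (0:ℝ) ≤ h), inv_mul_eq_div, le_div_iff₀ (by positivity)] at hh
    have := le_abs_self (Real.log h ^ 3)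
    nlinarith
  filter_upwards [ht.eventually hlog, ht.eventually (eventually_ge_atTop (Real.exp 1)), eventually_gt_atTop 0] with n hl hge hn0 A hAn hA
  set h : ℝ := (n:ℝ) ^ ((1:ℝ)/48) with hh
  have hnR : (0:ℝ) < n := by exact_mod_cast hn0
  have hh0 : 0 < h := by positivity
  have hh2 : 2 ≤ h := by linarith [Real.add_one_le_exp 1]
  set w := h ^ 2 with hw
  have hw0 : 0 < w := by positivity
  have hn48 : (n:ℝ) = h ^ 48 := by
    rw [hh, ← Real.rpow_natCast, ← Real.rpow_mul hnR.le]; norm_num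
  have hn24 : (n:ℝ) = w ^ 24 := by rw [hn48, hw]; ring
  have hlogh : 1 ≤ Real.log h := by
    rw [Real.le_log_iff_exp_le hh0]; exact hge
  have hLh : Real.log w = 2 * Real.log h := by rw [hw, Real.log_pow]; norm_num
  have hL1 : 1 ≤ Real.log w := by linarith
  have hmain := upper_explicit h w C hh2 hw hL1 hC n hn24 A hAn hA
  set L := Real.log w with hL
  have hL0 : 0 < L := by linarith
  have hlogn : Real.log n = 24 * L := by rw [hn24, Real.log_pow, ← hL]; norm_num
  have hmul : ∀ x : ℝ, 0 ≤ x → x * √x = x ^ ((3:ℝ)/2) := by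
    intro x hx
    rw [Real.sqrt_eq_rpow]
    rcases hx.eq_or_lt with h0 | h0
    · rw [← h0]; norm_num
    · nth_rewrite 1 [← Real.rpow_one x]
      rw [← Real.rpow_add h0]; norm_num
  have hX : (n:ℝ) ^ ((3:ℝ)/4) = h ^ 36 := by
    rw [hn48, ← Real.rpow_natCast, ← Real.rpow_natCast, ← Real.rpow_mul hh0.le]; norm_num
  have hW : (w ^ 12) ^ ((3:ℝ)/2) = h ^ 36 := by
    rw [hw, ← pow_mul, ← Real.rpow_natCast, ← Real.rpow_natCast, ← Real.rpow_mul hh0.le]; norm_num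
  have hD : (C * (w ^ 12 / L)) * √(C * (w ^ 12 / L)) = C ^ ((3:ℝ)/2) * (h ^ 36 / L ^ ((3:ℝ)/2)) := by
    rw [hmul _ (by positivity), Real.mul_rpow hC0.le (by positivity), Real.div_rpow (by positivity) hL0.le, hW]
  have hG : (24:ℝ) ^ ((3:ℝ)/2) * ((n:ℝ) ^ ((3:ℝ)/4) / (Real.log n) ^ ((3:ℝ)/2)) = h ^ 36 / L ^ ((3:ℝ)/2) := by
    rw [hX, hlogn, Real.mul_rpow (by norm_num) hL0.le]
    field_simp
  rw [hD] at hmain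
  rw [mul_assoc, hG]
  set P := L ^ ((3:ℝ)/2) with hP
  have hP0 : 0 < P := by positivity
  have hP2 : P ≤ L ^ 2 := by
    rw [hP, ← Real.rpow_natCast]; exact Real.rpow_le_rpow_of_exponent_le hL1 (by norm_num)
  have herr : w ^ 14 + 51 * L * h ^ 35 + 12 * C * w ^ 15 ≤ h ^ 36 / P := by
    have h1 : w ^ 14 ≤ L * h ^ 35 := by
      calc w ^ 14 = 1 * h ^ 28 := by rw [hw]; ring
        _ ≤ L * h ^ 35 := by
          apply mul_le_mul hL1 _ (by positivity) hL0.le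
          exact pow_le_pow_right₀ (by linarith) (by norm_num)
    have h2 : w ^ 15 ≤ L * h ^ 35 := by
      calc w ^ 15 = 1 * h ^ 30 := by rw [hw]; ring
        _ ≤ L * h ^ 35 := by
          apply mul_le_mul hL1 _ (by positivity) hL0.le
          exact pow_le_pow_right₀ (by linarith) (by norm_num)
    have h3 : 12 * C * w ^ 15 ≤ 12 * C * (L * h ^ 35) := by gcongr
    have h4 : (52 + 12 * C) * (L * h ^ 35) ≤ h ^ 36 / P := by
      rw [le_div_iff₀ hP0]
      calc (52 + 12 * C) * (L * h ^ 35) * P ≤ (52 + 12 * C) * (L * h ^ 35) * L ^ 2 := by gcongr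
        _ = ((52 + 12 * C) * 8 * Real.log h ^ 3) * h ^ 35 := by rw [hLh]; ring
        _ ≤ h * h ^ 35 := by gcongr
        _ = h ^ 36 := by ring
    linarith
  linarith

lemma trivialSol_iff {k : ℕ} (d : ℕ) (a : Fin k → ℕ) :
    TrivialSol d a ↔ ∀ y, d ∣ (univ.filter (fun i => a i = y)).card := by
  unfold TrivialSol
  have : ∀ y, (List.ofFn a : Multiset ℕ).count y = (univ.filter (fun i => a i = y)).card := by
    intro y
    rw [← Fin.univ_val_map, Multiset.count_map]
    simp only [eq_comm (a := y)]
    rfl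
  simp only [this]

lemma fib {ι γ : Type*} [DecidableEq γ] (S : Finset ι) (k : ι → γ) (z : γ) (h : 3 ∣ S.card)
    (hz : ¬ 3 ∣ (S.filter (fun i => k i = z)).card) :
    ∃ z', z' ≠ z ∧ ¬ 3 ∣ (S.filter (fun i => k i = z')).card := by
  by_contra hc
  push Not at hc
  apply hz
  by_cases hzi : z ∈ S.image k
  · rw [Finset.card_eq_sum_card_image k S, ← Finset.add_sum_erase _ _ hzi] at h
    refine (Nat.dvd_add_left (Finset.dvd_sum ?_)).1 h
    intro b hb
    exact hc b (Finset.ne_of_mem_erase hb)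
  · have : S.filter (fun i => k i = z) = ∅ := by
      apply Finset.filter_eq_empty_iff.2
      intro i hi hk
      exact hzi (hk ▸ Finset.mem_image_of_mem k hi)
    rw [this]; simp

open Classical in
lemma combi {α β : Type*} (Inc : α → β → Prop)
    (hC4 : ∀ P P' L L', Inc P L → Inc P L' → Inc P' L → Inc P' L' → P = P' ∨ L = L')
    (e : Fin 6 → Option (α × β)) (hinc : ∀ i P L, e i = some (P, L) → Inc P L)
    (hα : ∀ P, 3 ∣ (univ.filter (fun i => ∃ L, e i = some (P, L))).card)
    (hβ : ∀ L, 3 ∣ (univ.filter (fun i => ∃ P, e i = some (P, L))).card) (P : α) (L : β) :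
    3 ∣ (univ.filter (fun i => e i = some (P, L))).card := by
  have posi : ∀ z, ¬ 3 ∣ (univ.filter (fun i => e i = z)).card → ∃ i, e i = z := by
    intro z hz
    by_contra hc
    push Not at hc
    apply hz
    rw [Finset.filter_eq_empty_iff.2 (fun i _ => hc i)]; simp
  have stepα : ∀ P L, ¬ 3 ∣ (univ.filter (fun i => e i = some (P, L))).card →
      ∃ L', L' ≠ L ∧ ¬ 3 ∣ (univ.filter (fun i => e i = some (P, L'))).card := by
    intro P L h
    obtain ⟨z, hz, hz2⟩ := fib (univ.filter (fun i => ∃ L, e i = some (P, L))) e (some (P, L)) (hα P) (by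
      rw [Finset.filter_filter]
      convert h using 4
      constructor
      · rintro ⟨-, h⟩; exact h
      · intro h; exact ⟨⟨L, h⟩, h⟩)
    rw [Finset.filter_filter] at hz2
    have hex : ∃ i, (∃ L, e i = some (P, L)) ∧ e i = z := by
      by_contra hc
      push Not at hc
      apply hz2
      rw [Finset.filter_eq_empty_iff.2 (fun i _ => by rintro ⟨⟨L, h1⟩, h2⟩; exact hc i ⟨L, h1⟩ h2)]; simp
    obtain ⟨i, ⟨L', h1⟩, h2⟩ := hex
    have hzz : z = some (P, L') := by rw [← h2, h1]
    subst hzz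
    refine ⟨L', fun h => hz (by rw [h]), ?_⟩
    convert hz2 using 4
    constructor
    · intro h; exact ⟨⟨L', h⟩, h⟩
    · rintro ⟨-, h⟩; exact h
  have stepβ : ∀ P L, ¬ 3 ∣ (univ.filter (fun i => e i = some (P, L))).card →
      ∃ P', P' ≠ P ∧ ¬ 3 ∣ (univ.filter (fun i => e i = some (P', L))).card := by
    intro P L h
    obtain ⟨z, hz, hz2⟩ := fib (univ.filter (fun i => ∃ P, e i = some (P, L))) e (some (P, L)) (hβ L) (by
      rw [Finset.filter_filter]
      convert h using 4
      constructor
      · rintro ⟨-, h⟩; exact h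
      · intro h; exact ⟨⟨P, h⟩, h⟩)
    rw [Finset.filter_filter] at hz2
    have hex : ∃ i, (∃ P, e i = some (P, L)) ∧ e i = z := by
      by_contra hc
      push Not at hc
      apply hz2
      rw [Finset.filter_eq_empty_iff.2 (fun i _ => by rintro ⟨⟨L, h1⟩, h2⟩; exact hc i ⟨L, h1⟩ h2)]; simp
    obtain ⟨i, ⟨P', h1⟩, h2⟩ := hex
    have hzz : z = some (P', L) := by rw [← h2, h1]
    subst hzz
    refine ⟨P', fun h => hz (by rw [h]), ?_⟩
    convert hz2 using 4
    constructor
    · intro h; exact ⟨⟨P', h⟩, h⟩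
    · rintro ⟨-, h⟩; exact h
  by_contra h0
  obtain ⟨L1, hL1, h1⟩ := stepα P L h0
  obtain ⟨P2, hP2, h2⟩ := stepβ P L h0
  obtain ⟨P3, hP3, h3⟩ := stepβ P L1 h1
  obtain ⟨i0, e0⟩ := posi _ h0
  obtain ⟨i1, e1⟩ := posi _ h1
  obtain ⟨i2, e2⟩ := posi _ h2
  obtain ⟨i3, e3⟩ := posi _ h3
  have hP23 : P2 ≠ P3 := by
    rintro rfl
    rcases hC4 P P2 L L1 (hinc _ _ _ e0) (hinc _ _ _ e1) (hinc _ _ _ e2) (hinc _ _ _ e3) with h | h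
    · exact hP2 h.symm
    · exact hL1 h.symm
  set S : α → Finset (Fin 6) := fun P => univ.filter (fun i => ∃ L, e i = some (P, L)) with hS
  have hdis : ∀ A B, A ≠ B → Disjoint (S A) (S B) := by
    intro A B hAB
    rw [Finset.disjoint_left]
    intro i hA hB
    simp only [hS, mem_filter, mem_univ, true_and] at hA hB
    obtain ⟨l, hl⟩ := hA
    obtain ⟨l', hl'⟩ := hB
    rw [hl] at hl'
    simp only [Option.some.injEq, Prod.mk.injEq] at hl'
    exact hAB hl'.1
  have hge : ∀ A i L, e i = some (A, L) → 3 ≤ (S A).card := by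
    intro A i L h
    apply Nat.le_of_dvd _ (hα A)
    apply Finset.card_pos.2 ⟨i, by simp; exact ⟨L, h⟩⟩
  have hc : ((S P ∪ S P2) ∪ S P3).card ≤ 6 := by
    simpa using Finset.card_le_univ ((S P ∪ S P2) ∪ S P3)
  rw [Finset.card_union_of_disjoint, Finset.card_union_of_disjoint (hdis _ _ hP2.symm)] at hc
  · have := hge _ _ _ e0
    have := hge _ _ _ e2
    have := hge _ _ _ e3
    omega
  · rw [Finset.disjoint_union_left]
    exact ⟨hdis _ _ hP3.symm, hdis _ _ hP23⟩

lemma dvd_count_of_sqf (a : Fin 6 → ℕ) (ha : ∀ i, Squarefree (a i)) (x : ℕ)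
    (hprod : ∏ i, a i = x ^ 3) (p : ℕ) (hp : p.Prime) :
    3 ∣ (univ.filter (fun i => p ∣ a i)).card := by
  have h1 : (∏ i, a i).factorization p = (univ.filter (fun i => p ∣ a i)).card := by
    rw [Nat.factorization_prod (fun i _ => (ha i).ne_zero), Finset.card_filter, Finsupp.finsetSum_apply]
    apply Finset.sum_congr rfl
    intro i _
    split_ifs with h
    · have h1 := (ha i).natFactorization_le_one p
      have h2 := hp.factorization_pos_of_dvd (ha i).ne_zero h
      omega
    · exact Nat.factorization_eq_zero_of_not_dvd h
  rw [← h1, hprod, Nat.factorization_pow]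
  simp

open Classical in
lemma construction {α β : Type*} (Inc : α → β → Prop)
    (hC4 : ∀ P P' L L', Inc P L → Inc P L' → Inc P' L → Inc P' L' → P = P' ∨ L = L')
    (f : α → ℕ) (g : β → ℕ) (hf : Function.Injective f) (hg : Function.Injective g)
    (hfg : ∀ P L, f P ≠ g L) (s : ℕ) (hfp : ∀ P, (f P).Prime ∧ f P ≤ s) (hgp : ∀ L, (g L).Prime ∧ g L ≤ s)
    (A : Finset ℕ) (hA : ∀ y ∈ A, (y.Prime ∧ s < y) ∨ ∃ P L, Inc P L ∧ y = f P * g L)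
    (a : Fin 6 → ℕ) (x : ℕ) (ha : ∀ i, a i ∈ A) (hprod : ∏ i, a i = x ^ 3) : TrivialSol 3 a := by
  rw [trivialSol_iff]
  have hsq : ∀ i, Squarefree (a i) := by
    intro i
    rcases hA _ (ha i) with h | ⟨P, L, -, h⟩
    · exact h.1.prime.squarefree
    · rw [h, Nat.squarefree_mul ((Nat.coprime_primes (hfp P).1 (hgp L).1).2 (hfg P L))]
      exact ⟨(hfp P).1.prime.squarefree, (hgp L).1.prime.squarefree⟩
  have h3 := dvd_count_of_sqf a hsq x hprod
  have hfd : ∀ P P' L', f P ∣ f P' * g L' ↔ P = P' := by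
    intro P P' L'
    rw [(hfp P).1.dvd_mul, Nat.prime_dvd_prime_iff_eq (hfp P).1 (hfp P').1, Nat.prime_dvd_prime_iff_eq (hfp P).1 (hgp L').1]
    constructor
    · rintro (h | h)
      · exact hf h
      · exact absurd h (hfg _ _)
    · rintro rfl; exact Or.inl rfl
  have hgd : ∀ L P' L', g L ∣ f P' * g L' ↔ L = L' := by
    intro L P' L'
    rw [(hgp L).1.dvd_mul, Nat.prime_dvd_prime_iff_eq (hgp L).1 (hfp P').1, Nat.prime_dvd_prime_iff_eq (hgp L).1 (hgp L').1]
    constructor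
    · rintro (h | h)
      · exact absurd h.symm (hfg _ _)
      · exact hg h
    · rintro rfl; exact Or.inr rfl
  have huniq : ∀ P L P' L', f P * g L = f P' * g L' → P = P' ∧ L = L' := by
    intro P L P' L' h
    exact ⟨(hfd P P' L').1 (h ▸ Dvd.intro _ rfl), (hgd L P' L').1 (h ▸ Dvd.intro_left _ rfl)⟩
  have hbig : ∀ i, (a i).Prime ∧ s < a i → ∀ q : ℕ, q.Prime → q ≤ s → ¬ q ∣ a i := by
    rintro i ⟨h1, h2⟩ q hq hqs hd
    have := (Nat.prime_dvd_prime_iff_eq hq h1).1 hd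
    omega
  have hex : ∀ i, ∃ o : Option (α × β), (∀ P L, o = some (P, L) ↔ a i = f P * g L) ∧
      (∀ P L, o = some (P, L) → Inc P L) := by
    intro i
    rcases hA _ (ha i) with h | ⟨P, L, hPL, h⟩
    · refine ⟨none, ?_, by simp⟩
      intro P L
      simp only [reduceCtorEq, false_iff]
      intro h'
      exact hbig i h (f P) (hfp P).1 (hfp P).2 (h' ▸ Dvd.intro _ rfl)
    · refine ⟨some (P, L), ?_, ?_⟩
      · intro P' L'
        simp only [Option.some.injEq, Prod.mk.injEq]
        constructor
        · rintro ⟨rfl, rfl⟩; exact h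
        · intro h'; exact huniq _ _ _ _ (h.symm.trans h')
      · intro P' L' h'
        simp only [Option.some.injEq, Prod.mk.injEq] at h'
        obtain ⟨rfl, rfl⟩ := h'
        exact hPL
  choose e he hinc using hex
  have hcomb := combi Inc hC4 e hinc (by
    intro P
    convert h3 (f P) (hfp P).1 using 4 with i
    constructor
    · rintro ⟨L, hL⟩
      rw [(he i P L).1 hL]; exact Dvd.intro _ rfl
    · intro hd
      rcases hA _ (ha i) with h | ⟨P', L', hPL, h⟩
      · exact absurd hd (hbig i h (f P) (hfp P).1 (hfp P).2)
      · rw [h, hfd] at hd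
        subst hd
        exact ⟨L', (he i _ _).2 h⟩) (by
    intro L
    convert h3 (g L) (hgp L).1 using 4 with i
    constructor
    · rintro ⟨P, hP⟩
      rw [(he i P L).1 hP]; exact Dvd.intro_left _ rfl
    · intro hd
      rcases hA _ (ha i) with h | ⟨P', L', hPL, h⟩
      · exact absurd hd (hbig i h (g L) (hgp L).1 (hgp L).2)
      · rw [h, hgd] at hd
        subst hd
        exact ⟨P', (he i _ _).2 h⟩)
  intro y
  by_cases hy : ∃ i, a i = y
  · obtain ⟨i, rfl⟩ := hy
    rcases hA _ (ha i) with h | ⟨P, L, hPL, h⟩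
    · convert h3 (a i) h.1 using 4 with j
      constructor
      · intro h'; rw [h']
      · intro hd
        rcases hA _ (ha j) with hj | ⟨P', L', hPL', hj⟩
        · exact ((Nat.prime_dvd_prime_iff_eq h.1 hj.1).1 hd).symm
        · rw [hj, h.1.dvd_mul, Nat.prime_dvd_prime_iff_eq h.1 (hfp P').1, Nat.prime_dvd_prime_iff_eq h.1 (hgp L').1] at hd
          have := (hfp P').2
          have := (hgp L').2
          omega
    · convert hcomb P L using 4 with j
      rw [he j P L, h]
  · push Not at hy
    rw [Finset.filter_eq_empty_iff.2 (fun i _ => hy i)]; simp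

def Good (n : ℕ) (A : Finset ℕ) : Prop := A ⊆ Finset.Icc 1 n ∧
    ∀ (a : Fin 6 → ℕ) (x : ℕ), (∀ i, a i ∈ A) → 0 < x →
      (∏ i, a i) = x ^ 3 → TrivialSol 3 a

lemma good_sidon (n : ℕ) (A : Finset ℕ) (h : Good n A) : MSidon A := by
  intro a ha b hb c hc d hd habcd
  by_contra hcon
  push Not at hcon
  have hc0 := h.1 hc
  have hd0 := h.1 hd
  simp only [mem_Icc] at hc0 hd0
  have h1 := h.2 ![a, b, c, c, d, d] (c * d) (by
    intro i
    fin_cases i <;> simp [ha, hb, hc, hd]) (Nat.mul_pos (by omega) (by omega)) (by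
    simp only [Fin.prod_univ_succ]
    simp
    calc a * (b * (c * (c * (d * d)))) = (a * b) * (c * d) ^ 2 * 1 := by ring
      _ = _ := by rw [habcd]; ring)
  have h2 := h1 a
  simp only [List.ofFn_succ, Multiset.coe_count] at h2
  simp [List.count_cons, hcon.1.symm, hcon.2.symm] at h2
  split_ifs at h2 <;> omega

lemma good_bdd (n : ℕ) : BddAbove {m : ℕ | ∃ A : Finset ℕ, A ⊆ Finset.Icc 1 n ∧ A.card = m ∧
    ∀ (a : Fin 6 → ℕ) (x : ℕ), (∀ i, a i ∈ A) → 0 < x →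
      (∏ i, a i) = x ^ 3 → TrivialSol 3 a} := by
  refine ⟨n, ?_⟩
  rintro m ⟨A, hA, rfl, -⟩
  simpa using card_le_card hA

lemma good_le (n : ℕ) (A : Finset ℕ) (h : Good n A) : A.card ≤ fkd 6 3 n :=
  le_csSup (good_bdd n) ⟨A, h.1, rfl, h.2⟩

lemma fkd_attained (n : ℕ) : ∃ A : Finset ℕ, Good n A ∧ A.card = fkd 6 3 n := by
  have hne : {m : ℕ | ∃ A : Finset ℕ, A ⊆ Finset.Icc 1 n ∧ A.card = m ∧
    ∀ (a : Fin 6 → ℕ) (x : ℕ), (∀ i, a i ∈ A) → 0 < x →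
      (∏ i, a i) = x ^ 3 → TrivialSol 3 a}.Nonempty := by
    refine ⟨0, ∅, by simp, by simp, ?_⟩
    intro a x ha
    simpa using ha 0
  obtain ⟨A, h1, h2, h3⟩ := Nat.sSup_mem hne (good_bdd n)
  exact ⟨A, ⟨h1, h3⟩, h2⟩

lemma card_primes_Ioc (s n : ℕ) (h : s ≤ n) :
    ((Ioc s n).filter Nat.Prime).card + Nat.primeCounting s = Nat.primeCounting n := by
  simp only [Nat.primeCounting, Nat.primeCounting', Nat.count_eq_card_filter_range]
  rw [← Finset.card_union_of_disjoint]
  · congr 1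
    ext p
    simp only [mem_union, mem_filter, mem_Ioc, mem_range]
    constructor
    · rintro (⟨h1, h2⟩ | ⟨h1, h2⟩)
      · exact ⟨by omega, h2⟩
      · exact ⟨by omega, h2⟩
    · rintro ⟨h1, h2⟩
      by_cases hp : p < s + 1
      · right; exact ⟨hp, h2⟩
      · left; exact ⟨by omega, h2⟩
  · rw [Finset.disjoint_left]
    intro p hp hp'
    simp only [mem_filter, mem_Ioc, mem_range] at hp hp'
    omega

open Classical in
lemma lower_q (n s q : ℕ) (hs : s * s ≤ n) (hq : q.Prime) (hqs : 2 * q ^ 2 ≤ Nat.primeCounting s) :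
    Nat.primeCounting n + q ^ 3 ≤ fkd 6 3 n + Nat.primeCounting s := by
  have : Fact q.Prime := ⟨hq⟩
  have hsn : s ≤ n := by nlinarith [Nat.le_mul_self s]
  set Ps := (range (s + 1)).filter Nat.Prime with hPs
  have hPc : Ps.card = Nat.primeCounting s := by
    rw [hPs, Nat.primeCounting, Nat.primeCounting', Nat.count_eq_card_filter_range]
  have hcard : Fintype.card ((ZMod q × ZMod q) ⊕ (ZMod q × ZMod q)) ≤ Fintype.card Ps := by
    simp only [Fintype.card_sum, Fintype.card_prod, ZMod.card, Fintype.card_coe, hPc]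
    nlinarith
  obtain ⟨φ⟩ := Function.Embedding.nonempty_of_card_le hcard
  set f : ZMod q × ZMod q → ℕ := fun P => (φ (Sum.inl P) : ℕ) with hf
  set g : ZMod q × ZMod q → ℕ := fun P => (φ (Sum.inr P) : ℕ) with hg
  have hfi : Function.Injective f := by
    intro a b h
    have := φ.injective (Subtype.ext h)
    simpa using this
  have hgi : Function.Injective g := by
    intro a b h
    have := φ.injective (Subtype.ext h)
    simpa using this
  have hfg : ∀ P L, f P ≠ g L := by
    intro a b h
    have := φ.injective (Subtype.ext h)
    simp at this
  have hmemP : ∀ z, ((φ z : ℕ)).Prime ∧ (φ z : ℕ) ≤ s := by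
    intro z
    have := (φ z).2
    simp only [hPs, mem_filter, mem_range] at this
    exact ⟨this.2, by omega⟩
  have hfp : ∀ P, (f P).Prime ∧ f P ≤ s := fun P => hmemP _
  have hgp : ∀ P, (g P).Prime ∧ g P ≤ s := fun P => hmemP _
  set Inc : ZMod q × ZMod q → ZMod q × ZMod q → Prop := fun P L => P.2 = L.1 * P.1 + L.2 with hInc
  have hC4 : ∀ P P' L L', Inc P L → Inc P L' → Inc P' L → Inc P' L' → P = P' ∨ L = L' := by
    rintro ⟨x, y⟩ ⟨x', y'⟩ ⟨m, b⟩ ⟨m', b'⟩ h1 h2 h3 h4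
    simp only [hInc] at h1 h2 h3 h4
    have hz : (m - m') * (x - x') = 0 := by linear_combination (-1:ZMod q) * h1 + h2 + h3 - h4
    rcases mul_eq_zero.1 hz with h | h
    · right
      have hm : m = m' := sub_eq_zero.1 h
      subst hm
      have : b = b' := by linear_combination h2 - h1
      rw [this]
    · left
      have hx : x = x' := sub_eq_zero.1 h
      subst hx
      rw [h1, h3]
  set E : ZMod q × ZMod q × ZMod q → ℕ := fun t => f (t.1, t.2.1 * t.1 + t.2.2) * g (t.2.1, t.2.2) with hE
  set A := (Ioc s n).filter Nat.Prime ∪ univ.image E with hA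
  have hAcl : ∀ y ∈ A, (y.Prime ∧ s < y) ∨ ∃ P L, Inc P L ∧ y = f P * g L := by
    intro y hy
    simp only [hA, mem_union, mem_filter, mem_Ioc, mem_image, mem_univ, true_and] at hy
    rcases hy with h | ⟨t, rfl⟩
    · left; exact ⟨h.2, h.1.1⟩
    · right; exact ⟨_, _, rfl, rfl⟩
  have hgood : Good n A := by
    refine ⟨?_, fun a x ha _ hprod => construction Inc hC4 f g hfi hgi hfg s hfp hgp A hAcl a x ha hprod⟩
    intro y hy
    simp only [hA, mem_union, mem_filter, mem_Ioc, mem_image, mem_univ, true_and] at hy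
    simp only [mem_Icc]
    rcases hy with h | ⟨t, rfl⟩
    · omega
    · refine ⟨Nat.mul_pos (hfp _).1.pos (hgp _).1.pos, le_trans (Nat.mul_le_mul (hfp _).2 (hgp _).2) hs⟩
  have hEinj : Function.Injective E := by
    rintro ⟨x, m, b⟩ ⟨x', m', b'⟩ h
    simp only [hE] at h
    have h1 : g (m, b) ∣ f (x', m' * x' + b') * g (m', b') := h ▸ Dvd.intro_left _ rfl
    have h2 : f (x, m * x + b) ∣ f (x', m' * x' + b') * g (m', b') := h ▸ Dvd.intro _ rfl
    rw [(hgp _).1.dvd_mul, Nat.prime_dvd_prime_iff_eq (hgp _).1 (hfp _).1, Nat.prime_dvd_prime_iff_eq (hgp _).1 (hgp _).1] at h1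
    rw [(hfp _).1.dvd_mul, Nat.prime_dvd_prime_iff_eq (hfp _).1 (hfp _).1, Nat.prime_dvd_prime_iff_eq (hfp _).1 (hgp _).1] at h2
    have h1' := hgi (h1.resolve_left (fun h => hfg _ _ h.symm))
    have h2' := hfi (h2.resolve_right (fun h => hfg _ _ h))
    simp only [Prod.mk.injEq] at h1' h2' ⊢
    exact ⟨h2'.1, h1'.1, h1'.2⟩
  have hAc : A.card = ((Ioc s n).filter Nat.Prime).card + q ^ 3 := by
    rw [hA, Finset.card_union_of_disjoint, Finset.card_image_of_injective _ hEinj]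
    · simp only [Finset.card_univ, Fintype.card_prod, ZMod.card]; ring
    · rw [Finset.disjoint_left]
      intro y hy hy'
      simp only [mem_filter, mem_image, mem_univ, true_and] at hy hy'
      obtain ⟨t, rfl⟩ := hy'
      exact Nat.not_prime_mul (hfp _).1.ne_one (hgp _).1.ne_one hy.2
  have h1 := good_le n A hgood
  have h2 := card_primes_Ioc s n hsn
  omega

lemma lower_final : ∀ᶠ n : ℕ in atTop,
    (Nat.primeCounting n : ℝ) + (1/256 : ℝ) * ((n:ℝ) ^ ((3:ℝ)/4) / (Real.log n) ^ ((3:ℝ)/2)) < fkd 6 3 n := by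
  have hst : Tendsto Nat.sqrt atTop atTop := by
    rw [tendsto_atTop]
    intro b
    filter_upwards [eventually_ge_atTop (b * b)] with n hn
    exact Nat.le_sqrt.2 hn
  have hlog : ∀ᶠ s : ℕ in atTop, Real.log ((s:ℝ) + 1) ≤ 0.09 * (s + 1) := by
    have h1 := Real.isLittleO_log_id_atTop.bound (c := 0.09) (by norm_num)
    have h2 : Tendsto (fun s : ℕ => (s:ℝ) + 1) atTop atTop :=
      tendsto_atTop_add_const_right _ _ tendsto_natCast_atTop_atTop
    filter_upwards [h2.eventually h1] with s hs
    simp only [id, Real.norm_eq_abs] at hs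
    rw [abs_of_nonneg (by positivity : (0:ℝ) ≤ (s:ℝ) + 1)] at hs
    exact (le_abs_self _).trans hs
  have hpi : ∀ᶠ s : ℕ in atTop, 10000 ≤ Nat.primeCounting s := by
    exact Nat.tendsto_primeCounting.eventually (eventually_ge_atTop 10000)
  filter_upwards [hst.eventually hlog, hst.eventually hpi, hst.eventually (eventually_ge_atTop 2), eventually_ge_atTop 2] with n hl hp hs2 hn2
  set s := Nat.sqrt n with hs
  set m := Nat.sqrt (Nat.primeCounting s / 8) with hm
  have hm1 : m * m ≤ Nat.primeCounting s / 8 := Nat.sqrt_le _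
  have hm2 : Nat.primeCounting s / 8 < (m + 1) * (m + 1) := Nat.lt_succ_sqrt _
  have hm16 : 16 ≤ m := by
    rw [hm, Nat.le_sqrt]; omega
  obtain ⟨q, hq, hmq, hq2⟩ := Nat.exists_prime_lt_and_le_two_mul m (by omega)
  have hq1 : 2 * q ^ 2 ≤ Nat.primeCounting s := by
    have : q ^ 2 ≤ (2 * m) ^ 2 := Nat.pow_le_pow_left hq2 2
    have h8 : 8 * (m * m) ≤ Nat.primeCounting s := by omega
    nlinarith
  have hq3 : Nat.primeCounting s ≤ 8 * q ^ 2 := by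
    have : (m + 1) * (m + 1) ≤ q * q := Nat.mul_le_mul hmq hmq
    have : q ^ 2 = q * q := sq q
    omega
  have hlow := lower_q n s q (Nat.sqrt_le n) hq hq1
  have hlowR : (Nat.primeCounting n : ℝ) + (q:ℝ) ^ 3 ≤ fkd 6 3 n + Nat.primeCounting s := by exact_mod_cast hlow
  have hq3R : (Nat.primeCounting s : ℝ) ≤ 8 * (q:ℝ) ^ 2 := by exact_mod_cast hq3
  have hq16 : (17:ℝ) ≤ q := by
    have : 17 ≤ q := by omega
    exact_mod_cast this
  have hnR : (2:ℝ) ≤ n := by exact_mod_cast hn2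
  have hsR : (2:ℝ) ≤ s := by exact_mod_cast hs2
  have hln : 0 < Real.log n := Real.log_pos (by linarith)
  have hls : 0 < Real.log s := Real.log_pos (by linarith)
  have hlsn : 2 * Real.log s ≤ Real.log n := by
    have h1 : ((s:ℝ)) ^ 2 ≤ n := by
      have := Nat.sqrt_le' n
      exact_mod_cast this
    have := Real.log_le_log (by positivity) h1
    rw [Real.log_pow] at this
    push_cast at this; exact this
  have hsq : √(n:ℝ) ≤ 2 * s := by
    rw [Real.sqrt_le_left (by positivity)]
    have : n < (s + 1) * (s + 1) := Nat.lt_succ_sqrt _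
    have h2 : (n:ℝ) < (s + 1) * (s + 1) := by exact_mod_cast this
    nlinarith
  have hpi2 : √(n:ℝ) / (2 * Real.log n) ≤ Nat.primeCounting s := by
    refine le_trans ?_ (Chebyshev.pi_ge s)
    have hl2 := Real.log_two_gt_d9
    have h1 : (s:ℝ) / 2 ≤ s * Real.log 2 - Real.log (s + 1) := by nlinarith
    rw [div_le_div_iff₀ (by positivity) hls]
    have h0 : (0:ℝ) ≤ s * Real.log 2 - Real.log (s + 1) := by linarith
    calc √(n:ℝ) * Real.log s ≤ (2 * s) * Real.log s := by gcongr
      _ = (s / 2) * (2 * (2 * Real.log s)) := by ring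
      _ ≤ (s * Real.log 2 - Real.log (s + 1)) * (2 * Real.log n) := by gcongr
  have hG : √(n:ℝ) / (16 * Real.log n) ≤ (q:ℝ) ^ 2 := by
    have : √(n:ℝ) / (16 * Real.log n) = (√(n:ℝ) / (2 * Real.log n)) / 8 := by field_simp; norm_num
    rw [this]; linarith
  have hG3 : (√(n:ℝ) / (16 * Real.log n)) ^ ((3:ℝ)/2) ≤ (q:ℝ) ^ 3 := by
    calc _ ≤ ((q:ℝ) ^ 2) ^ ((3:ℝ)/2) := Real.rpow_le_rpow (by positivity) hG (by norm_num)
      _ = (q:ℝ) ^ 3 := by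
        rw [← Real.rpow_natCast, ← Real.rpow_natCast, ← Real.rpow_mul (by positivity)]; norm_num
  have hG4 : (√(n:ℝ) / (16 * Real.log n)) ^ ((3:ℝ)/2) = (1/64) * ((n:ℝ) ^ ((3:ℝ)/4) / (Real.log n) ^ ((3:ℝ)/2)) := by
    rw [Real.div_rpow (by positivity) (by positivity), Real.mul_rpow (by norm_num) hln.le, Real.sqrt_eq_rpow,
      ← Real.rpow_mul (by positivity)]
    have : (16:ℝ) ^ ((3:ℝ)/2) = 64 := by
      rw [show (16:ℝ) = 4 ^ (2:ℝ) by norm_num, ← Real.rpow_mul (by norm_num)]; norm_num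
    rw [this]; norm_num
    field_simp
  rw [hG4] at hG3
  have hpos : 0 < (n:ℝ) ^ ((3:ℝ)/4) / (Real.log n) ^ ((3:ℝ)/2) := by positivity
  have hq32 : 8 * (q:ℝ) ^ 2 ≤ (q:ℝ) ^ 3 / 2 := by nlinarith [sq_nonneg (q:ℝ)]
  linarith

theorem stmt_8 : ∃ c1 c2 : ℝ, 0 < c1 ∧ 0 < c2 ∧ ∀ᶠ n : ℕ in Filter.atTop,
    (Nat.primeCounting n : ℝ) + c1 * (n : ℝ) ^ ((3 : ℝ)/4) / (Real.log n) ^ ((3 : ℝ)/2)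
        < (fkd 6 3 n : ℝ) ∧
    (fkd 6 3 n : ℝ)
        < (Nat.primeCounting n : ℝ) + c2 * (n : ℝ) ^ ((3 : ℝ)/4) / (Real.log n) ^ ((3 : ℝ)/2) := by
  obtain ⟨c2, hc2, hup⟩ := upper_final
  refine ⟨1/256, c2 + 1, by norm_num, by linarith, ?_⟩
  filter_upwards [hup, lower_final, eventually_ge_atTop 2] with n h1 h2 hn
  constructor
  · rw [mul_div_assoc]; exact h2
  · obtain ⟨A, hA, hAc⟩ := fkd_attained n
    have h3 := h1 A hA.1 (good_sidon n A hA)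
    rw [hAc] at h3
    have hnR : (2:ℝ) ≤ n := by exact_mod_cast hn
    have hln : 0 < Real.log n := Real.log_pos (by linarith)
    have hpos : 0 < (n:ℝ) ^ ((3:ℝ)/4) / (Real.log n) ^ ((3:ℝ)/2) := by positivity
    rw [mul_div_assoc]
    linarith
end
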